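/- For any two computably enumerable sets A and D, neither of which is K-trivial, there exist a computably enumerable set B and computably enumerable prefix-free machines M_a and M_d such that B is Turing equivalent to the halting problem ∅′, K_{M_a}(B↾n) ≤ K(A↾n) for all n, and K_{M_d}(B↾n) ≤ K(D↾n) for all n. -/

import Mathlib

section
open Part Filter

open scoped Classical

namespace KPaper

/-- Binary strings. -/
abbrev Str := List Bool

/-! ### Oracle (Turing) reducibility -/

/-- The functions `ℕ →. ℕ` that are partial recursive relative to an oracle `O : ℕ →. ℕ`.
This mirrors Mathlib's `Nat.Partrec`, with an extra base case for the oracle. -/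
inductive RecursiveIn (O : ℕ →. ℕ) : (ℕ →. ℕ) → Prop
  | oracle : RecursiveIn O O
  | zero : RecursiveIn O (pure 0)
  | succ : RecursiveIn O ↑Nat.succ
  | left : RecursiveIn O ↑fun n : ℕ => n.unpair.1
  | right : RecursiveIn O ↑fun n : ℕ => n.unpair.2
  | pair {f g} : RecursiveIn O f → RecursiveIn O g →
      RecursiveIn O fun n => Nat.pair <$> f n <*> g n
  | comp {f g} : RecursiveIn O f → RecursiveIn O g → RecursiveIn O fun n => g n >>= f
  | prec {f g} : RecursiveIn O f → RecursiveIn O g → RecursiveIn O (Nat.unpaired fun a n =>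
      n.rec (f a) fun y IH => do let i ← IH; g (Nat.pair a (Nat.pair y i)))
  | rfind {f} : RecursiveIn O f →
      RecursiveIn O fun a => Nat.rfind fun n => (fun m => m = 0) <$> f (Nat.pair a n)

/-- The characteristic (partial) function of a set of naturals, used as a Turing oracle. -/
noncomputable def chi (A : Set ℕ) : ℕ →. ℕ := fun n => Part.some (if n ∈ A then 1 else 0)

/-- The characteristic function of an infinite binary sequence, used as a Turing oracle. -/
def chiSeq (X : ℕ → Bool) : ℕ →. ℕ := fun n => Part.some (cond (X n) 1 0)

/-- `A` is Turing reducible to `B`. -/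
noncomputable def TuringLeSet (A B : Set ℕ) : Prop := RecursiveIn (chi B) (chi A)

/-- `A` is Turing equivalent to `B`. -/
noncomputable def TuringEquivSet (A B : Set ℕ) : Prop := TuringLeSet A B ∧ TuringLeSet B A

/-- Turing equivalence between a set and an infinite binary sequence. -/
noncomputable def TuringEquivSetSeq (A : Set ℕ) (X : ℕ → Bool) : Prop :=
  RecursiveIn (chiSeq X) (chi A) ∧ RecursiveIn (chi A) (chiSeq X)

/-- The halting problem `∅'`. -/
def haltingSet : Set ℕ := {n | ((Denumerable.ofNat Nat.Partrec.Code n).eval n).Dom}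

/-- A set of naturals is computably enumerable iff it is the domain of a
partial computable function. -/
def CESet (A : Set ℕ) : Prop := ∃ f : ℕ →. ℕ, Nat.Partrec f ∧ ∀ n, n ∈ A ↔ (f n).Dom

/-! ### Machines and Kolmogorov complexity -/

/-- A (plain) machine is a partial computable map from binary strings to binary strings. -/
def PlainMachine (M : Str →. Str) : Prop := Partrec M

/-- A prefix-free machine: a partial computable map on binary strings whose
domain is an antichain under the prefix relation. -/
def PFMachine (M : Str →. Str) : Prop :=
  Partrec M ∧ ∀ ρ₁ ρ₂ : Str, (M ρ₁).Dom → (M ρ₂).Dom → ρ₁ <+: ρ₂ → ρ₁ = ρ₂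

/-- The Kolmogorov complexity of a string `σ` with respect to a machine `M`:
the least length of an `M`-description of `σ` (`⊤` if there is none). -/
noncomputable def KC (M : Str →. Str) (σ : Str) : ℕ∞ :=
  ⨅ ρ : {ρ : Str // σ ∈ M ρ}, ((ρ : Str).length : ℕ∞)

/-- An optimal prefix-free machine: a prefix-free machine whose associated complexity
is minimal, up to an additive constant, among all prefix-free machines. -/
def OptimalPF (U : Str →. Str) : Prop :=
  PFMachine U ∧ ∀ M : Str →. Str, PFMachine M → ∃ c : ℕ, ∀ σ : Str, KC U σ ≤ KC M σ + c

/-- An optimal plain machine. -/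
def OptimalPlain (V : Str →. Str) : Prop :=
  PlainMachine V ∧ ∀ M : Str →. Str, PlainMachine M → ∃ c : ℕ, ∀ σ : Str, KC V σ ≤ KC M σ + c

/-! ### Initial segments -/

/-- The first `n` bits of the characteristic sequence of a set of naturals. -/
noncomputable def restrSet (A : Set ℕ) (n : ℕ) : Str :=
  (List.range n).map fun i => decide (i ∈ A)

/-- The first `n` bits of an infinite binary sequence. -/
def restrSeq (X : ℕ → Bool) (n : ℕ) : Str := (List.range n).map X

/-- The string `0^n`; `K(n)` is identified with `K(0^n)`. -/
def zeroStr (n : ℕ) : Str := List.replicate n false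

/-! ### `≤_K`, `<_K`, `K`-triviality (and the `≤_C` analogues) -/

def KLeSet (U : Str →. Str) (A B : Set ℕ) : Prop :=
  ∃ c : ℕ, ∀ n, KC U (restrSet A n) ≤ KC U (restrSet B n) + c

def KLtSet (U : Str →. Str) (A B : Set ℕ) : Prop := KLeSet U A B ∧ ¬ KLeSet U B A

def KTrivialSet (U : Str →. Str) (A : Set ℕ) : Prop :=
  ∃ c : ℕ, ∀ n, KC U (restrSet A n) ≤ KC U (zeroStr n) + c

def KLeSeq (U : Str →. Str) (X Y : ℕ → Bool) : Prop :=
  ∃ c : ℕ, ∀ n, KC U (restrSeq X n) ≤ KC U (restrSeq Y n) + c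

def KLtSeq (U : Str →. Str) (X Y : ℕ → Bool) : Prop := KLeSeq U X Y ∧ ¬ KLeSeq U Y X

def KTrivialSeq (U : Str →. Str) (X : ℕ → Bool) : Prop :=
  ∃ c : ℕ, ∀ n, KC U (restrSeq X n) ≤ KC U (zeroStr n) + c

/-! ### Computably enumerable reals -/

/-- The real number in `[0,1]` whose binary expansion is the sequence `X`. -/
noncomputable def realOfSeq (X : ℕ → Bool) : ℝ := ∑' i : ℕ, cond (X i) ((2 : ℝ) ^ (i + 1))⁻¹ 0

/-- `X` (identified with the real it is the binary expansion of) is a computably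
enumerable real: it is the limit of a nondecreasing computable sequence of
(dyadic) rationals. -/
def CEReal (X : ℕ → Bool) : Prop :=
  ∃ f : ℕ → ℤ, Computable f ∧
    (∀ s, (f s : ℝ) / 2 ^ s ≤ (f (s + 1) : ℝ) / 2 ^ (s + 1)) ∧
    Tendsto (fun s => (f s : ℝ) / 2 ^ s) atTop (nhds (realOfSeq X))

/-- The characteristic sequence of a set of naturals. -/
noncomputable def seqOfSet (A : Set ℕ) : ℕ → Bool := fun i => decide (i ∈ A)

/-! ### Solovay reducibility -/

/-- Solovay reducibility on c.e. reals: `X ≤_S Y` iff there are nondecreasing computable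
rational approximations to `X` and `Y` and a constant `c` such that at each stage the
distance to `X` is bounded by `c` times the distance to `Y`. -/
def SolovayLe (X Y : ℕ → Bool) : Prop :=
  ∃ (c : ℕ) (f g : ℕ → ℤ), Computable f ∧ Computable g ∧
    (∀ s, (f s : ℝ) / 2 ^ s ≤ (f (s + 1) : ℝ) / 2 ^ (s + 1)) ∧
    (∀ s, (g s : ℝ) / 2 ^ s ≤ (g (s + 1) : ℝ) / 2 ^ (s + 1)) ∧
    Tendsto (fun s => (f s : ℝ) / 2 ^ s) atTop (nhds (realOfSeq X)) ∧
    Tendsto (fun s => (g s : ℝ) / 2 ^ s) atTop (nhds (realOfSeq Y)) ∧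
    ∀ s, realOfSeq X - (f s : ℝ) / 2 ^ s ≤ (c : ℝ) * (realOfSeq Y - (g s : ℝ) / 2 ^ s)


end KPaper
end
namespace KPaper

theorem pfx_total {α : Type*} {a b c : List α} (h1 : a <+: c) (h2 : b <+: c) : a <+: b ∨ b <+: a :=
  (le_total a.length b.length).imp (List.prefix_of_prefix_length_le h1 h2)
    (List.prefix_of_prefix_length_le h2 h1)

/-- weight of a request -/
noncomputable def rwt : Option (ℕ × Str) → ℝ
  | none => 0
  | some q => (1/2 : ℝ)^q.1

/-- ceiling of `p * 2^l` for `p = a/2^k` -/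
def kcC (p : ℕ × ℕ) (l : ℕ) : ℕ := (p.1 * 2^l + (2^p.2 - 1)) / 2^p.2

def kcStep (p : ℕ × ℕ) (r : Option (ℕ × Str)) : ℕ × ℕ :=
  Option.casesOn r p (fun q => (kcC p q.1 + 1, q.1))

def kcP (req : ℕ → Option (ℕ × Str)) (m : ℕ) : ℕ × ℕ :=
  Nat.rec (0, 0) (fun m p => kcStep p (req m)) m

/-- binary value -/
def bval (ρ : Str) : ℕ := ρ.foldl (fun n b => 2 * n + cond b 1 0) 0

theorem primrec_pow : Primrec₂ (fun a b : ℕ => a ^ b) := by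
  have : Primrec₂ (fun a b : ℕ => (Nat.rec 1 (fun _ x => x * a) b : ℕ)) :=
    Primrec.nat_rec (Primrec.const 1)
      ((Primrec.nat_mul.comp (Primrec.snd.comp Primrec.snd) Primrec.fst).to₂)
  refine this.of_eq fun a b => ?_
  induction b with
  | zero => simp
  | succ n ih => simp [pow_succ, ih]

theorem primrec_kcC : Primrec₂ kcC := by
  unfold kcC
  have hp : Primrec fun x : (ℕ × ℕ) × ℕ => x.1.1 := Primrec.fst.comp Primrec.fst
  have hk : Primrec fun x : (ℕ × ℕ) × ℕ => x.1.2 := Primrec.snd.comp Primrec.fst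
  have h2k : Primrec fun x : (ℕ × ℕ) × ℕ => 2 ^ x.1.2 := primrec_pow.comp (Primrec.const 2) hk
  have h2l : Primrec fun x : (ℕ × ℕ) × ℕ => 2 ^ x.2 := primrec_pow.comp (Primrec.const 2) Primrec.snd
  exact Primrec.nat_div.comp (Primrec.nat_add.comp (Primrec.nat_mul.comp hp h2l)
    (Primrec.nat_sub.comp h2k (Primrec.const 1))) h2k

theorem primrec_kcStep : Primrec₂ kcStep := by
  unfold kcStep
  refine Primrec.option_casesOn Primrec.snd Primrec.fst ?_
  have hp : Primrec fun x : ((ℕ × ℕ) × Option (ℕ × Str)) × (ℕ × Str) => x.1.1 :=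
    Primrec.fst.comp Primrec.fst
  have hl : Primrec fun x : ((ℕ × ℕ) × Option (ℕ × Str)) × (ℕ × Str) => x.2.1 :=
    Primrec.fst.comp Primrec.snd
  exact Primrec.pair (Primrec.succ.comp (primrec_kcC.comp hp hl)) hl

theorem computable_kcP {req : ℕ → Option (ℕ × Str)} (h : Computable req) :
    Computable (kcP req) := by
  unfold kcP
  refine Computable.nat_rec (f := fun m : ℕ => m) (g := fun _ : ℕ => ((0, 0) : ℕ × ℕ))
    (h := fun _ (x : ℕ × (ℕ × ℕ)) => kcStep x.2 (req x.1)) Computable.id (Computable.const (0,0)) ?_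
  exact (primrec_kcStep.to_comp.comp (Computable.snd.comp Computable.snd)
    (h.comp (Computable.fst.comp Computable.snd))).to₂

theorem primrec_bval : Primrec bval := by
  unfold bval
  refine Primrec.list_foldl (f := fun ρ : Str => ρ) (g := fun _ => (0 : ℕ))
    (h := fun _ (x : ℕ × Bool) => 2 * x.1 + cond x.2 1 0) Primrec.id (Primrec.const 0) ?_
  exact (Primrec.nat_add.comp (Primrec.nat_mul.comp (Primrec.const 2) (Primrec.fst.comp Primrec.snd))
    (Primrec.cond (Primrec.snd.comp Primrec.snd) (Primrec.const 1) (Primrec.const 0))).to₂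

theorem bval_append (ρ τ : Str) : bval (ρ ++ τ) = bval ρ * 2 ^ τ.length + bval τ := by
  induction τ using List.reverseRecOn with
  | nil => simp [bval]
  | append_singleton l a ih =>
    rw [← List.append_assoc]
    have h : ∀ x : Str, bval (x ++ [a]) = 2 * bval x + cond a 1 0 := by
      intro x; simp [bval]
    rw [h, h, ih]; simp [pow_succ]; ring

theorem bval_lt (ρ : Str) : bval ρ < 2 ^ ρ.length := by
  induction ρ using List.reverseRecOn with
  | nil => simp [bval]
  | append_singleton l a ih =>
    rw [bval_append]
    have : bval [a] < 2 := by cases a <;> simp [bval]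
    simp [pow_succ]; omega

theorem exists_bval (l c : ℕ) (h : c < 2 ^ l) : ∃ ρ : Str, ρ.length = l ∧ bval ρ = c := by
  induction l generalizing c with
  | zero => exact ⟨[], rfl, by simp only [pow_zero] at h; simp [bval]; omega⟩
  | succ n ih =>
    obtain ⟨ρ, h1, h2⟩ := ih (c / 2) (by rw [pow_succ] at h; omega)
    refine ⟨ρ ++ [decide (c % 2 = 1)], by simp [h1], ?_⟩
    rw [bval_append, h2]
    rcases Nat.mod_two_eq_zero_or_one c with h0 | h0 <;> simp [bval, h0] <;> omega

noncomputable def pv (p : ℕ × ℕ) : ℝ := p.1 / 2 ^ p.2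

theorem kcC_ge (p : ℕ × ℕ) (l : ℕ) : pv p ≤ (kcC p l : ℝ) / 2 ^ l := by
  unfold pv kcC
  have h2 : 0 < 2 ^ p.2 := by positivity
  set q := p.1 * 2 ^ l
  have : q ≤ (q + (2 ^ p.2 - 1)) / 2 ^ p.2 * 2 ^ p.2 := by
    have := Nat.div_add_mod (q + (2 ^ p.2 - 1)) (2^p.2)
    have h3 := Nat.mod_lt (q + (2 ^ p.2 - 1)) h2
    rw [mul_comm] at this
    omega
  rw [div_le_div_iff₀ (by positivity) (by positivity)]
  exact_mod_cast this

theorem kcC_le (p : ℕ × ℕ) (l : ℕ) : (kcC p l : ℝ) / 2 ^ l ≤ pv p + (1/2)^l := by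
  unfold pv kcC
  have h2 : 0 < 2 ^ p.2 := by positivity
  set q := p.1 * 2 ^ l with hq
  have : (q + (2 ^ p.2 - 1)) / 2 ^ p.2 * 2 ^ p.2 ≤ q + 2 ^ p.2 := by
    have := Nat.div_mul_le_self (q + (2 ^ p.2 - 1)) (2^p.2)
    omega
  have h3 : (((q + (2 ^ p.2 - 1)) / 2 ^ p.2 : ℕ) : ℝ) * 2 ^ p.2 ≤ p.1 * 2 ^ l + 2 ^ p.2 := by
    rw [hq] at this ⊢
    exact_mod_cast this
  rw [one_div, inv_pow, ← one_div, div_add_div _ _ (by positivity) (by positivity), div_le_div_iff₀ (by positivity) (by positivity)]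
  have : (0:ℝ) < 2 ^ l := by positivity
  nlinarith

theorem pv_mono {req : ℕ → Option (ℕ × Str)} {m m' : ℕ} (h : m ≤ m') :
    pv (kcP req m) ≤ pv (kcP req m') := by
  induction m', h using Nat.le_induction with
  | base => exact le_rfl
  | succ n hn ih =>
    refine ih.trans ?_
    change _ ≤ pv (kcStep (kcP req n) (req n))
    cases hr : req n with
    | none => simp [kcStep]
    | some q =>
      simp only [kcStep]
      refine (kcC_ge _ q.1).trans ?_
      simp only [pv]
      gcongr; linarith

theorem pv_le {req : ℕ → Option (ℕ × Str)} (m : ℕ) :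
    pv (kcP req m) ≤ 2 * ∑ i ∈ Finset.range m, rwt (req i) := by
  induction m with
  | zero => simp [kcP, pv]
  | succ n ih =>
    rw [Finset.sum_range_succ]
    change pv (kcStep (kcP req n) (req n)) ≤ _
    cases hr : req n with
    | none => simpa [kcStep, rwt] using ih
    | some q =>
      simp only [kcStep]
      rw [show rwt (some q) = (1/2 : ℝ)^q.1 from rfl]
      have := kcC_le (kcP req n) q.1
      have h3 : pv (kcC (kcP req n) q.1 + 1, q.1) = (kcC (kcP req n) q.1 : ℝ) / 2 ^ q.1 + (1/2)^q.1 := by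
        simp [pv, add_div]
      rw [h3]; linarith

/-- test used by the KC machine -/
def kcT (p : ℕ × ℕ) (r : Option (ℕ × Str)) (ρ : Str) : Option Str :=
  Option.casesOn r none (fun q => if q.1 = ρ.length ∧ kcC p q.1 = bval ρ then some q.2 else none)

theorem primrec_kcT : Primrec fun x : ((ℕ × ℕ) × Option (ℕ × Str)) × Str => kcT x.1.1 x.1.2 x.2 := by
  unfold kcT
  refine Primrec.option_casesOn (Primrec.snd.comp Primrec.fst) (Primrec.const none) ?_
  have hq : Primrec fun x : (((ℕ × ℕ) × Option (ℕ × Str)) × Str) × (ℕ × Str) => x.2.1 :=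
    Primrec.fst.comp Primrec.snd
  have hρ : Primrec fun x : (((ℕ × ℕ) × Option (ℕ × Str)) × Str) × (ℕ × Str) => x.1.2 :=
    Primrec.snd.comp Primrec.fst
  have hp : Primrec fun x : (((ℕ × ℕ) × Option (ℕ × Str)) × Str) × (ℕ × Str) => x.1.1.1 :=
    Primrec.fst.comp (Primrec.fst.comp Primrec.fst)
  exact (Primrec.ite (PrimrecPred.and (Primrec.eq.comp hq (Primrec.list_length.comp hρ))
    (Primrec.eq.comp (primrec_kcC.comp hp hq) (primrec_bval.comp hρ)))
    (Primrec.option_some.comp (Primrec.snd.comp Primrec.snd)) (Primrec.const none)).to₂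

theorem kc_thm (req : ℕ → Option (ℕ × Str)) (hreq : Computable req)
    (hs : ∀ T, ∑ m ∈ Finset.range T, rwt (req m) ≤ 1/2) :
    ∃ N, PFMachine N ∧ ∀ m l σ, req m = some (l, σ) → ∃ ρ : Str, ρ.length = l ∧ σ ∈ N ρ := by
  set p := kcP req with hp
  let N : Str →. Str := fun ρ => Nat.rfindOpt fun m => kcT (p m) (req m) ρ
  have hT : ∀ m ρ σ, kcT (p m) (req m) ρ = some σ → 
      ∃ l, req m = some (l, σ) ∧ l = ρ.length ∧ kcC (p m) l = bval ρ := by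
    intro m ρ σ h
    unfold kcT at h
    cases hr : req m with
    | none => simp [hr] at h
    | some q =>
      simp only [hr] at h
      split_ifs at h with h1
      · refine ⟨q.1, ?_, h1.1, h1.2⟩
        cases h; rfl
  have hdisj : ∀ m m' l σ l' σ', req m = some (l,σ) → req m' = some (l',σ') → m < m' →
      ((kcC (p m) l : ℝ) + 1) / 2 ^ l ≤ (kcC (p m') l' : ℝ) / 2 ^ l' := by
    intro m m' l σ l' σ' h h' hlt
    refine le_trans ?_ ((pv_mono (req := req) (Nat.succ_le_of_lt hlt)).trans (kcC_ge _ l'))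
    change _ ≤ pv (kcStep (p m) (req m))
    simp [kcStep, h, pv]
  have huniq : ∀ m m' l σ l' σ' (ρ ρ' : Str), req m = some (l,σ) → req m' = some (l',σ') →
      l = ρ.length → l' = ρ'.length → kcC (p m) l = bval ρ → kcC (p m') l' = bval ρ' → 
      ρ <+: ρ' → m = m' := by
    intro m m' l σ l' σ' ρ ρ' h h' hl hl' hc hc' hpre
    obtain ⟨ξ, rfl⟩ := hpre
    rw [bval_append] at hc'
    have hξ := bval_lt ξ
    have e1 : (bval ρ : ℝ) / 2 ^ l ≤ (kcC (p m') l' : ℝ) / 2 ^ l' := by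
      rw [hc', hl, hl', List.length_append, pow_add, div_le_div_iff₀ (by positivity) (by positivity)]
      push_cast
      have : (0:ℝ) ≤ bval ξ * 2 ^ ρ.length := by positivity
      nlinarith
    have e2 : (kcC (p m') l' : ℝ) / 2 ^ l' < ((bval ρ : ℝ) + 1) / 2 ^ l := by
      rw [hc', hl, hl', List.length_append, pow_add, div_lt_div_iff₀ (by positivity) (by positivity)]
      push_cast
      have h3 : (bval ξ : ℝ) < 2 ^ ξ.length := by exact_mod_cast hξ
      have : (0:ℝ) < 2 ^ ρ.length := by positivity
      nlinarith
    rcases lt_trichotomy m m' with hlt | heq | hgt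
    · have := hdisj _ _ _ _ _ _ h h' hlt
      rw [hc] at this; linarith
    · exact heq
    · have := hdisj _ _ _ _ _ _ h' h hgt
      rw [hc] at this
      have h5 : (kcC (p m') l' : ℝ) / 2 ^ l' < ((kcC (p m') l' : ℝ) + 1) / 2 ^ l' := by
        gcongr; linarith
      linarith
  refine ⟨N, ⟨?_, ?_⟩, ?_⟩
  · refine Partrec.rfindOpt ?_
    have hpc : Computable p := computable_kcP hreq
    exact primrec_kcT.to_comp.comp (Computable.pair (Computable.pair (hpc.comp Computable.snd)
      (hreq.comp Computable.snd)) Computable.fst)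
  · intro ρ ρ' h h' hpre
    obtain ⟨m, σ, hm⟩ := Nat.rfindOpt_dom.1 h
    obtain ⟨m', σ', hm'⟩ := Nat.rfindOpt_dom.1 h'
    obtain ⟨l, h1, h2, h3⟩ := hT _ _ _ hm
    obtain ⟨l', h1', h2', h3'⟩ := hT _ _ _ hm'
    have := huniq _ _ _ _ _ _ _ _ h1 h1' h2 h2' h3 h3' hpre
    subst this
    rw [h1] at h1'
    cases h1'
    exact hpre.eq_of_length (h2.symm.trans h2')
  · intro m l σ hm
    have hlt : kcC (p m) l < 2 ^ l := by
      have h1 : pv (p (m+1)) ≤ 1 := (pv_le (m+1)).trans (by have := hs (m+1); linarith)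
      change pv (kcStep (p m) (req m)) ≤ 1 at h1
      simp only [kcStep, hm, pv] at h1
      rw [div_le_one (by positivity)] at h1
      have h2 : kcC (p m) l + 1 ≤ 2 ^ l := by exact_mod_cast h1
      omega
    obtain ⟨ρ, hρ, hb⟩ := exists_bval _ _ hlt
    refine ⟨ρ, hρ, ?_⟩
    have hk : kcT (p m) (req m) ρ = some σ := by
      simp [kcT, hm, hρ, hb]
    have hd : (N ρ).Dom := Nat.rfindOpt_dom.2 ⟨m, σ, hk⟩
    obtain ⟨m', hm'⟩ := Nat.rfindOpt_spec (Part.get_mem hd)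
    obtain ⟨l', h1', h2', h3'⟩ := hT _ _ _ hm'
    have := huniq _ _ _ _ _ _ _ _ hm h1' hρ.symm h2' hb.symm h3' List.prefix_rfl
    subst this
    rw [hm] at h1'
    have h6 : σ = (N ρ).get hd := by injection h1' with h1'; injection h1'
    rw [h6]; exact Part.get_mem hd

end KPaper


namespace KPaper

section comb
open scoped Classical

/-- Data of the construction. -/
structure Dat where
  X : Bool → ℕ → ℕ → Bool
  w : ℕ → ℝ
  str : ℕ → Str
  g : ℝ
  n0 : ℕ
  kind : ℕ → ℕ
  lev : ℕ → ℕ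
  τ : ℕ → ℝ
  H : ℕ → ℕ → Bool

namespace Dat
variable (C : Dat)

def base : ℕ → ℕ → ℕ
  | 0, e => max C.n0 e
  | s+1, e => if C.kind (s+1) ≠ 0 ∧ C.lev (s+1) ≤ e then max (base s e) (s+1) else base s e

def len (i : ℕ) : ℕ := (C.str i).length

def pre (ty : Bool) (s n : ℕ) : Str := (List.range n).map (C.X ty s)

def good (ty : Bool) (i s : ℕ) : Prop := C.str i = C.pre ty s (C.len i)

noncomputable def cost (ty : Bool) (x s : ℕ) : ℝ :=
  ∑ i ∈ Finset.range s, if x < C.len i ∧ C.good ty i s then C.w i else 0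

noncomputable def S (x : ℕ) : ℝ := ∑ i ∈ Finset.range x, C.w i

def bs (i : ℕ) : ℕ := C.base (i-1) (C.lev i)

def alive (ty : Bool) (i s : ℕ) : Prop := ∀ y < C.bs i, C.X ty s y = C.X ty i y

def EvT (ty : Bool) (i : ℕ) : Prop := C.kind i = cond ty 3 2

def Ev (i : ℕ) : Prop := 2 ≤ C.kind i

noncomputable def α (ty : Bool) (e s' : ℕ) : ℕ → ℝ
  | 0 => 0
  | s+1 => if C.Ev (s+1) ∧ C.lev (s+1) < e then 0 else
      if C.EvT ty (s+1) ∧ C.lev (s+1) = e ∧ C.alive ty (s+1) s' then C.τ (s+1) + α ty e s' s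
      else α ty e s' s

noncomputable def tt (s s' e : ℕ) (G : ℝ) : ℝ :=
  max 0 (min (G * C.S (C.base s e) - C.α false e s' s) (G * C.S (C.base s e) - C.α true e s' s))

noncomputable def G (s s' : ℕ) : ℕ → ℝ
  | 0 => C.g
  | e+1 => C.tt s s' e (G s s' e) / 8

noncomputable def t (s s' e : ℕ) : ℝ := C.tt s s' e (C.G s s' e)

structure Good : Prop where
  Xmono : ∀ ty s y, C.X ty s y = true → C.X ty (s+1) y = true
  Hmono : ∀ s y, C.H s y = true → C.H (s+1) y = true
  wnn : ∀ i, 0 ≤ C.w i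
  wsum : ∀ T, C.S T ≤ 1
  len_le : ∀ i, C.len i ≤ i
  kind0 : C.kind 0 = 0
  kind_le : ∀ s, C.kind s ≤ 3
  gpos : 0 < C.g
  lev_lt : ∀ s, C.kind (s+1) ≠ 0 → C.lev (s+1) < s+1
  tau_eq : ∀ s, C.kind (s+1) ≠ 0 → C.τ (s+1) = C.t s (s+1) (C.lev (s+1))
  ev_cost : ∀ ty s, C.EvT ty (s+1) → C.τ (s+1) < C.cost ty (C.base s (C.lev (s+1))) (s+1)
  quiet : ∀ s e, e < s+1 → (C.kind (s+1) ≠ 0 → e < C.lev (s+1)) → ∀ ty,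
    C.cost ty (C.base s e) (s+1) ≤ C.t s (s+1) e
  code : ∀ s, C.kind (s+1) = 1 → C.H (s+1) (C.lev (s+1)) = true ∧ C.H s (C.lev (s+1)) = false
  code' : ∀ s e, C.H (s+1) e = true → C.H s e = false → e < s+1 →
    C.kind (s+1) ≠ 0 ∧ C.lev (s+1) ≤ e
  desc : ∀ ty n, ∃ i, n < C.len i ∧ 0 < C.w i ∧ ∃ s1, ∀ s ≥ s1, C.good ty i s

variable {C}

theorem base_mono_s {s s' : ℕ} (h : s ≤ s') (e : ℕ) : C.base s e ≤ C.base s' e := by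
  induction s', h using Nat.le_induction with
  | base => exact le_rfl
  | succ n hn ih =>
    refine ih.trans ?_
    simp only [base]; split_ifs <;> simp

theorem base_mono_e (s : ℕ) {e e' : ℕ} (h : e ≤ e') : C.base s e ≤ C.base s e' := by
  induction s with
  | zero => simp only [base]; omega
  | succ n ih => simp only [base]; split_ifs <;> omega

theorem base_ge (s e : ℕ) : C.n0 ≤ C.base s e ∧ e ≤ C.base s e := by
  have := base_mono_s (C := C) (Nat.zero_le s) e
  simp only [base] at this; omega

theorem base_act {s e : ℕ} (h : C.kind (s+1) ≠ 0) (h' : C.lev (s+1) ≤ e) : s+1 ≤ C.base (s+1) e := by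
  simp [base, h, h']

theorem Ev_of_EvT {ty : Bool} {i : ℕ} (h : C.EvT ty i) : C.Ev i := by
  cases ty <;> simp_all [EvT, Ev]

theorem Ev_kind {i : ℕ} (h : C.Ev i) : C.kind i ≠ 0 := by
  simp only [Ev] at h; omega

theorem base_eq {s e : ℕ} (h : C.kind (s+1) ≠ 0 → e < C.lev (s+1)) :
    C.base (s+1) e = C.base s e := by
  simp only [base]; rw [if_neg]; rintro ⟨h1, h2⟩; have := h h1; omega

theorem Good.X_le (hC : C.Good) {ty : Bool} {s s' : ℕ} (h : s ≤ s') {y : ℕ} (hx : C.X ty s y = true) :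
    C.X ty s' y = true := by
  induction s', h using Nat.le_induction with
  | base => exact hx
  | succ n hn ih => exact hC.Xmono _ _ _ ih

theorem Good.H_le (hC : C.Good) {s s' : ℕ} (h : s ≤ s') {y : ℕ} (hx : C.H s y = true) :
    C.H s' y = true := by
  induction s', h using Nat.le_induction with
  | base => exact hx
  | succ n hn ih => exact hC.Hmono _ _ ih

theorem Good.X_btw (hC : C.Good) {ty : Bool} {a b c : ℕ} (h : a ≤ b) (h' : b ≤ c) {y : ℕ}
    (hx : C.X ty c y = C.X ty a y) : C.X ty b y = C.X ty a y := by
  cases hb : C.X ty b y with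
  | true => rw [← hx]; exact (hC.X_le h' hb).symm
  | false =>
    cases ha : C.X ty a y with
    | true => rw [hC.X_le h ha] at hb; cases hb
    | false => rfl

theorem Good.alive_anti (hC : C.Good) {ty : Bool} {i s s' : ℕ} (hi : i ≤ s) (h : s ≤ s')
    (ha : C.alive ty i s') : C.alive ty i s :=
  fun y hy => hC.X_btw hi h (ha y hy)

theorem alive_self {ty : Bool} {i : ℕ} : C.alive ty i i := fun _ _ => rfl

theorem Good.S_mono (hC : C.Good) {x y : ℕ} (h : x ≤ y) : C.S x ≤ C.S y :=
  Finset.sum_le_sum_of_subset_of_nonneg (by intro a; simp; omega) fun i _ _ => hC.wnn i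

theorem Good.S_nn (hC : C.Good) (x : ℕ) : 0 ≤ C.S x := Finset.sum_nonneg fun i _ => hC.wnn i

theorem tt_nn (s s' e : ℕ) (x : ℝ) : 0 ≤ C.tt s s' e x := le_max_left _ _

theorem t_nn (s s' e : ℕ) : 0 ≤ C.t s s' e := tt_nn ..

theorem Good.G_nn (hC : C.Good) (s s' e : ℕ) : 0 ≤ C.G s s' e := by
  cases e with
  | zero => exact hC.gpos.le
  | succ n => have := tt_nn (C := C) s s' n (C.G s s' n); simp only [G]; positivity

theorem Good.tau_nn (hC : C.Good) {s : ℕ} (h : C.kind s ≠ 0) : 0 ≤ C.τ s := by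
  cases s with
  | zero => exact absurd hC.kind0 h
  | succ n => rw [hC.tau_eq n h]; exact t_nn ..

theorem Good.α_nn (hC : C.Good) (ty : Bool) (e s' s : ℕ) : 0 ≤ C.α ty e s' s := by
  induction s with
  | zero => simp [α]
  | succ n ih =>
    simp only [α]; split_ifs with h1 h2
    · rfl
    · have := hC.tau_nn (Ev_kind (Ev_of_EvT h2.1)); linarith
    · exact ih

theorem Good.α_anti (hC : C.Good) (ty : Bool) (e : ℕ) {s s' s'' : ℕ} (h : s ≤ s') (h' : s' ≤ s'') :
    C.α ty e s'' s ≤ C.α ty e s' s := by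
  induction s with
  | zero => simp [α]
  | succ n ih =>
    have ih := ih (by omega)
    simp only [α]
    by_cases h1 : C.Ev (n+1) ∧ C.lev (n+1) < e
    · simp [h1]
    · rw [if_neg h1, if_neg h1]
      split_ifs with h2 h3 h3
      · linarith
      · exact absurd ⟨h2.1, h2.2.1, hC.alive_anti (by omega) h' h2.2.2⟩ h3
      · have := hC.tau_nn (Ev_kind (Ev_of_EvT h3.1)); linarith
      · exact ih

theorem Good.tt_mono (hC : C.Good) {s s' s'' e : ℕ} (h : s ≤ s') (h' : s' ≤ s'') {x y : ℝ} (hxy : x ≤ y) :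
    C.tt s s' e x ≤ C.tt s s'' e y := by
  have h1 := hC.α_anti false e h h'
  have h2 := hC.α_anti true e h h'
  have h3 := mul_le_mul_of_nonneg_right hxy (hC.S_nn (C.base s e))
  unfold tt
  gcongr

theorem Good.G_mono' (hC : C.Good) {s s' s'' : ℕ} (h : s ≤ s') (h' : s' ≤ s'') (e : ℕ) :
    C.G s s' e ≤ C.G s s'' e := by
  induction e with
  | zero => exact le_rfl
  | succ n ih => simp only [G]; have := hC.tt_mono (e := n) h h' ih; linarith

theorem Good.t_mono' (hC : C.Good) {s s' s'' : ℕ} (h : s ≤ s') (h' : s' ≤ s'') (e : ℕ) :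
    C.t s s' e ≤ C.t s s'' e := hC.tt_mono h h' (hC.G_mono' h h' e)

/-- `α` does not change at `s+1` unless there is an event of level `≤ e`. -/
theorem α_eq {ty : Bool} {e s s' : ℕ} (h : C.Ev (s+1) → e < C.lev (s+1)) :
    C.α ty e s' (s+1) = C.α ty e s' s := by
  simp only [α]
  rw [if_neg, if_neg]
  · rintro ⟨h1, h2, h3⟩; have := h (Ev_of_EvT h1); omega
  · rintro ⟨h1, h2⟩; have := h h1; omega

theorem tt_eq {e s s' : ℕ} (h : C.kind (s+1) ≠ 0 → e < C.lev (s+1)) (x : ℝ) :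
    C.tt (s+1) s' e x = C.tt s s' e x := by
  unfold tt
  rw [base_eq h, α_eq fun h1 => h (Ev_kind h1), α_eq fun h1 => h (Ev_kind h1)]

theorem G_eq {e s s' : ℕ} (h : C.kind (s+1) ≠ 0 → e ≤ C.lev (s+1)) :
    C.G (s+1) s' e = C.G s s' e := by
  induction e with
  | zero => rfl
  | succ n ih =>
    simp only [G]
    rw [ih fun h1 => (Nat.le_succ n).trans (h h1), tt_eq fun h1 => h h1]

theorem t_eq {e s s' : ℕ} (h : C.kind (s+1) ≠ 0 → e < C.lev (s+1)) :
    C.t (s+1) s' e = C.t s s' e := by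
  unfold t
  rw [G_eq fun h1 => (h h1).le, tt_eq h]

theorem Good.tt_le (hC : C.Good) {e s s' : ℕ} (h : C.Ev (s+1) → e < C.lev (s+1)) {x y : ℝ} (hx : 0 ≤ x)
    (hxy : x ≤ y) :
    C.tt s s' e x ≤ C.tt (s+1) s' e y := by
  unfold tt
  rw [α_eq h, α_eq h]
  have h3 := mul_le_mul hxy (hC.S_mono (base_mono_s (C := C) (Nat.le_succ s) e)) (hC.S_nn _) (hx.trans hxy)
  gcongr

theorem Good.G_le (hC : C.Good) {e s s' : ℕ} (h : C.Ev (s+1) → e ≤ C.lev (s+1)) :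
    C.G s s' e ≤ C.G (s+1) s' e := by
  induction e with
  | zero => exact le_rfl
  | succ n ih =>
    simp only [G]
    have := hC.tt_le (e := n) (s' := s') (fun h1 => h h1) (hC.G_nn s s' n) (ih fun h1 => (Nat.le_succ n).trans (h h1))
    linarith

theorem Good.J' (hC : C.Good) (ty : Bool) (e s : ℕ) (hJ : C.α ty e s s ≤ C.G s s e * C.S (C.base s e)) :
    C.α ty e (s+1) s ≤ C.G s (s+1) e * C.S (C.base s e) := by
  refine (hC.α_anti ty e le_rfl (Nat.le_succ s)).trans (hJ.trans ?_)
  exact mul_le_mul_of_nonneg_right (hC.G_mono' le_rfl (Nat.le_succ s) e) (hC.S_nn _)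

theorem Good.tt_le_ty (_hC : C.Good) (ty : Bool) {e s s' : ℕ} {x : ℝ}
    (h : C.α ty e s' s ≤ x * C.S (C.base s e)) :
    C.tt s s' e x ≤ x * C.S (C.base s e) - C.α ty e s' s := by
  unfold tt
  refine max_le (by linarith) ?_
  cases ty
  · exact min_le_left _ _
  · exact min_le_right _ _

theorem Good.J (hC : C.Good) (ty : Bool) (e s : ℕ) : C.α ty e s s ≤ C.G s s e * C.S (C.base s e) := by
  induction s with
  | zero => simp only [α]; exact mul_nonneg (hC.G_nn ..) (hC.S_nn _)
  | succ n ih =>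
    have h0 := hC.J' ty e n ih
    have hS := hC.S_mono (base_mono_s (C := C) (Nat.le_succ n) e)
    rw [α]
    split_ifs with h1 h2
    · exact mul_nonneg (hC.G_nn ..) (hC.S_nn _)
    · obtain ⟨h2, rfl, h4⟩ := h2
      have hk := Ev_kind (Ev_of_EvT h2)
      rw [hC.tau_eq n hk, G_eq (fun _ => le_rfl), t]
      have := hC.tt_le_ty ty h0
      have h5 := mul_le_mul_of_nonneg_left hS (hC.G_nn n (n+1) (C.lev (n+1)))
      linarith
    · refine h0.trans (mul_le_mul (hC.G_le ?_) hS (hC.S_nn _) (hC.G_nn ..))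
      intro h; by_contra h3; exact h1 ⟨h, by omega⟩

theorem Good.J1 (hC : C.Good) (ty : Bool) (e s : ℕ) :
    C.α ty e (s+1) s ≤ C.G s (s+1) e * C.S (C.base s e) := hC.J' ty e s (hC.J ty e s)

theorem Good.cost_zero (hC : C.Good) {ty : Bool} {x s : ℕ} (h : s ≤ x) : C.cost ty x s = 0 := by
  refine Finset.sum_eq_zero fun i hi => if_neg ?_
  have := hC.len_le i
  simp at hi; omega

theorem Good.inv (hC : C.Good) (ty : Bool) (s e : ℕ) : C.cost ty (C.base s e) s ≤ C.t s s e := by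
  cases s with
  | zero => rw [hC.cost_zero (Nat.zero_le _)]; exact t_nn ..
  | succ s =>
    by_cases he : e < s+1
    · by_cases h : C.kind (s+1) ≠ 0 → e < C.lev (s+1)
      · rw [base_eq h, t_eq h]; exact hC.quiet s e he h ty
      · push Not at h
        rw [hC.cost_zero (base_act h.1 h.2)]; exact t_nn ..
    · rw [hC.cost_zero (by have := base_ge (C := C) (s+1) e; omega)]; exact t_nn ..

theorem Good.tt_le_self (hC : C.Good) (s s' e : ℕ) {x : ℝ} (hx : 0 ≤ x) : C.tt s s' e x ≤ x := by
  unfold tt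
  refine max_le hx ((min_le_left _ _).trans ?_)
  have h1 := mul_le_mul_of_nonneg_left (hC.wsum (C.base s e)) hx
  have := hC.α_nn false e s' s
  linarith

theorem Good.G_bd (hC : C.Good) (s s' e d : ℕ) : C.G s s' (e+d) ≤ C.G s s' e / 8 ^ d := by
  induction d with
  | zero => simp
  | succ n ih =>
    rw [← add_assoc, G, pow_succ, ← div_div]
    have := hC.tt_le_self s s' (e+n) (hC.G_nn s s' (e+n))
    linarith

theorem Good.t_bd (hC : C.Good) (s s' e : ℕ) : C.t s s' e ≤ C.g / 8 ^ e := by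
  have := hC.G_bd s s' 0 e
  rw [zero_add] at this
  exact (hC.tt_le_self s s' e (hC.G_nn ..)).trans this

theorem Good.G_bd_t (hC : C.Good) (s s' e d : ℕ) : C.G s s' (e+1+d) ≤ C.t s s' e / 8 ^ (d+1) := by
  refine (hC.G_bd s s' (e+1) d).trans ?_
  rw [G, t, div_div, pow_succ, mul_comm (8:ℝ)]

end Dat
end comb
end KPaper


namespace KPaper

section comb
open scoped Classical
namespace Dat
variable {C : Dat}

/-- no event of level `< e` in `(i, s]` -/
def nolow (C : Dat) (e i s : ℕ) : Prop := ∀ m, i < m → m ≤ s → ¬ (C.Ev m ∧ C.lev m < e)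

def cnt (C : Dat) (ty : Bool) (e s' i s : ℕ) : Prop :=
  C.EvT ty i ∧ C.lev i = e ∧ C.alive ty i s' ∧ C.nolow e i s

theorem cnt_low {ty : Bool} {e s' i s : ℕ} (h : C.Ev (s+1) ∧ C.lev (s+1) < e) (hi : i ≤ s+1) :
    ¬ C.cnt ty e s' i (s+1) := by
  rintro ⟨h1, h2, h3, h4⟩
  rcases hi.eq_or_lt with rfl | h5
  · omega
  · exact h4 _ h5 le_rfl h

theorem cnt_succ {ty : Bool} {e s' i s : ℕ} (h : ¬ (C.Ev (s+1) ∧ C.lev (s+1) < e)) (_hi : i ≤ s) :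
    C.cnt ty e s' i (s+1) ↔ C.cnt ty e s' i s := by
  unfold cnt nolow
  constructor
  · rintro ⟨h1, h2, h3, h4⟩
    exact ⟨h1, h2, h3, fun m hm hm' => h4 m hm (by omega)⟩
  · rintro ⟨h1, h2, h3, h4⟩
    refine ⟨h1, h2, h3, fun m hm hm' => ?_⟩
    rcases hm'.eq_or_lt with rfl | h5
    · exact h
    · exact h4 m hm (by omega)

theorem cnt_last {ty : Bool} {e s' s : ℕ} :
    C.cnt ty e s' s s ↔ (C.EvT ty s ∧ C.lev s = e ∧ C.alive ty s s') := by
  unfold cnt nolow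
  constructor
  · rintro ⟨h1, h2, h3, h4⟩; exact ⟨h1, h2, h3⟩
  · rintro ⟨h1, h2, h3⟩; exact ⟨h1, h2, h3, fun m h h' => by omega⟩

/-- general summation principle over counted events -/
theorem cnt_sum (ty : Bool) (e s' : ℕ) (φ : ℕ → ℝ) (F : ℕ → ℝ)
    (hk : C.kind 0 = 0) (h0 : F 0 = 0)
    (hlow : ∀ s, (C.Ev (s+1) ∧ C.lev (s+1) < e) → F (s+1) = 0)
    (hadd : ∀ s, ¬ (C.Ev (s+1) ∧ C.lev (s+1) < e) →
      (C.EvT ty (s+1) ∧ C.lev (s+1) = e ∧ C.alive ty (s+1) s') → s+1 ≤ s' → F (s+1) = φ (s+1) + F s)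
    (hsame : ∀ s, ¬ (C.Ev (s+1) ∧ C.lev (s+1) < e) →
      ¬ (C.EvT ty (s+1) ∧ C.lev (s+1) = e ∧ C.alive ty (s+1) s') → F (s+1) = F s) (s : ℕ) (hs : s ≤ s') :
    F s = ∑ i ∈ Finset.range (s+1), if C.cnt ty e s' i s then φ i else 0 := by
  induction s with
  | zero =>
    rw [h0]; simp [cnt_last, EvT, hk]; intro h; cases ty <;> simp at h
  | succ n ih =>
    have ih := ih (by omega)
    by_cases h1 : C.Ev (n+1) ∧ C.lev (n+1) < e
    · rw [hlow n h1]
      symm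
      refine Finset.sum_eq_zero fun i hi => if_neg (cnt_low h1 ?_)
      simp at hi; omega
    · have e1 : ∑ i ∈ Finset.range (n+1), (if C.cnt ty e s' i (n+1) then φ i else 0) = F n := by
        rw [ih]
        refine Finset.sum_congr rfl fun i hi => ?_
        simp at hi
        simp only [cnt_succ h1 (by omega : i ≤ n)]
      rw [Finset.sum_range_succ, e1]
      by_cases h2 : C.EvT ty (n+1) ∧ C.lev (n+1) = e ∧ C.alive ty (n+1) s'
      · rw [hadd n h1 h2 hs, if_pos (cnt_last.2 h2), add_comm]
      · rw [hsame n h1 h2, if_neg fun h => h2 (cnt_last.1 h), add_zero]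

theorem Good.α_sum (hC : C.Good) (ty : Bool) (e s' s : ℕ) (hs : s ≤ s') :
    C.α ty e s' s = ∑ i ∈ Finset.range (s+1), if C.cnt ty e s' i s then C.τ i else 0 := by
  refine cnt_sum ty e s' C.τ (C.α ty e s') hC.kind0 rfl ?_ ?_ ?_ s hs
  · intro s h; simp [α, h]
  · intro s h h' _; rw [α, if_neg h, if_pos h']
  · intro s h h'; rw [α, if_neg h, if_neg h']

/-- type of an event -/
def tyOf (C : Dat) (i : ℕ) : Bool := decide (C.kind i = 3)

theorem Good.EvT_tyOf (hC : C.Good) {i : ℕ} (h : C.Ev i) : C.EvT (C.tyOf i) i := by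
  have := hC.kind_le i
  unfold Ev at h
  unfold EvT tyOf
  by_cases h3 : C.kind i = 3
  · simp [h3]
  · simp [h3]; omega

theorem tyOf_eq {ty : Bool} {i : ℕ} (h : C.EvT ty i) : C.tyOf i = ty := by
  unfold EvT at h
  cases ty <;> simp_all [tyOf]

def ErBy (C : Dat) (i k : ℕ) : Prop :=
  i < k ∧ C.Ev i ∧ C.Ev k ∧ C.lev k < C.lev i ∧ C.nolow (C.lev i) i (k-1) ∧ C.alive (C.tyOf i) i k

theorem geom8 (n : ℕ) : ∑ d ∈ Finset.range n, (1:ℝ) / 8 ^ (d+1) ≤ 1/7 := by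
  have : ∀ n : ℕ, ∑ d ∈ Finset.range n, (1:ℝ) / 8 ^ (d+1) = 1/7 * (1 - 1/8^n) := by
    intro n
    induction n with
    | zero => simp
    | succ n ih => rw [Finset.sum_range_succ, ih]; field_simp; ring
  rw [this]
  have : (0:ℝ) < 1/8^n := by positivity
  linarith

theorem Good.er_sum (hC : C.Good) {k : ℕ} (hk : C.Ev k) :
    ∑ i ∈ Finset.range k, (if C.ErBy i k then C.τ i else 0) ≤ 2/7 * C.τ k := by
  obtain ⟨s, rfl⟩ : ∃ s, k = s+1 := by
    cases k with
    | zero => exact absurd hC.kind0 (Ev_kind hk)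
    | succ n => exact ⟨n, rfl⟩
  set l := C.lev (s+1) with hl
  have key : ∀ i ∈ Finset.range (s+1), (if C.ErBy i (s+1) then C.τ i else 0) ≤
      ∑ d ∈ Finset.range (s+1), ((if C.cnt false (l+1+d) (s+1) i s then C.τ i else 0) +
        (if C.cnt true (l+1+d) (s+1) i s then C.τ i else 0)) := by
    intro i hi
    have hnn : ∀ d ty, 0 ≤ (if C.cnt ty (l+1+d) (s+1) i s then C.τ i else 0) := by
      intro d ty
      split_ifs with h
      · exact hC.tau_nn (Ev_kind (Ev_of_EvT h.1))
      · exact le_rfl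
    split_ifs with h
    · obtain ⟨h1, h2, h3, h4, h5, h6⟩ := h
      have hli : C.lev i < i := by
        cases i with
        | zero => exact absurd hC.kind0 (Ev_kind h2)
        | succ n => exact hC.lev_lt n (Ev_kind h2)
      have hd : C.lev i - (l+1) ∈ Finset.range (s+1) := by simp; omega
      refine le_trans ?_ (Finset.single_le_sum (fun d _ => add_nonneg (hnn d false) (hnn d true)) hd)
      have he : l + 1 + (C.lev i - (l+1)) = C.lev i := by omega
      have hc : C.cnt (C.tyOf i) (l+1 + (C.lev i - (l+1))) (s+1) i s := by
        rw [he]; exact ⟨hC.EvT_tyOf h2, rfl, h6, h5⟩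
      cases hty : C.tyOf i with
      | false => rw [hty] at hc; have := hnn (C.lev i - (l+1)) true; rw [if_pos hc]; linarith
      | true => rw [hty] at hc; have := hnn (C.lev i - (l+1)) false; rw [if_pos hc]; linarith
    · exact Finset.sum_nonneg fun d _ => add_nonneg (hnn d false) (hnn d true)
  refine (Finset.sum_le_sum key).trans ?_
  rw [Finset.sum_comm]
  have hτ := hC.tau_eq s (Ev_kind hk)
  have : ∀ d ∈ Finset.range (s+1), ∑ i ∈ Finset.range (s+1), ((if C.cnt false (l+1+d) (s+1) i s then C.τ i else 0) +
        (if C.cnt true (l+1+d) (s+1) i s then C.τ i else 0)) ≤ 2 * C.τ (s+1) * (1 / 8 ^ (d+1)) := by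
    intro d _
    rw [Finset.sum_add_distrib, ← hC.α_sum _ _ _ _ (Nat.le_succ s), ← hC.α_sum _ _ _ _ (Nat.le_succ s)]
    have hG := hC.G_bd_t s (s+1) l d
    rw [hl, ← hτ, ← hl] at hG
    have hb : ∀ ty, C.α ty (l+1+d) (s+1) s ≤ C.G s (s+1) (l+1+d) := by
      intro ty
      refine (hC.J1 ty (l+1+d) s).trans ?_
      have := mul_le_mul_of_nonneg_left (hC.wsum (C.base s (l+1+d))) (hC.G_nn s (s+1) (l+1+d))
      linarith
    have := hb true
    have := hb false
    have e : 2 * C.τ (s+1) * (1 / 8 ^ (d+1)) = 2 * (C.τ (s+1) / 8 ^ (d+1)) := by ring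
    rw [e]; linarith
  refine (Finset.sum_le_sum this).trans ?_
  rw [← Finset.mul_sum]
  have := geom8 (s+1)
  have h2 := hC.tau_nn (Ev_kind hk)
  nlinarith

/-- erased by an event before stage `T` -/
def Er (C : Dat) (i T : ℕ) : Prop := ∃ k < T, C.ErBy i k

theorem Good.evT_pos (hC : C.Good) {i : ℕ} (h : C.Ev i) : ∃ n, i = n+1 := by
  cases i with
  | zero => exact absurd hC.kind0 (Ev_kind h)
  | succ n => exact ⟨n, rfl⟩

theorem Good.kept_disj (hC : C.Good) {ty : Bool} {i i' T k : ℕ} (hi : C.EvT ty i) (hi' : C.EvT ty i')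
    (hlt : i < i') (hT : i' < T) (hk : ¬ C.Er i T) (hki : k < i)
    (h1 : C.bs i < C.len k) (h1' : C.bs i' < C.len k) (h2 : C.good ty k i) (h2' : C.good ty k i') :
    False := by
  by_cases hlow : ∃ m, i < m ∧ m ≤ i' ∧ (C.Ev m ∧ C.lev m < C.lev i)
  · have hm := Nat.find_spec hlow
    have hmin := fun m => Nat.find_min hlow (m := m)
    set m := Nat.find hlow
    have hna : ¬ C.alive ty i m := by
      intro ha
      refine hk ⟨m, by omega, hm.1, Ev_of_EvT hi, hm.2.2.1, hm.2.2.2, ?_, ?_⟩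
      · intro m' h3 h4 h5
        exact hmin m' (by omega) ⟨h3, by omega, h5⟩
      · rw [tyOf_eq hi]; exact ha
    unfold alive at hna
    push Not at hna
    obtain ⟨y, hy, hne⟩ := hna
    have hp : C.pre ty i (C.len k) = C.pre ty i' (C.len k) := h2.symm.trans h2'
    have hX : C.X ty i y = C.X ty i' y := by
      have := congrArg (fun l => l[y]?) hp
      simpa [pre, show y < C.len k by omega] using this
    exact hne (hC.X_btw hm.1.le hm.2.1 hX.symm)
  · push Not at hlow
    have hl : C.lev i ≤ C.lev i' := hlow i' hlt le_rfl (Ev_of_EvT hi')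
    obtain ⟨n, rfl⟩ := hC.evT_pos (Ev_of_EvT hi)
    have := base_act (Ev_kind (Ev_of_EvT hi)) (le_refl (C.lev (n+1)))
    have h3 : n + 1 ≤ C.bs i' := this.trans ((base_mono_s (C := C) (by omega) _).trans (base_mono_e (C := C) (i'-1) hl))
    have := hC.len_le k
    omega

theorem Good.kept_sum (hC : C.Good) {q : ℝ}
    (hq : ∀ T, ∑ k ∈ Finset.range T, (if C.n0 < C.len k then C.w k else 0) ≤ q) (ty : Bool) (T : ℕ) :
    ∑ i ∈ Finset.range T, (if C.EvT ty i ∧ ¬ C.Er i T then C.τ i else 0) ≤ q := by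
  let sup : ℕ → ℕ → Prop := fun i k => C.EvT ty i ∧ ¬ C.Er i T ∧ k < i ∧ C.bs i < C.len k ∧ C.good ty k i
  have h1 : ∀ i ∈ Finset.range T, (if C.EvT ty i ∧ ¬ C.Er i T then C.τ i else 0) ≤
      ∑ k ∈ Finset.range T, if sup i k then C.w k else 0 := by
    intro i hi
    simp at hi
    split_ifs with h
    · obtain ⟨n, rfl⟩ := hC.evT_pos (Ev_of_EvT h.1)
      refine (hC.ev_cost ty n h.1).le.trans ?_
      unfold cost
      refine le_trans (Finset.sum_le_sum (g := fun k => if sup (n+1) k then C.w k else 0) ?_) 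
        (Finset.sum_le_sum_of_subset_of_nonneg ?_ ?_)
      · intro k hk
        simp at hk
        split_ifs with ha hb hb
        · exact le_rfl
        · exact absurd ⟨h.1, h.2, by omega, ha.1, ha.2⟩ hb
        · exact hC.wnn k
        · exact le_rfl
      · intro a; simp; omega
      · intro k _ _; split_ifs; exacts [hC.wnn k, le_rfl]
    · exact Finset.sum_nonneg fun k _ => by split_ifs; exacts [hC.wnn k, le_rfl]
  refine (Finset.sum_le_sum h1).trans ?_
  rw [Finset.sum_comm]
  refine le_trans (Finset.sum_le_sum ?_) (hq T)
  intro k _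
  by_cases hex : ∃ i ∈ Finset.range T, sup i k
  · obtain ⟨i, hi, hs⟩ := hex
    rw [Finset.sum_eq_single i]
    · have := base_ge (C := C) (i-1) (C.lev i)
      have hb := hs.2.2.2.1
      simp only [bs] at hb
      rw [if_pos hs, if_pos (by omega)]
    · intro i' hi' hne
      rw [if_neg]
      intro hs'
      simp at hi hi'
      rcases lt_or_gt_of_ne hne with hlt | hlt
      · exact hC.kept_disj hs'.1 hs.1 hlt hi hs'.2.1 hs'.2.2.1 hs'.2.2.2.1 hs.2.2.2.1 hs'.2.2.2.2 hs.2.2.2.2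
      · exact hC.kept_disj hs.1 hs'.1 hlt hi' hs.2.1 hs.2.2.1 hs.2.2.2.1 hs'.2.2.2.1 hs.2.2.2.2 hs'.2.2.2.2
    · intro h; exact absurd hi h
  · push Not at hex
    rw [Finset.sum_eq_zero fun i hi => if_neg (hex i hi)]
    split_ifs; exacts [hC.wnn k, le_rfl]

theorem Good.ev_sum (hC : C.Good) {q : ℝ}
    (hq : ∀ T, ∑ k ∈ Finset.range T, (if C.n0 < C.len k then C.w k else 0) ≤ q) (T : ℕ) :
    ∑ i ∈ Finset.range T, (if C.Ev i then C.τ i else 0) ≤ 14/5 * q := by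
  have hsplit : ∀ i ∈ Finset.range T, (if C.Ev i then C.τ i else 0) ≤
      ((if C.EvT false i ∧ ¬ C.Er i T then C.τ i else 0) + (if C.EvT true i ∧ ¬ C.Er i T then C.τ i else 0)) +
      ∑ k ∈ Finset.range T, (if i < k ∧ C.ErBy i k then C.τ i else 0) := by
    intro i hi
    have hnn : ∀ (P : Prop) [Decidable P], (P → C.Ev i) → 0 ≤ (if P then C.τ i else 0) := by
      intro P _ h; split_ifs with hp
      · exact hC.tau_nn (Ev_kind (h hp))
      · exact le_rfl
    have n1 := hnn (C.EvT false i ∧ ¬ C.Er i T) (fun h => Ev_of_EvT h.1)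
    have n2 := hnn (C.EvT true i ∧ ¬ C.Er i T) (fun h => Ev_of_EvT h.1)
    have n3 : 0 ≤ ∑ k ∈ Finset.range T, (if i < k ∧ C.ErBy i k then C.τ i else 0) :=
      Finset.sum_nonneg fun k _ => hnn _ fun h => h.2.2.1
    by_cases h : C.Ev i
    · rw [if_pos h]
      by_cases hE : C.Er i T
      · obtain ⟨k, hk, hE⟩ := hE
        have := Finset.single_le_sum (f := fun k => if i < k ∧ C.ErBy i k then C.τ i else 0) 
          (fun k _ => hnn _ fun h => h.2.2.1) (Finset.mem_range.2 hk)
        rw [if_pos ⟨hE.1, hE⟩] at this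
        linarith
      · have := hC.EvT_tyOf h
        cases hty : C.tyOf i with
        | false => rw [hty] at this; rw [if_pos (c := C.EvT false i ∧ _) ⟨this, hE⟩]; linarith
        | true => rw [hty] at this; rw [if_pos (c := C.EvT true i ∧ _) ⟨this, hE⟩]; linarith
    · rw [if_neg h]; linarith
  have h2 := Finset.sum_le_sum hsplit
  rw [Finset.sum_add_distrib, Finset.sum_add_distrib, Finset.sum_comm (s := Finset.range T) (t := Finset.range T)] at h2
  have h3 : ∀ k ∈ Finset.range T, ∑ i ∈ Finset.range T, (if i < k ∧ C.ErBy i k then C.τ i else 0) ≤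
      2/7 * (if C.Ev k then C.τ k else 0) := by
    intro k hk
    simp at hk
    by_cases hE : C.Ev k
    · rw [if_pos hE]
      refine le_trans (le_of_eq ?_) (hC.er_sum hE)
      rw [← Finset.sum_filter, ← Finset.sum_filter]
      refine Finset.sum_congr ?_ fun _ _ => rfl
      ext i; simp; intro h2 h3; omega
    · rw [if_neg hE, mul_zero]
      refine (Finset.sum_eq_zero fun i _ => if_neg ?_).le
      rintro ⟨_, h⟩; exact hE h.2.2.1
  have h4 := Finset.sum_le_sum h3
  rw [← Finset.mul_sum] at h4
  have h5 := hC.kept_sum hq false T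
  have h6 := hC.kept_sum hq true T
  linarith

theorem Good.code_sum (hC : C.Good) (T : ℕ) :
    ∑ i ∈ Finset.range T, (if C.kind i = 1 then C.τ i else 0) ≤ 8/7 * C.g := by
  have h1 : ∀ i ∈ Finset.range T, (if C.kind i = 1 then C.τ i else 0) ≤
      ∑ e ∈ Finset.range T, if C.kind i = 1 ∧ C.lev i = e then C.g / 8 ^ e else 0 := by
    intro i hi
    simp at hi
    have hg := hC.gpos
    split_ifs with h
    · cases i with
      | zero => rw [hC.kind0] at h; cases h
      | succ n =>
        have hk : C.kind (n+1) ≠ 0 := by omega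
        have hl := hC.lev_lt n hk
        rw [Finset.sum_eq_single_of_mem (C.lev (n+1)) (by simp; omega)]
        · rw [if_pos ⟨h, rfl⟩, hC.tau_eq n hk]; exact hC.t_bd _ _ _
        · intro b _ hb; rw [if_neg]; rintro ⟨_, h⟩; exact hb h.symm
    · refine Finset.sum_nonneg fun e _ => ?_
      split_ifs
      · positivity
      · exact le_rfl
  refine (Finset.sum_le_sum h1).trans ?_
  rw [Finset.sum_comm]
  have h2 : ∀ e ∈ Finset.range T, ∑ i ∈ Finset.range T, (if C.kind i = 1 ∧ C.lev i = e then C.g / 8 ^ e else 0)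
      ≤ 8 * C.g * (1 / 8 ^ (e+1)) := by
    intro e _
    have hg := hC.gpos
    have he : 8 * C.g * (1 / 8 ^ (e+1)) = C.g / 8 ^ e := by field_simp; ring
    rw [he]
    by_cases hex : ∃ i ∈ Finset.range T, C.kind i = 1 ∧ C.lev i = e
    · obtain ⟨i, hi, hs⟩ := hex
      rw [Finset.sum_eq_single i, if_pos hs]
      · intro i' hi' hne
        rw [if_neg]
        intro hs'
        have pos : ∀ i, C.kind i = 1 → ∃ n, i = n+1 := by
          intro i h; cases i with
          | zero => rw [hC.kind0] at h; cases h
          | succ n => exact ⟨n, rfl⟩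
        obtain ⟨n, rfl⟩ := pos i hs.1
        obtain ⟨n', rfl⟩ := pos i' hs'.1
        have c1 := hC.code n hs.1
        have c2 := hC.code n' hs'.1
        rw [hs.2] at c1
        rw [hs'.2] at c2
        rcases lt_or_gt_of_ne hne with hlt | hlt
        · have := hC.H_le (by omega : n' + 1 ≤ n) c2.1
          rw [c1.2] at this; cases this
        · have := hC.H_le (by omega : n + 1 ≤ n') c1.1
          rw [c2.2] at this; cases this
      · intro h; exact absurd hi h
    · push Not at hex
      rw [Finset.sum_eq_zero fun i hi => if_neg fun h => hex i hi h.1 h.2]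
      positivity
  refine (Finset.sum_le_sum h2).trans ?_
  rw [← Finset.mul_sum]
  have := geom8 T
  have hg := hC.gpos
  nlinarith

theorem Good.pay_sum (hC : C.Good) {q : ℝ}
    (hq : ∀ T, ∑ k ∈ Finset.range T, (if C.n0 < C.len k then C.w k else 0) ≤ q) (T : ℕ) :
    ∑ i ∈ Finset.range T, (if C.kind i ≠ 0 then C.τ i else 0) ≤ 14/5 * q + 8/7 * C.g := by
  refine le_trans (le_of_eq ?_) (add_le_add (hC.ev_sum hq T) (hC.code_sum T))
  rw [← Finset.sum_add_distrib]
  refine Finset.sum_congr rfl fun i _ => ?_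
  unfold Ev
  by_cases h0 : C.kind i = 0
  · simp [h0]
  · by_cases h1 : C.kind i = 1
    · simp [h1]
    · rw [if_pos h0, if_pos (by omega), if_neg h1, add_zero]

end Dat
end comb
end KPaper


namespace KPaper

section comb
open scoped Classical
namespace Dat
variable {C : Dat}

def Bs (C : Dat) (s n : ℕ) : Bool := decide (n.unpair.2 < C.base s n.unpair.1)

def preB (C : Dat) (s n : ℕ) : Str := (List.range n).map (C.Bs s)

theorem Bs_mono {s s' n : ℕ} (h : s ≤ s') (hb : C.Bs s n = true) : C.Bs s' n = true := by
  simp only [Bs, decide_eq_true_eq] at *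
  exact hb.trans_le (base_mono_s h _)

theorem preB_ne {s n : ℕ} (h : C.preB (s+1) n ≠ C.preB s n) :
    C.kind (s+1) ≠ 0 ∧ C.base s (C.lev (s+1)) < n := by
  have : ∃ m < n, C.Bs (s+1) m ≠ C.Bs s m := by
    by_contra hcon
    push Not at hcon
    refine h (List.map_congr_left fun a ha => hcon a (by simpa using ha))
  obtain ⟨m, hm, hne⟩ := this
  have hb : C.base (s+1) m.unpair.1 ≠ C.base s m.unpair.1 := by
    intro h; apply hne; simp [Bs, h]
  by_cases hc : C.kind (s+1) ≠ 0 → m.unpair.1 < C.lev (s+1)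
  · exact absurd (base_eq hc) hb
  · push Not at hc
    refine ⟨hc.1, ?_⟩
    have h1 := base_mono_e (C := C) s hc.2
    have h2 : C.base s m.unpair.1 ≤ m.unpair.2 := by
      by_contra h3
      push Not at h3
      apply hne
      have : C.Bs s m = true := by simpa [Bs] using h3
      rw [this, Bs_mono (Nat.le_succ s) this]
    have := Nat.unpair_right_le m
    omega

theorem Good.mach_cost (hC : C.Good) (ty : Bool) (s : ℕ) :
    ∑ i ∈ Finset.range s, (if C.good ty i s ∧ C.preB (s+1) (C.len i) ≠ C.preB s (C.len i) then C.w i else 0)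
     ≤ if C.kind (s+1) ≠ 0 then C.τ (s+1) else 0 := by
  split_ifs with hk
  · rw [hC.tau_eq s hk]
    refine le_trans ?_ ((hC.inv ty s (C.lev (s+1))).trans (hC.t_mono' le_rfl (Nat.le_succ s) _))
    unfold cost
    refine Finset.sum_le_sum fun i _ => ?_
    split_ifs with h1 h2 h2
    · exact le_rfl
    · exact absurd ⟨(preB_ne h1.2).2, h1.1⟩ h2
    · exact hC.wnn i
    · exact le_rfl
  · refine (Finset.sum_eq_zero fun i _ => if_neg ?_).le
    rintro ⟨_, h⟩; exact hk (preB_ne h).1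

/-! ### infinitely many events -/

theorem Good.winf (hC : C.Good) (n : ℕ) : ∃ i, n < i ∧ 0 < C.w i := by
  obtain ⟨i, h1, h2, _⟩ := hC.desc true n
  exact ⟨i, h1.trans_le (hC.len_le i), h2⟩

/-- the assumption that things are stable at level `e` -/
def Stab (C : Dat) (e s0 : ℕ) (Γ : ℝ) : Prop :=
  0 < Γ ∧ ∀ s ≥ s0, ¬ (C.Ev s ∧ C.lev s < e) ∧ C.G s s e = Γ

theorem Good.Stab_G (hC : C.Good) {e s0 : ℕ} {Γ : ℝ} (h : C.Stab e s0 Γ) {s : ℕ} (hs : s0 ≤ s) :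
    C.G s (s+1) e = Γ := by
  have h1 := hC.G_mono' le_rfl (Nat.le_succ s) e
  have h2 := hC.G_le (e := e) (s := s) (s' := s+1) (by
    intro hE; by_contra h3; exact (h.2 (s+1) (by omega)).1 ⟨hE, by omega⟩)
  rw [(h.2 s hs).2] at h1
  rw [(h.2 (s+1) (by omega)).2] at h2
  linarith

theorem small_exists (φ : ℕ → ℝ) (P : ℕ → Prop) (q ε : ℝ) (hε : 0 < ε)
    (hnn : ∀ i, P i → 0 ≤ φ i)
    (hq : ∀ T, ∑ i ∈ Finset.range T, (if P i then φ i else 0) ≤ q) (hinf : ∀ n, ∃ i ≥ n, P i) (n : ℕ) :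
    ∃ i ≥ n, P i ∧ φ i < ε := by
  by_contra hcon
  push Not at hcon
  have key : ∀ m : ℕ, ∃ T, (m:ℝ) * ε ≤ ∑ i ∈ Finset.range T, (if P i then φ i else 0) := by
    intro m
    induction m with
    | zero => exact ⟨0, by simp⟩
    | succ m ih =>
      obtain ⟨T, hT⟩ := ih
      obtain ⟨i, hi, hP⟩ := hinf (max n T)
      refine ⟨i+1, ?_⟩
      rw [Finset.sum_range_succ, if_pos hP]
      have h1 := hcon i (by omega) hP
      have h2 : ∑ i ∈ Finset.range T, (if P i then φ i else 0) ≤ ∑ i ∈ Finset.range i, (if P i then φ i else 0) :=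
        Finset.sum_le_sum_of_subset_of_nonneg (by intro a; simp; omega) fun i _ _ => by
          split_ifs with h
          · exact hnn i h
          · exact le_rfl
      push_cast
      linarith
  obtain ⟨m, hm⟩ := exists_nat_gt (q / ε)
  obtain ⟨T, hT⟩ := key m
  rw [div_lt_iff₀ hε] at hm
  linarith [hq T]

theorem Good.inf_done (hC : C.Good) {q : ℝ}
    (hq : ∀ T, ∑ i ∈ Finset.range T, (if C.Ev i then C.τ i else 0) ≤ q) {e s0 : ℕ} {Γ : ℝ}
    (h : C.Stab e s0 Γ) (hinf : ∀ n, ∃ i ≥ n, C.Ev i ∧ C.lev i = e) :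
    ∃ ty, ∀ j s1, ∃ s ≥ s1, Γ * C.S (j+1) ≤ C.α ty e s s := by
  have main : ∀ j s1, ∃ ty, ∃ s ≥ s1, Γ * C.S (j+1) ≤ C.α ty e s s := by
    intro j s1
    obtain ⟨j', hj', hw⟩ := hC.winf j
    have hS : C.S (j+1) < C.S (j'+1) := by
      have h1 : C.S (j+1) ≤ C.S j' := hC.S_mono hj'
      have h2 : C.S (j'+1) = C.S j' + C.w j' := Finset.sum_range_succ _ _
      linarith
    obtain ⟨m0, hm0, hE0, hl0⟩ := hinf (j'+1)
    obtain ⟨i, hi, ⟨hE, hl⟩, hτ⟩ := small_exists C.τ (fun i => C.Ev i ∧ C.lev i = e) q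
      (Γ * (C.S (j'+1) - C.S (j+1))) (mul_pos h.1 (by linarith)) (fun i h => hC.tau_nn (Ev_kind h.1))
      (fun T => le_trans (Finset.sum_le_sum fun i _ => by
        by_cases h : C.Ev i
        · by_cases h2 : C.lev i = e
          · simp [h, h2]
          · simp [h, h2]; exact hC.tau_nn (Ev_kind h)
        · simp [h]) (hq T)) hinf (max (s0+1) (max s1 (m0+1)))
    obtain ⟨n, rfl⟩ := hC.evT_pos hE
    have hG := hC.Stab_G h (s := n) (by omega)
    have hb : j'+1 ≤ C.base n e := by
      obtain ⟨m, rfl⟩ := hC.evT_pos hE0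
      have := base_act (Ev_kind hE0) hl0.le
      have h2 := base_mono_s (C := C) (by omega : m+1 ≤ n) e
      omega
    have hSb := hC.S_mono hb
    rw [hC.tau_eq n (Ev_kind hE), hl, t, hG] at hτ
    unfold tt at hτ
    have hτ := (le_max_right _ _).trans_lt hτ
    have hx : ∃ ty, Γ * C.S (C.base n e) - C.α ty e (n+1) n < Γ * (C.S (j'+1) - C.S (j+1)) := by
      rcases min_lt_iff.1 hτ with h | h
      · exact ⟨_, h⟩
      · exact ⟨_, h⟩
    obtain ⟨ty, hty⟩ := hx
    refine ⟨ty, n+1, by omega, ?_⟩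
    have h1 : C.α ty e (n+1) n ≤ C.α ty e (n+1) (n+1) := by
      rw [α]
      rw [if_neg (by rintro ⟨_, h⟩; omega)]
      split_ifs
      · have := hC.tau_nn (Ev_kind hE); linarith
      · exact le_rfl
    have h2 := mul_le_mul_of_nonneg_left hSb h.1.le
    nlinarith
  by_contra hcon
  push Not at hcon
  obtain ⟨j0, s0', h0⟩ := hcon false
  obtain ⟨j1, s1', h1⟩ := hcon true
  obtain ⟨ty, s, hs, hh⟩ := main (max j0 j1) (max s0' s1')
  have hm : ∀ j ≤ max j0 j1, Γ * C.S (j+1) ≤ C.α ty e s s := fun j hj =>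
    (mul_le_mul_of_nonneg_left (hC.S_mono (by omega)) h.1.le).trans hh
  cases ty
  · have := h0 s (by omega); have := hm j0 (le_max_left _ _); linarith
  · have := h1 s (by omega); have := hm j1 (le_max_right _ _); linarith

/-! ### clamps -/

noncomputable def cl (C : Dat) (Γ : ℝ) (j : ℕ) (x : ℝ) : ℝ := max (Γ * C.S j) (min x (Γ * C.S (j+1)))

theorem Good.cl_sum (hC : C.Good) {Γ : ℝ} (hΓ : 0 < Γ) (x : ℝ) (n : ℕ) :
    ∑ j ∈ Finset.range n, (C.cl Γ j x - Γ * C.S j) = max 0 (min x (Γ * C.S n)) := by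
  induction n with
  | zero => simp [S]
  | succ n ih =>
    rw [Finset.sum_range_succ, ih]
    have h1 : Γ * C.S n ≤ Γ * C.S (n+1) := mul_le_mul_of_nonneg_left (hC.S_mono (Nat.le_succ n)) hΓ.le
    have h0 : 0 ≤ Γ * C.S n := mul_nonneg hΓ.le (hC.S_nn n)
    unfold cl
    rcases le_total x (Γ * C.S n) with h | h
    · rw [min_eq_left h, min_eq_left (h.trans h1), max_eq_left h]; ring
    · rw [min_eq_right h, max_eq_right h0]
      rw [max_eq_right (le_min h h1), max_eq_right (le_min (h0.trans h) (h0.trans h1))]; ring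

theorem cl_mono (Γ : ℝ) (j : ℕ) {x y : ℝ} (h : x ≤ y) : C.cl Γ j x ≤ C.cl Γ j y := by
  unfold cl; gcongr

noncomputable def ov (C : Dat) (Γ : ℝ) (a : ℕ → ℝ) (i j : ℕ) : ℝ :=
  C.cl Γ j (a i + C.τ i) - C.cl Γ j (a i)

theorem Good.ov_sum (hC : C.Good) {Γ : ℝ} (hΓ : 0 < Γ) (a : ℕ → ℝ) (i n : ℕ) (hτ : 0 ≤ C.τ i) :
    ∑ j ∈ Finset.range n, C.ov Γ a i j ≤ C.τ i := by
  have : ∑ j ∈ Finset.range n, C.ov Γ a i j =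
      ∑ j ∈ Finset.range n, (C.cl Γ j (a i + C.τ i) - Γ * C.S j) -
      ∑ j ∈ Finset.range n, (C.cl Γ j (a i) - Γ * C.S j) := by
    rw [← Finset.sum_sub_distrib]; refine Finset.sum_congr rfl fun j _ => ?_; unfold ov; ring
  rw [this, hC.cl_sum hΓ, hC.cl_sum hΓ, sub_le_iff_le_add]
  have h0 : 0 ≤ Γ * C.S n := mul_nonneg hΓ.le (hC.S_nn n)
  refine max_le ?_ ?_
  · have := le_max_left 0 (min (a i) (Γ * C.S n)); linarith
  · rcases le_total (a i) (Γ * C.S n) with h | h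
    · have h1 := min_le_left (a i + C.τ i) (Γ * C.S n)
      have h2 := le_max_right 0 (min (a i) (Γ * C.S n))
      rw [min_eq_left h] at h2 ⊢
      linarith
    · have h1 := min_le_right (a i + C.τ i) (Γ * C.S n)
      have h2 := le_max_right 0 (min (a i) (Γ * C.S n))
      rw [min_eq_right h] at h2 ⊢
      linarith

/-- accumulated amount before event `i` -/
noncomputable def acc (C : Dat) (ty : Bool) (e i : ℕ) : ℝ := C.α ty e i (i-1)

theorem Good.acc_eq (hC : C.Good) {ty : Bool} {e s n : ℕ} (_hE : C.EvT ty (n+1)) (hl : C.lev (n+1) = e)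
    (ha : C.alive ty (n+1) s) (hs : n+1 ≤ s) : C.α ty e s n = C.acc ty e (n+1) := by
  unfold acc
  rw [Nat.add_sub_cancel, hC.α_sum _ _ _ _ (by omega), hC.α_sum _ _ _ _ (Nat.le_succ n)]
  refine Finset.sum_congr rfl fun i hi => ?_
  simp at hi
  have : C.cnt ty e s i n ↔ C.cnt ty e (n+1) i n := by
    unfold cnt
    constructor
    · rintro ⟨h1, h2, h3, h4⟩; exact ⟨h1, h2, hC.alive_anti (by omega) hs h3, h4⟩
    · rintro ⟨h1, h2, h3, h4⟩
      refine ⟨h1, h2, fun y hy => ?_, h4⟩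
      rw [← h3 y hy]
      apply ha
      refine hy.trans_le ?_
      unfold bs
      rw [h2, hl]
      exact base_mono_s (by omega) _
  simp only [this]

theorem Good.ov_tel (hC : C.Good) {ty : Bool} {e : ℕ} {Γ : ℝ} (hΓ : 0 < Γ) (j s : ℕ) :
    C.cl Γ j (C.α ty e s s) - Γ * C.S j =
      ∑ i ∈ Finset.range (s+1), if C.cnt ty e s i s then C.ov Γ (C.acc ty e) i j else 0 := by
  have hz : C.cl Γ j 0 - Γ * C.S j = 0 := by
    have h0 : 0 ≤ Γ * C.S j := mul_nonneg hΓ.le (hC.S_nn j)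
    unfold cl
    rw [max_eq_left]; · ring
    exact (min_le_left _ _).trans h0
  refine cnt_sum ty e s (fun i => C.ov Γ (C.acc ty e) i j) (fun m => C.cl Γ j (C.α ty e s m) - Γ * C.S j)
    hC.kind0 hz ?_ ?_ ?_ s le_rfl
  · intro m h; simp only [α]; rw [if_pos h]; exact hz
  · intro m h h' hm
    simp only [α]
    rw [if_neg h, if_pos h', hC.acc_eq h'.1 h'.2.1 h'.2.2 hm, ov, add_comm (C.τ _)]
    ring
  · intro m h h'; simp only [α]; rw [if_neg h, if_neg h']

def done (C : Dat) (ty : Bool) (e s0 : ℕ) (Γ : ℝ) (j s : ℕ) : Prop :=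
  s0 ≤ s ∧ Γ * C.S (j+1) ≤ C.α ty e s s

def frst (C : Dat) (ty : Bool) (e s0 : ℕ) (Γ : ℝ) (j s : ℕ) : Prop :=
  C.done ty e s0 Γ j s ∧ ∀ s' < s, C.done ty e s0 Γ j s' → C.pre ty s' (C.len j) ≠ C.pre ty s (C.len j)

theorem Good.G_le_of_nolow (hC : C.Good) {e n s : ℕ} (hs : n+1 ≤ s) (h : C.nolow e (n+1) s)
    (hl : C.lev (n+1) = e) : C.G n (n+1) e ≤ C.G s s e := by
  have h0 : C.G n (n+1) e ≤ C.G (n+1) (n+1) e := hC.G_le fun _ => hl.ge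
  refine h0.trans ?_
  clear h0
  induction s, hs using Nat.le_induction with
  | base => exact le_rfl
  | succ m hm ih =>
    refine (ih fun k h1 h2 => h k h1 (by omega)).trans ((hC.G_mono' le_rfl (Nat.le_succ m) e).trans (hC.G_le ?_))
    intro hE; by_contra h3
    exact h (m+1) (by omega) le_rfl ⟨hE, by omega⟩

theorem Good.ov_lt (hC : C.Good) {ty : Bool} {e s0 : ℕ} {Γ : ℝ} (h : C.Stab e s0 Γ) {i j s : ℕ}
    (hs : s0 ≤ s) (his : i ≤ s) (hc : C.cnt ty e s i s) (hne : C.ov Γ (C.acc ty e) i j ≠ 0) : j < C.bs i := by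
  obtain ⟨n, rfl⟩ := hC.evT_pos (Ev_of_EvT hc.1)
  by_contra hcon
  push Not at hcon
  apply hne
  have hG : C.G n (n+1) e ≤ Γ := by
    rw [← (h.2 s hs).2]; exact hC.G_le_of_nolow his hc.2.2.2 hc.2.1
  have h1 : C.acc ty e (n+1) + C.τ (n+1) ≤ Γ * C.S j := by
    have hJ := hC.J1 ty e n
    have h2 := hC.tt_le_ty ty hJ
    have h3 := hC.tau_eq n (Ev_kind (Ev_of_EvT hc.1))
    rw [hc.2.1, t] at h3
    have h4 : C.G n (n+1) e * C.S (C.base n e) ≤ Γ * C.S j := by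
      refine mul_le_mul hG (hC.S_mono ?_) (hC.S_nn _) h.1.le
      unfold bs at hcon
      rw [hc.2.1] at hcon
      exact hcon
    unfold acc
    rw [Nat.add_sub_cancel]
    linarith
  have h2 := hC.tau_nn (Ev_kind (Ev_of_EvT hc.1))
  unfold ov cl
  rw [max_eq_left ((min_le_left _ _).trans h1), max_eq_left ((min_le_left _ _).trans (by linarith))]
  ring

theorem Good.frst_sum (hC : C.Good) {q : ℝ}
    (hq : ∀ T, ∑ i ∈ Finset.range T, (if C.Ev i then C.τ i else 0) ≤ q) {ty : Bool} {e s0 : ℕ} {Γ : ℝ}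
    (h : C.Stab e s0 Γ) (T : ℕ) :
    ∑ j ∈ Finset.range T, ∑ s ∈ Finset.range T, (if C.frst ty e s0 Γ j s then Γ * C.w j else 0) ≤ q := by
  set O := fun i j => C.ov Γ (C.acc ty e) i j with hO
  have hOnn : ∀ i j, C.EvT ty i → 0 ≤ O i j := by
    intro i j hE
    have := hC.tau_nn (Ev_kind (Ev_of_EvT hE))
    simp only [hO, ov]
    have := cl_mono (C := C) Γ j (show C.acc ty e i ≤ C.acc ty e i + C.τ i by linarith)
    linarith
  have h1 : ∀ j ∈ Finset.range T, ∀ s ∈ Finset.range T, (if C.frst ty e s0 Γ j s then Γ * C.w j else 0) ≤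
      ∑ i ∈ Finset.range T, if i ≤ s ∧ C.frst ty e s0 Γ j s ∧ C.cnt ty e s i s then O i j else 0 := by
    intro j _ s hs
    simp at hs
    split_ifs with hf
    · have h2 := hC.ov_tel (ty := ty) (e := e) h.1 j s
      have h3 : C.cl Γ j (C.α ty e s s) = Γ * C.S (j+1) := by
        unfold cl
        rw [min_eq_right hf.1.2, max_eq_right]
        exact mul_le_mul_of_nonneg_left (hC.S_mono (Nat.le_succ j)) h.1.le
      have h4 : C.S (j+1) = C.S j + C.w j := Finset.sum_range_succ _ _
      rw [h3, h4, mul_add, add_sub_cancel_left] at h2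
      rw [h2]
      refine le_trans (Finset.sum_le_sum (g := fun i => if i ≤ s ∧ C.frst ty e s0 Γ j s ∧ C.cnt ty e s i s then O i j else 0) ?_)
        (Finset.sum_le_sum_of_subset_of_nonneg ?_ ?_)
      · intro i hi
        simp at hi
        refine le_of_eq ?_
        have : (i ≤ s ∧ C.frst ty e s0 Γ j s ∧ C.cnt ty e s i s) ↔ C.cnt ty e s i s :=
          ⟨fun h => h.2.2, fun h => ⟨by omega, hf, h⟩⟩
        simp only [this]; rfl
      · intro a; simp; omega
      · intro i _ _
        split_ifs with h5
        · exact hOnn i j h5.2.2.1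
        · exact le_rfl
    · refine Finset.sum_nonneg fun i _ => ?_
      split_ifs with h5
      · exact hOnn i j h5.2.2.1
      · exact le_rfl
  refine (Finset.sum_le_sum fun j hj => Finset.sum_le_sum (h1 j hj)).trans ?_
  have h2 : ∀ j ∈ Finset.range T, (∑ s ∈ Finset.range T, ∑ i ∈ Finset.range T,
      if i ≤ s ∧ C.frst ty e s0 Γ j s ∧ C.cnt ty e s i s then O i j else 0) ≤
      ∑ i ∈ Finset.range T, if C.EvT ty i then O i j else 0 := by
    intro j _
    rw [Finset.sum_comm]
    refine Finset.sum_le_sum fun i _ => ?_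
    by_cases hex : ∃ s ∈ Finset.range T, (i ≤ s ∧ C.frst ty e s0 Γ j s ∧ C.cnt ty e s i s) ∧ O i j ≠ 0
    · obtain ⟨s, hs, hP, hne⟩ := hex
      rw [Finset.sum_eq_single_of_mem s hs, if_pos hP, if_pos hP.2.2.1]
      intro s' hs' hss
      rw [if_neg]
      intro hP'
      have hj := hC.ov_lt h hP.2.1.1.1 hP.1 hP.2.2 hne
      have hpre : ∀ s, i ≤ s → C.cnt ty e s i s → C.pre ty s (C.len j) = C.pre ty i (C.len j) := by
        intro s _ hc
        refine List.map_congr_left fun y hy => ?_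
        simp at hy
        have := hC.len_le j
        exact hc.2.2.1 y (by omega)
      have heq := (hpre s hP.1 hP.2.2).trans (hpre s' hP'.1 hP'.2.2).symm
      rcases lt_or_gt_of_ne hss with hlt | hlt
      · exact hP.2.1.2 s' hlt hP'.2.1.1 heq.symm
      · exact hP'.2.1.2 s hlt hP.2.1.1 heq
    · push Not at hex
      rw [Finset.sum_eq_zero]
      · split_ifs with h5
        · exact hOnn i j h5
        · exact le_rfl
      · intro s hs
        split_ifs with h5
        · exact hex s hs h5
        · rfl
  refine (Finset.sum_le_sum h2).trans ?_
  rw [Finset.sum_comm]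
  refine le_trans (Finset.sum_le_sum fun i _ => ?_) (hq T)
  by_cases hE : C.EvT ty i
  · simp only [if_pos hE, if_pos (Ev_of_EvT hE)]
    exact hC.ov_sum h.1 _ i T (hC.tau_nn (Ev_kind (Ev_of_EvT hE)))
  · simp only [if_neg hE, Finset.sum_const_zero]
    split_ifs with h5
    · exact hC.tau_nn (Ev_kind h5)
    · exact le_rfl

/-! ### liveness -/

theorem Good.code_fin (hC : C.Good) (e : ℕ) : ∃ s1, ∀ s ≥ s1, C.kind s = 1 → e < C.lev s := by
  induction e with
  | zero =>
    by_cases h : ∃ s, C.kind s = 1 ∧ C.lev s = 0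
    · obtain ⟨s, h1, h2⟩ := h
      refine ⟨s+1, fun s' hs' h' => ?_⟩
      by_contra h3
      have h3 : C.lev s' = 0 := by omega
      obtain ⟨n', rfl⟩ : ∃ n, s' = n+1 := ⟨s'-1, by omega⟩
      have c2 := hC.code n' h'
      cases s with
      | zero => rw [hC.kind0] at h1; cases h1
      | succ n =>
        have c1 := hC.code n h1
        rw [h2] at c1
        rw [h3] at c2
        have := hC.H_le (by omega : n+1 ≤ n') c1.1
        rw [c2.2] at this; cases this
    · push Not at h
      exact ⟨0, fun s _ hs => Nat.pos_of_ne_zero (h s hs)⟩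
  | succ e ih =>
    obtain ⟨s1, hs1⟩ := ih
    by_cases h : ∃ s, C.kind s = 1 ∧ C.lev s = e+1
    · obtain ⟨s, h1, h2⟩ := h
      refine ⟨max s1 (s+1), fun s' hs' h' => ?_⟩
      by_contra h3
      have h3 : C.lev s' = e+1 := by have := hs1 s' (by omega) h'; omega
      obtain ⟨n', rfl⟩ : ∃ n, s' = n+1 := ⟨s'-1, by omega⟩
      have c2 := hC.code n' h'
      cases s with
      | zero => rw [hC.kind0] at h1; cases h1
      | succ n =>
        have c1 := hC.code n h1
        rw [h2] at c1
        rw [h3] at c2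
        have := hC.H_le (by omega : n+1 ≤ n') c1.1
        rw [c2.2] at this; cases this
    · push Not at h
      refine ⟨s1, fun s h1 hs => ?_⟩
      have := hs1 s h1 hs
      have := h s hs
      omega

theorem Good.X_conv (hC : C.Good) (ty : Bool) (N : ℕ) : ∃ s2, ∀ s ≥ s2, ∀ y < N, C.X ty s y = C.X ty s2 y := by
  induction N with
  | zero => exact ⟨0, fun s _ y hy => by omega⟩
  | succ N ih =>
    obtain ⟨s2, h2⟩ := ih
    by_cases h : ∃ s, C.X ty s N = true
    · obtain ⟨s3, h3⟩ := h
      refine ⟨max s2 s3, fun s hs y hy => ?_⟩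
      by_cases hyN : y = N
      · subst hyN; rw [hC.X_le (by omega : s3 ≤ s) h3, hC.X_le (by omega : s3 ≤ max s2 s3) h3]
      · rw [h2 s (by omega) y (by omega), h2 (max s2 s3) (by omega) y (by omega)]
    · refine ⟨s2, fun s hs y hy => ?_⟩
      by_cases hyN : y = N
      · subst hyN
        push Not at h
        rw [Bool.eq_false_iff.2 (h s), Bool.eq_false_iff.2 (h s2)]
      · exact h2 s hs y (by omega)

theorem Good.cost_pos (hC : C.Good) (b : ℕ) : ∃ s1, ∀ s ≥ s1, 0 < C.cost true b s := by
  obtain ⟨i, h1, h2, s1, h3⟩ := hC.desc true b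
  refine ⟨max s1 (i+1), fun s hs => ?_⟩
  unfold cost
  refine Finset.sum_pos' (fun k _ => ?_) ⟨i, by simp; omega, ?_⟩
  · split_ifs; exacts [hC.wnn k, le_rfl]
  · rw [if_pos ⟨h1, h3 s (by omega)⟩]; exact h2

theorem Good.step (hC : C.Good) {e s0 : ℕ} {Γ : ℝ} (h : C.Stab e s0 Γ)
    (hfin : ∃ n, ∀ i ≥ n, C.Ev i → C.lev i ≠ e) :
    (∃ s1, ∀ s ≥ s1, C.base s e = C.base s1 e) ∧ ∃ s0' Γ', C.Stab (e+1) s0' Γ' := by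
  obtain ⟨n, hn⟩ := hfin
  obtain ⟨c, hc⟩ := hC.code_fin e
  set s1 := max s0 (max n c) with hs1
  have hq : ∀ s ≥ s1, C.kind s ≠ 0 → e < C.lev s := by
    intro s hs hk
    by_cases h1 : C.kind s = 1
    · exact hc s (by omega) h1
    · have hE : C.Ev s := by unfold Ev; omega
      have h2 := hn s (by omega) hE
      have h3 := (h.2 s (by omega)).1
      by_contra h4
      exact h3 ⟨hE, by omega⟩
  have hb : ∀ s ≥ s1, C.base s e = C.base s1 e := by
    intro s hs
    induction s, hs using Nat.le_induction with
    | base => rfl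
    | succ m hm ih => rw [base_eq (hq (m+1) (by omega)), ih]
  refine ⟨⟨s1, hb⟩, ?_⟩
  have hα1 : ∀ ty s', ∀ s ≥ s1, C.α ty e s' s = C.α ty e s' s1 := by
    intro ty s' s hs
    induction s, hs using Nat.le_induction with
    | base => rfl
    | succ m hm ih => rw [α_eq fun hE => hq (m+1) (by omega) (Ev_kind hE), ih]
  have hα2 : ∀ ty, ∃ s2, ∀ s ≥ s2, C.α ty e s s1 = C.α ty e s2 s1 := by
    intro ty
    obtain ⟨s2, h2⟩ := hC.X_conv ty ((Finset.range (s1+1)).sup C.bs)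
    refine ⟨max s1 s2, fun s hs => ?_⟩
    rw [hC.α_sum _ _ _ _ (by omega), hC.α_sum _ _ _ _ (by omega)]
    refine Finset.sum_congr rfl fun i hi => ?_
    have hbi := Finset.le_sup (f := C.bs) hi
    have : C.alive ty i s ↔ C.alive ty i (max s1 s2) := by
      unfold alive
      refine forall_congr' fun y => forall_congr' fun hy => ?_
      rw [h2 s (by omega) y (by omega), h2 (max s1 s2) (by omega) y (by omega)]
    have h3 : C.cnt ty e s i s1 ↔ C.cnt ty e (max s1 s2) i s1 := by
      unfold cnt
      rw [this]
    simp only [h3]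
  obtain ⟨a, ha⟩ := hα2 false
  obtain ⟨b, hbb⟩ := hα2 true
  obtain ⟨d, hd⟩ := hC.cost_pos (C.base s1 e)
  set s3 := max (max s1 d) (max a b) with hs3
  have htt : ∀ s ≥ s3, C.t s s e = C.t s3 s3 e := by
    intro s hs
    unfold t tt
    rw [(h.2 s (by omega)).2, (h.2 s3 (by omega)).2, hb s (by omega), hb s3 (by omega),
      hα1 _ s s (by omega), hα1 _ s s (by omega), hα1 _ s3 s3 (by omega), hα1 _ s3 s3 (by omega),
      ha s (by omega), ha s3 (by omega), hbb s (by omega), hbb s3 (by omega)]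
  have hpos : 0 < C.t s3 s3 e := by
    refine lt_of_lt_of_le ?_ (hC.inv true s3 e)
    rw [hb s3 (by omega)]
    exact hd s3 (by omega)
  refine ⟨s3, C.t s3 s3 e / 8, by positivity, fun s hs => ⟨?_, ?_⟩⟩
  · rintro ⟨hE, hl⟩
    have := hq s (by omega) (Ev_kind hE)
    omega
  · rw [G]; change C.t s s e / 8 = _; rw [htt s hs]

theorem Good.limits (hC : C.Good)
    (hfin : ∀ e s0 Γ, C.Stab e s0 Γ → ∃ n, ∀ i ≥ n, C.Ev i → C.lev i ≠ e) (e : ℕ) :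
    ∃ s1, ∀ s ≥ s1, C.base s e = C.base s1 e := by
  have : ∀ e, ∃ s0 Γ, C.Stab e s0 Γ := by
    intro e
    induction e with
    | zero => exact ⟨0, C.g, hC.gpos, fun s _ => ⟨by omega, rfl⟩⟩
    | succ e ih =>
      obtain ⟨s0, Γ, h⟩ := ih
      exact (hC.step h (hfin e s0 Γ h)).2
  obtain ⟨s0, Γ, h⟩ := this e
  exact (hC.step h (hfin e s0 Γ h)).1

end Dat
end comb
end KPaper


namespace KPaper

/-! ### dyadic arithmetic -/

abbrev Dy := ℕ × ℕ

def dadd (x y : Dy) : Dy := (x.1 * 2 ^ y.2 + y.1 * 2 ^ x.2, x.2 + y.2)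
def dsub (x y : Dy) : Dy := (x.1 * 2 ^ y.2 - y.1 * 2 ^ x.2, x.2 + y.2)
def dmul (x y : Dy) : Dy := (x.1 * y.1, x.2 + y.2)
def dlt (x y : Dy) : Bool := decide (x.1 * 2 ^ y.2 < y.1 * 2 ^ x.2)
def dmin (x y : Dy) : Dy := cond (dlt x y) x y
def deighth (x : Dy) : Dy := (x.1, x.2 + 3)

theorem pv_nn (x : Dy) : 0 ≤ pv x := by unfold pv; positivity

theorem pv_dadd (x y : Dy) : pv (dadd x y) = pv x + pv y := by
  simp only [pv, dadd]; push_cast; rw [pow_add]; field_simp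

theorem pv_dmul (x y : Dy) : pv (dmul x y) = pv x * pv y := by
  simp only [pv, dmul]; push_cast; rw [pow_add]; field_simp

theorem pv_eighth (x : Dy) : pv (deighth x) = pv x / 8 := by
  simp only [pv, deighth]; rw [pow_add]; field_simp; norm_num

theorem dlt_iff (x y : Dy) : dlt x y = true ↔ pv x < pv y := by
  simp only [pv, dlt, decide_eq_true_eq]
  rw [div_lt_div_iff₀ (by positivity) (by positivity)]
  exact_mod_cast Iff.rfl

theorem pv_dmin (x y : Dy) : pv (dmin x y) = min (pv x) (pv y) := by
  unfold dmin
  cases h : dlt x y with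
  | true => rw [min_eq_left ((dlt_iff x y).1 h).le]; rfl
  | false =>
    have : ¬ pv x < pv y := by rw [← dlt_iff, h]; simp
    rw [min_eq_right (by linarith)]; rfl

theorem pv_dsub (x y : Dy) : pv (dsub x y) = max 0 (pv x - pv y) := by
  simp only [pv, dsub]
  have e : (x.1:ℝ) / 2 ^ x.2 - y.1 / 2 ^ y.2 = (x.1 * 2 ^ y.2 - y.1 * 2 ^ x.2) / 2 ^ (x.2 + y.2) := by
    rw [pow_add]; field_simp
  rw [e]
  rcases le_total (y.1 * 2 ^ x.2) (x.1 * 2 ^ y.2) with h | h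
  · have h' : (y.1 : ℝ) * 2 ^ x.2 ≤ x.1 * 2 ^ y.2 := by exact_mod_cast h
    rw [max_eq_right (div_nonneg (by linarith) (by positivity)), Nat.cast_sub h]
    push_cast; rfl
  · have h' : (x.1 : ℝ) * 2 ^ y.2 ≤ y.1 * 2 ^ x.2 := by exact_mod_cast h
    rw [max_eq_left (div_nonpos_of_nonpos_of_nonneg (by linarith) (by positivity)), Nat.sub_eq_zero_of_le h]
    simp

section pr
variable {β : Type*} [Primcodable β]

theorem pow2_pr {k : β → ℕ} (hk : Primrec k) : Primrec fun x => 2 ^ k x :=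
  primrec_pow.comp (Primrec.const 2) hk

variable {x y : β → Dy}

theorem dadd_pr (hx : Primrec x) (hy : Primrec y) : Primrec fun z => dadd (x z) (y z) := by
  have h1 := Primrec.fst.comp hx
  have h2 := Primrec.snd.comp hx
  have h3 := Primrec.fst.comp hy
  have h4 := Primrec.snd.comp hy
  exact Primrec.pair (Primrec.nat_add.comp (Primrec.nat_mul.comp h1 (pow2_pr h4))
    (Primrec.nat_mul.comp h3 (pow2_pr h2))) (Primrec.nat_add.comp h2 h4)

theorem dsub_pr (hx : Primrec x) (hy : Primrec y) : Primrec fun z => dsub (x z) (y z) := by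
  have h1 := Primrec.fst.comp hx
  have h2 := Primrec.snd.comp hx
  have h3 := Primrec.fst.comp hy
  have h4 := Primrec.snd.comp hy
  exact Primrec.pair (Primrec.nat_sub.comp (Primrec.nat_mul.comp h1 (pow2_pr h4))
    (Primrec.nat_mul.comp h3 (pow2_pr h2))) (Primrec.nat_add.comp h2 h4)

theorem dmul_pr (hx : Primrec x) (hy : Primrec y) : Primrec fun z => dmul (x z) (y z) := by
  have h1 := Primrec.fst.comp hx
  have h2 := Primrec.snd.comp hx
  have h3 := Primrec.fst.comp hy
  have h4 := Primrec.snd.comp hy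
  exact Primrec.pair (Primrec.nat_mul.comp h1 h3) (Primrec.nat_add.comp h2 h4)

theorem lt_pr {a b : β → ℕ} (ha : Primrec a) (hb : Primrec b) : Primrec fun z => decide (a z < b z) :=
  (PrimrecRel.comp Primrec.nat_lt ha hb).decide

theorem eq_pr {γ : Type*} [Primcodable γ] [DecidableEq γ] {a b : β → γ} (ha : Primrec a) (hb : Primrec b) :
    Primrec fun z => decide (a z = b z) :=
  (PrimrecRel.comp Primrec.eq ha hb).decide

theorem dlt_pr (hx : Primrec x) (hy : Primrec y) : Primrec fun z => dlt (x z) (y z) := by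
  have h1 := Primrec.fst.comp hx
  have h2 := Primrec.snd.comp hx
  have h3 := Primrec.fst.comp hy
  have h4 := Primrec.snd.comp hy
  exact lt_pr (Primrec.nat_mul.comp h1 (pow2_pr h4)) (Primrec.nat_mul.comp h3 (pow2_pr h2))

theorem dmin_pr (hx : Primrec x) (hy : Primrec y) : Primrec fun z => dmin (x z) (y z) :=
  Primrec.cond (dlt_pr hx hy) hx hy

theorem deighth_pr (hx : Primrec x) : Primrec fun z => deighth (x z) :=
  Primrec.pair (Primrec.fst.comp hx) (Primrec.nat_add.comp (Primrec.snd.comp hx) (Primrec.const 3))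

/-- closure form of primitive recursion -/
theorem rec_pr {γ : Type*} [Primcodable γ] {n : β → ℕ} {g : β → γ} {h : β → ℕ → γ → γ} (hn : Primrec n)
    (hg : Primrec g) (hh : Primrec fun p : β × ℕ × γ => h p.1 p.2.1 p.2.2) :
    Primrec fun z => (Nat.rec (g z) (h z) (n z) : γ) :=
  Primrec.nat_rec' (f := n) (g := g) (h := fun z p => h z p.1 p.2) hn hg hh

theorem foldr_pr {γ δ : Type*} [Primcodable γ] [Primcodable δ] {l : β → List δ} {g : β → γ} {h : β → δ → γ → γ}
    (hl : Primrec l) (hg : Primrec g) (hh : Primrec fun p : β × δ × γ => h p.1 p.2.1 p.2.2) :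
    Primrec fun z => (l z).foldr (h z) (g z) :=
  Primrec.list_foldr (f := l) (g := g) (h := fun z p => h z p.1 p.2) hl hg hh
end pr

structure Inp where
  f : ℕ → Option (Str × Str)
  X : Bool → ℕ → ℕ → Bool
  H : ℕ → ℕ → Bool
  n0 : ℕ
  k0 : ℕ
  hf : Primrec f
  hX : Primrec fun p : Bool × ℕ × ℕ => X p.1 p.2.1 p.2.2
  hH : Primrec fun p : ℕ × ℕ => H p.1 p.2

/-- kind, level, base, time, payment -/
abbrev Item := ℕ × ℕ × ℕ × ℕ × Dy

namespace Inp
variable (I : Inp)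

def wD (i : ℕ) : Dy := ((I.f i).map fun q => (1, q.1.length)).getD (0, 0)
def strF (i : ℕ) : Str := ((I.f i).map fun q => q.2).getD []
def SD (x : ℕ) : Dy := Nat.rec (0, 0) (fun i acc => dadd acc (I.wD i)) x
def preX (ty : Bool) (s n : ℕ) : Str := (List.range n).map (I.X ty s)
def goodB (ty : Bool) (i s : ℕ) : Bool := decide (I.strF i = I.preX ty s (I.strF i).length)
def costD (ty : Bool) (x s : ℕ) : Dy :=
  Nat.rec (0, 0) (fun i acc => cond (decide (x < (I.strF i).length) && I.goodB ty i s) (dadd acc (I.wD i)) acc) s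
def baseL (L : List Item) (e : ℕ) : ℕ :=
  L.foldr (fun it b => cond (!decide (it.1 = 0) && !decide (e < it.2.1)) (max b it.2.2.2.1) b) (max I.n0 e)
def alphaL (L : List Item) (ty : Bool) (e s' : ℕ) : Dy :=
  L.foldr (fun it acc => cond (decide (1 < it.1) && decide (it.2.1 < e)) (0, 0)
    (cond (decide (it.1 = cond ty 3 2) && (decide (it.2.1 = e) &&
      decide (I.preX ty s' it.2.2.1 = I.preX ty it.2.2.2.1 it.2.2.1))) (dadd it.2.2.2.2 acc) acc)) (0, 0)
def tD (L : List Item) (s' e : ℕ) (G : Dy) : Dy :=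
  dmin (dsub (dmul G (I.SD (I.baseL L e))) (I.alphaL L false e s'))
    (dsub (dmul G (I.SD (I.baseL L e))) (I.alphaL L true e s'))
def GD (L : List Item) (s' e : ℕ) : Dy :=
  Nat.rec (1, I.k0) (fun e G => deighth (I.tD L s' e G)) e
def tauD (L : List Item) (s' e : ℕ) : Dy := I.tD L s' e (I.GD L s' e)
def trig (L : List Item) (s e : ℕ) : ℕ :=
  cond (dlt (I.tauD L s e) (I.costD false (I.baseL L e) s)) 2
    (cond (dlt (I.tauD L s e) (I.costD true (I.baseL L e) s)) 3
      (cond (I.H s e && !I.H (s-1) e) 1 0))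
def find (L : List Item) (s m : ℕ) : ℕ × ℕ :=
  Nat.rec (0, 0) (fun e acc => cond (decide (acc.1 = 0)) (I.trig L s e, e) acc) m
def stepItem (s : ℕ) (L : List Item) : Item :=
  ((I.find L s s).1, (I.find L s s).2, I.baseL L (I.find L s s).2, s, I.tauD L s (I.find L s s).2)
def hist (s : ℕ) : List Item := Nat.rec [] (fun s L => I.stepItem (s+1) L :: L) s

section pr
variable {I}
variable {β : Type*} [Primcodable β] {s s' e x n i : β → ℕ} {ty : β → Bool} {L : β → List Item}

theorem X_pr (hty : Primrec ty) (hs : Primrec s) (hx : Primrec x) : Primrec fun z => I.X (ty z) (s z) (x z) :=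
  I.hX.comp (Primrec.pair hty (Primrec.pair hs hx))

theorem wD_pr (hi : Primrec i) : Primrec fun z => I.wD (i z) :=
  Primrec.option_getD.comp (Primrec.option_map (I.hf.comp hi)
    (Primrec.pair (Primrec.const 1) (Primrec.list_length.comp (Primrec.fst.comp Primrec.snd))).to₂)
    (Primrec.const (0,0))

theorem strF_pr (hi : Primrec i) : Primrec fun z => I.strF (i z) :=
  Primrec.option_getD.comp (Primrec.option_map (I.hf.comp hi)
    (Primrec.snd.comp Primrec.snd).to₂) (Primrec.const [])

theorem SD_pr (hx : Primrec x) : Primrec fun z => I.SD (x z) :=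
  rec_pr (g := fun _ => ((0,0) : Dy)) (h := fun _ i acc => dadd acc (I.wD i)) hx (Primrec.const (0,0))
    (dadd_pr (Primrec.snd.comp Primrec.snd) (wD_pr (Primrec.fst.comp Primrec.snd)))

theorem preX_pr (hty : Primrec ty) (hs : Primrec s) (hn : Primrec n) :
    Primrec fun z => I.preX (ty z) (s z) (n z) :=
  Primrec.list_map (f := fun z => List.range (n z)) (g := fun z y => I.X (ty z) (s z) y)
    (Primrec.list_range.comp hn)
    (X_pr (hty.comp Primrec.fst) (hs.comp Primrec.fst) Primrec.snd)

theorem goodB_pr (hty : Primrec ty) (hi : Primrec i) (hs : Primrec s) :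
    Primrec fun z => I.goodB (ty z) (i z) (s z) :=
  eq_pr (strF_pr hi) (preX_pr hty hs (Primrec.list_length.comp (strF_pr hi)))

theorem costD_pr (hty : Primrec ty) (hx : Primrec x) (hs : Primrec s) :
    Primrec fun z => I.costD (ty z) (x z) (s z) := by
  have hi : Primrec fun p : β × ℕ × Dy => p.2.1 := Primrec.fst.comp Primrec.snd
  have ha : Primrec fun p : β × ℕ × Dy => p.2.2 := Primrec.snd.comp Primrec.snd
  have h0 : Primrec fun p : β × ℕ × Dy => p.1 := Primrec.fst
  exact rec_pr (g := fun _ => ((0,0) : Dy)) (h := fun z i acc =>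
    cond (decide (x z < (I.strF i).length) && I.goodB (ty z) i (s z)) (dadd acc (I.wD i)) acc)
    hs (Primrec.const (0,0)) (Primrec.cond (Primrec.and.comp
      (lt_pr (hx.comp h0) (Primrec.list_length.comp (strF_pr hi)))
      (goodB_pr (hty.comp h0) hi (hs.comp h0))) (dadd_pr ha (wD_pr hi)) ha)

theorem baseL_pr (hL : Primrec L) (he : Primrec e) : Primrec fun z => I.baseL (L z) (e z) := by
  have hit : Primrec fun p : β × Item × ℕ => p.2.1 := Primrec.fst.comp Primrec.snd
  have ha : Primrec fun p : β × Item × ℕ => p.2.2 := Primrec.snd.comp Primrec.snd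
  have h0 : Primrec fun p : β × Item × ℕ => p.1 := Primrec.fst
  have h1 := Primrec.fst.comp hit
  have h2 := Primrec.fst.comp (Primrec.snd.comp hit)
  have h4 := Primrec.fst.comp (Primrec.snd.comp (Primrec.snd.comp (Primrec.snd.comp hit)))
  exact foldr_pr (g := fun z => max I.n0 (e z)) (h := fun z (it : Item) b =>
      cond (!decide (it.1 = 0) && !decide (e z < it.2.1)) (max b it.2.2.2.1) b) hL
    (Primrec.nat_max.comp (Primrec.const _) he)
    (Primrec.cond (Primrec.and.comp (Primrec.not.comp (eq_pr h1 (Primrec.const 0)))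
      (Primrec.not.comp (lt_pr (he.comp h0) h2))) (Primrec.nat_max.comp ha h4) ha)

theorem alphaL_pr (hL : Primrec L) (hty : Primrec ty) (he : Primrec e) (hs : Primrec s') :
    Primrec fun z => I.alphaL (L z) (ty z) (e z) (s' z) := by
  have hit : Primrec fun p : β × Item × Dy => p.2.1 := Primrec.fst.comp Primrec.snd
  have ha : Primrec fun p : β × Item × Dy => p.2.2 := Primrec.snd.comp Primrec.snd
  have h0 : Primrec fun p : β × Item × Dy => p.1 := Primrec.fst
  have h1 := Primrec.fst.comp hit
  have h2 := Primrec.fst.comp (Primrec.snd.comp hit)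
  have h3 := Primrec.fst.comp (Primrec.snd.comp (Primrec.snd.comp hit))
  have h4 := Primrec.fst.comp (Primrec.snd.comp (Primrec.snd.comp (Primrec.snd.comp hit)))
  have h5 := Primrec.snd.comp (Primrec.snd.comp (Primrec.snd.comp (Primrec.snd.comp hit)))
  exact foldr_pr (g := fun _ => ((0,0) : Dy)) (h := fun z (it : Item) acc =>
      cond (decide (1 < it.1) && decide (it.2.1 < e z)) (0, 0)
    (cond (decide (it.1 = cond (ty z) 3 2) && (decide (it.2.1 = e z) &&
      decide (I.preX (ty z) (s' z) it.2.2.1 = I.preX (ty z) it.2.2.2.1 it.2.2.1))) (dadd it.2.2.2.2 acc) acc)) hL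
    (Primrec.const (0,0))
    (Primrec.cond (Primrec.and.comp (lt_pr (Primrec.const 1) h1) (lt_pr h2 (he.comp h0)))
      (Primrec.const (0,0))
      (Primrec.cond (Primrec.and.comp
        (eq_pr h1 (Primrec.cond (hty.comp h0) (Primrec.const 3) (Primrec.const 2)))
        (Primrec.and.comp (eq_pr h2 (he.comp h0))
          (eq_pr (preX_pr (hty.comp h0) (hs.comp h0) h3) (preX_pr (hty.comp h0) h4 h3))))
        (dadd_pr h5 ha) ha))

theorem tD_pr {G : β → Dy} (hL : Primrec L) (hs : Primrec s') (he : Primrec e) (hG : Primrec G) :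
    Primrec fun z => I.tD (L z) (s' z) (e z) (G z) := by
  have hb := dmul_pr hG (SD_pr (I := I) (baseL_pr (I := I) hL he))
  exact dmin_pr (dsub_pr hb (alphaL_pr hL (Primrec.const false) he hs))
    (dsub_pr hb (alphaL_pr hL (Primrec.const true) he hs))

theorem GD_pr (hL : Primrec L) (hs : Primrec s') (he : Primrec e) :
    Primrec fun z => I.GD (L z) (s' z) (e z) :=
  rec_pr (g := fun _ => ((1, I.k0) : Dy)) (h := fun z e G => deighth (I.tD (L z) (s' z) e G)) he
    (Primrec.const _) (deighth_pr (tD_pr (hL.comp Primrec.fst) (hs.comp Primrec.fst)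
      (Primrec.fst.comp Primrec.snd) (Primrec.snd.comp Primrec.snd)))

theorem tauD_pr (hL : Primrec L) (hs : Primrec s') (he : Primrec e) :
    Primrec fun z => I.tauD (L z) (s' z) (e z) := tD_pr hL hs he (GD_pr hL hs he)

theorem trig_pr (hL : Primrec L) (hs : Primrec s) (he : Primrec e) :
    Primrec fun z => I.trig (L z) (s z) (e z) := by
  have ht := tauD_pr (I := I) hL hs he
  have hb := baseL_pr (I := I) hL he
  have hH1 : Primrec fun z => I.H (s z) (e z) := I.hH.comp (Primrec.pair hs he)
  have hH2 : Primrec fun z => I.H (s z - 1) (e z) := I.hH.comp (Primrec.pair (Primrec.pred.comp hs) he)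
  exact Primrec.cond (dlt_pr ht (costD_pr (Primrec.const false) hb hs)) (Primrec.const 2)
    (Primrec.cond (dlt_pr ht (costD_pr (Primrec.const true) hb hs)) (Primrec.const 3)
      (Primrec.cond (Primrec.and.comp hH1 (Primrec.not.comp hH2)) (Primrec.const 1) (Primrec.const 0)))

theorem find_pr (hL : Primrec L) (hs : Primrec s) (hn : Primrec n) :
    Primrec fun z => I.find (L z) (s z) (n z) := by
  have ha : Primrec fun p : β × ℕ × (ℕ × ℕ) => p.2.2 := Primrec.snd.comp Primrec.snd
  have he : Primrec fun p : β × ℕ × (ℕ × ℕ) => p.2.1 := Primrec.fst.comp Primrec.snd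
  exact rec_pr (g := fun _ => ((0, 0) : ℕ × ℕ)) (h := fun z e acc =>
      cond (decide (acc.1 = 0)) (I.trig (L z) (s z) e, e) acc) hn
    (Primrec.const _) (Primrec.cond (eq_pr (Primrec.fst.comp ha) (Primrec.const 0))
      (Primrec.pair (trig_pr (hL.comp Primrec.fst) (hs.comp Primrec.fst) he) he) ha)

theorem stepItem_pr (hs : Primrec s) (hL : Primrec L) : Primrec fun z => I.stepItem (s z) (L z) := by
  have hf := find_pr (I := I) hL hs hs
  have h2 := Primrec.snd.comp hf
  exact Primrec.pair (Primrec.fst.comp hf) (Primrec.pair h2 (Primrec.pair (baseL_pr hL h2)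
    (Primrec.pair hs (tauD_pr hL hs h2))))

theorem hist_pr (hs : Primrec s) : Primrec fun z => I.hist (s z) := by
  have h1 : Primrec fun p : β × ℕ × List Item => p.2.2 := Primrec.snd.comp Primrec.snd
  have h2 : Primrec fun p : β × ℕ × List Item => p.2.1 := Primrec.fst.comp Primrec.snd
  exact rec_pr (g := fun _ => ([] : List Item)) (h := fun _ s L => I.stepItem (s+1) L :: L) hs
    (Primrec.const _) (Primrec.list_cons.comp (stepItem_pr (Primrec.succ.comp h2) h1) h1)

end pr

/-- item at time `s` -/
def item (s : ℕ) : Item := Nat.casesOn s (0, 0, 0, 0, (0,0)) (fun n => I.stepItem (n+1) (I.hist n))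

noncomputable def dat : Dat where
  X := I.X
  w := fun i => pv (I.wD i)
  str := I.strF
  g := pv (1, I.k0)
  n0 := I.n0
  kind := fun s => (I.item s).1
  lev := fun s => (I.item s).2.1
  τ := fun s => pv (I.item s).2.2.2.2
  H := I.H

theorem base_eq (s e : ℕ) : I.dat.base s e = I.baseL (I.hist s) e := by
  induction s with
  | zero => rfl
  | succ n ih =>
    change _ = cond (!decide ((I.item (n+1)).1 = 0) && !decide (e < (I.item (n+1)).2.1))
      (max (I.baseL (I.hist n) e) (n+1)) (I.baseL (I.hist n) e)
    rw [Dat.base, ih]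
    by_cases h1 : (I.item (n+1)).1 = 0
    · rw [if_neg (by rintro ⟨h, _⟩; exact h h1)]; simp [h1]
    · by_cases h2 : e < (I.item (n+1)).2.1
      · rw [if_neg (by rintro ⟨_, h⟩; exact absurd h2 (by exact not_lt.2 h))]; simp [h1, h2]
      · rw [if_pos ⟨h1, not_lt.1 h2⟩]; simp [h1, h2]

theorem S_eq (x : ℕ) : I.dat.S x = pv (I.SD x) := by
  induction x with
  | zero => simp [Dat.S, SD, pv]
  | succ n ih =>
    rw [Dat.S, Finset.sum_range_succ]
    change I.dat.S n + pv (I.wD n) = pv (dadd (I.SD n) (I.wD n))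
    rw [pv_dadd, ih]

theorem goodB_iff (ty : Bool) (i s : ℕ) : I.goodB ty i s = true ↔ I.dat.good ty i s := by
  simp only [goodB, decide_eq_true_eq]; rfl

theorem cost_eq (ty : Bool) (x s : ℕ) : I.dat.cost ty x s = pv (I.costD ty x s) := by
  have : ∀ m, ∑ i ∈ Finset.range m, (open Classical in if x < I.dat.len i ∧ I.dat.good ty i s then I.dat.w i else 0) =
    pv (Nat.rec (0, 0) (fun i acc => cond (decide (x < (I.strF i).length) && I.goodB ty i s) (dadd acc (I.wD i)) acc) m) := by
    intro m
    induction m with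
    | zero => simp [pv]
    | succ n ih =>
      rw [Finset.sum_range_succ, ih]
      simp only
      have e : (decide (x < (I.strF n).length) && I.goodB ty n s) = true ↔ (x < I.dat.len n ∧ I.dat.good ty n s) := by
        rw [Bool.and_eq_true, goodB_iff, decide_eq_true_eq]; rfl
      by_cases h : x < I.dat.len n ∧ I.dat.good ty n s
      · rw [if_pos h, e.2 h, cond_true, pv_dadd]; rfl
      · rw [if_neg h, Bool.eq_false_iff.2 (fun h' => h (e.1 h')), cond_false, add_zero]
  exact this s

theorem α_eq (ty : Bool) (e s' s : ℕ) : I.dat.α ty e s' s = pv (I.alphaL (I.hist s) ty e s') := by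
  induction s with
  | zero => simp [Dat.α, alphaL, hist, pv]
  | succ n ih =>
    change _ = pv (cond (decide (1 < (I.item (n+1)).1) && decide ((I.item (n+1)).2.1 < e)) (0, 0)
     (cond (decide ((I.item (n+1)).1 = cond ty 3 2) && (decide ((I.item (n+1)).2.1 = e) &&
      decide (I.preX ty s' (I.item (n+1)).2.2.1 = I.preX ty (n+1) (I.item (n+1)).2.2.1)))
        (dadd (I.item (n+1)).2.2.2.2 (I.alphaL (I.hist n) ty e s')) (I.alphaL (I.hist n) ty e s')))
    rw [Dat.α, ih]
    have e1 : (decide (1 < (I.item (n+1)).1) && decide ((I.item (n+1)).2.1 < e)) = true ↔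
        (I.dat.Ev (n+1) ∧ I.dat.lev (n+1) < e) := by
      rw [Bool.and_eq_true, decide_eq_true_eq, decide_eq_true_eq]; rfl
    have e3 : (I.item (n+1)).2.2.1 = I.dat.bs (n+1) := by
      rw [Dat.bs, base_eq]; rfl
    have e2 : (decide ((I.item (n+1)).1 = cond ty 3 2) && (decide ((I.item (n+1)).2.1 = e) &&
      decide (I.preX ty s' (I.item (n+1)).2.2.1 = I.preX ty (n+1) (I.item (n+1)).2.2.1))) = true ↔
      (I.dat.EvT ty (n+1) ∧ I.dat.lev (n+1) = e ∧ I.dat.alive ty (n+1) s') := by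
      rw [Bool.and_eq_true, Bool.and_eq_true, decide_eq_true_eq, decide_eq_true_eq, decide_eq_true_eq, e3]
      have : I.preX ty s' (I.dat.bs (n+1)) = I.preX ty (n+1) (I.dat.bs (n+1)) ↔ I.dat.alive ty (n+1) s' := by
        simp only [preX, List.map_inj_left, List.mem_range]; rfl
      rw [this]; rfl
    by_cases h1 : I.dat.Ev (n+1) ∧ I.dat.lev (n+1) < e
    · rw [if_pos h1, e1.2 h1]; simp [pv]
    · rw [if_neg h1, Bool.eq_false_iff.2 (fun h' => h1 (e1.1 h')), cond_false]
      by_cases h2 : I.dat.EvT ty (n+1) ∧ I.dat.lev (n+1) = e ∧ I.dat.alive ty (n+1) s'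
      · rw [if_pos h2, e2.2 h2, cond_true, pv_dadd]; rfl
      · rw [if_neg h2, Bool.eq_false_iff.2 (fun h' => h2 (e2.1 h')), cond_false]

theorem tt_eq (s s' e : ℕ) (G : Dy) : I.dat.tt s s' e (pv G) = pv (I.tD (I.hist s) s' e G) := by
  unfold Dat.tt tD
  rw [pv_dmin, pv_dsub, pv_dsub, pv_dmul, base_eq, S_eq, α_eq, α_eq, max_min_distrib_left]

theorem G_eq (s s' e : ℕ) : I.dat.G s s' e = pv (I.GD (I.hist s) s' e) := by
  induction e with
  | zero => rfl
  | succ n ih =>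
    rw [Dat.G, ih, tt_eq, ← pv_eighth]; rfl

theorem t_eq (s s' e : ℕ) : I.dat.t s s' e = pv (I.tauD (I.hist s) s' e) := by
  rw [Dat.t, G_eq, tt_eq]; rfl

theorem find_spec (L : List Item) (s m : ℕ) :
    ((I.find L s m).1 = 0 ∧ ∀ e < m, I.trig L s e = 0) ∨
    ((I.find L s m).1 ≠ 0 ∧ (I.find L s m).2 < m ∧ (I.find L s m).1 = I.trig L s (I.find L s m).2 ∧
      ∀ e < (I.find L s m).2, I.trig L s e = 0) := by
  induction m with
  | zero => left; exact ⟨rfl, fun e he => by omega⟩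
  | succ m ih =>
    have hs : I.find L s (m+1) = cond (decide ((I.find L s m).1 = 0)) (I.trig L s m, m) (I.find L s m) := rfl
    rcases ih with ⟨h1, h2⟩ | ⟨h1, h2, h3, h4⟩
    · rw [hs, h1]
      simp only [decide_true, cond_true]
      by_cases h : I.trig L s m = 0
      · left; refine ⟨h, fun e he => ?_⟩
        rcases (Nat.lt_succ_iff.1 he).eq_or_lt with rfl | h5
        · exact h
        · exact h2 e h5
      · right; exact ⟨h, by omega, trivial, h2⟩
    · right
      rw [hs]
      simp only [h1, decide_false, cond_false]
      exact ⟨h1, by omega, h3, h4⟩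

structure OK : Prop where
  Xmono : ∀ ty s y, I.X ty s y = true → I.X ty (s+1) y = true
  Hmono : ∀ s y, I.H s y = true → I.H (s+1) y = true
  wsum : ∀ T, ∑ i ∈ Finset.range T, pv (I.wD i) ≤ 1
  len_le : ∀ i, (I.strF i).length ≤ i
  desc : ∀ ty n, ∃ i, n < (I.strF i).length ∧ 0 < pv (I.wD i) ∧ ∃ s1, ∀ s ≥ s1, I.dat.good ty i s

theorem trig_vals (L : List Item) (s e : ℕ) :
    (I.trig L s e = 2 ∧ pv (I.tauD L s e) < pv (I.costD false (I.baseL L e) s)) ∨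
    (I.trig L s e = 3 ∧ pv (I.tauD L s e) < pv (I.costD true (I.baseL L e) s)) ∨
    ((∀ ty, pv (I.costD ty (I.baseL L e) s) ≤ pv (I.tauD L s e)) ∧
      ((I.trig L s e = 1 ∧ I.H s e = true ∧ I.H (s-1) e = false) ∨
       (I.trig L s e = 0 ∧ ¬ (I.H s e = true ∧ I.H (s-1) e = false)))) := by
  unfold trig
  rw [← dlt_iff, ← dlt_iff]
  cases h1 : dlt (I.tauD L s e) (I.costD false (I.baseL L e) s) with
  | true => left; simp
  | false =>
    cases h2 : dlt (I.tauD L s e) (I.costD true (I.baseL L e) s) with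
    | true => right; left; simp
    | false =>
      right; right
      constructor
      · intro ty
        rw [← not_lt, ← dlt_iff]
        cases ty
        · rw [h1]; simp
        · rw [h2]; simp
      · simp only [cond_false]
        cases h3 : I.H s e <;> cases h4 : I.H (s-1) e <;> simp

theorem good (h : I.OK) : I.dat.Good where
  Xmono := h.Xmono
  Hmono := h.Hmono
  wnn := fun i => pv_nn _
  wsum := h.wsum
  len_le := h.len_le
  kind0 := rfl
  kind_le := by
    intro s
    cases s with
    | zero => exact Nat.zero_le _
    | succ n =>
      change (I.find (I.hist n) (n+1) (n+1)).1 ≤ 3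
      rcases I.find_spec (I.hist n) (n+1) (n+1) with h1 | h1
      · rw [h1.1]; exact Nat.zero_le _
      · rw [h1.2.2.1]
        rcases I.trig_vals (I.hist n) (n+1) (I.find (I.hist n) (n+1) (n+1)).2 with h2 | h2 | ⟨_, h2 | h2⟩ <;> omega
  gpos := by change 0 < pv (1, I.k0); simp [pv]
  lev_lt := by
    intro n hk
    rcases I.find_spec (I.hist n) (n+1) (n+1) with h1 | h1
    · exact absurd h1.1 hk
    · exact h1.2.1
  tau_eq := by
    intro n hk
    rw [t_eq]; rfl
  ev_cost := by
    intro ty n hE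
    have hE : (I.find (I.hist n) (n+1) (n+1)).1 = cond ty 3 2 := hE
    change pv (I.tauD (I.hist n) (n+1) (I.find (I.hist n) (n+1) (n+1)).2) <
      I.dat.cost ty (I.dat.base n (I.find (I.hist n) (n+1) (n+1)).2) (n+1)
    rw [cost_eq, base_eq]
    rcases I.find_spec (I.hist n) (n+1) (n+1) with h1 | h1
    · rw [h1.1] at hE; cases ty <;> simp at hE
    · rw [h1.2.2.1] at hE
      rcases I.trig_vals (I.hist n) (n+1) (I.find (I.hist n) (n+1) (n+1)).2 with h2 | h2 | ⟨_, h2 | h2⟩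
      · rw [h2.1] at hE; cases ty
        · exact h2.2
        · simp at hE
      · rw [h2.1] at hE; cases ty
        · simp at hE
        · exact h2.2
      · rw [h2.1] at hE; cases ty <;> simp at hE
      · rw [h2.1] at hE; cases ty <;> simp at hE
  quiet := by
    intro n e he hq ty
    have hq : (I.find (I.hist n) (n+1) (n+1)).1 ≠ 0 → e < (I.find (I.hist n) (n+1) (n+1)).2 := hq
    rw [cost_eq, base_eq, t_eq]
    have h0 : I.trig (I.hist n) (n+1) e = 0 := by
      rcases I.find_spec (I.hist n) (n+1) (n+1) with h1 | h1
      · exact h1.2 e he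
      · exact h1.2.2.2 e (hq h1.1)
    rcases I.trig_vals (I.hist n) (n+1) e with h2 | h2 | ⟨h2, _⟩
    · omega
    · omega
    · exact h2 ty
  code := by
    intro n hk
    have hk : (I.find (I.hist n) (n+1) (n+1)).1 = 1 := hk
    change I.H (n+1) (I.find (I.hist n) (n+1) (n+1)).2 = true ∧ I.H n (I.find (I.hist n) (n+1) (n+1)).2 = false
    rcases I.find_spec (I.hist n) (n+1) (n+1) with h1 | h1
    · omega
    · rw [h1.2.2.1] at hk
      rcases I.trig_vals (I.hist n) (n+1) (I.find (I.hist n) (n+1) (n+1)).2 with h2 | h2 | ⟨_, h2 | h2⟩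
      · omega
      · omega
      · exact h2.2
      · omega
  code' := by
    intro n e h1 h2 he
    change (I.find (I.hist n) (n+1) (n+1)).1 ≠ 0 ∧ (I.find (I.hist n) (n+1) (n+1)).2 ≤ e
    have h0 : I.trig (I.hist n) (n+1) e ≠ 0 := by
      rcases I.trig_vals (I.hist n) (n+1) e with h3 | h3 | ⟨_, h3 | h3⟩
      · omega
      · omega
      · omega
      · exact absurd ⟨h1, h2⟩ h3.2
    rcases I.find_spec (I.hist n) (n+1) (n+1) with h3 | h3
    · exact absurd (h3.2 e he) h0
    · refine ⟨h3.1, ?_⟩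
      by_contra h4
      exact h0 (h3.2.2.2 e (by omega))
  desc := h.desc

end Inp
end KPaper


namespace KPaper
open Nat.Partrec (Code)
open Nat.Partrec.Code (evaln eval)

/-! ### enumerations -/

theorem ce_approx {A : Set ℕ} (h : CESet A) : ∃ c : Code, ∀ n, n ∈ A ↔ ∃ s, (evaln s c n).isSome = true := by
  obtain ⟨f, hf, h⟩ := h
  obtain ⟨c, rfl⟩ := Nat.Partrec.Code.exists_code.1 hf
  refine ⟨c, fun n => ?_⟩
  rw [h, Part.dom_iff_mem]
  constructor
  · rintro ⟨y, hy⟩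
    obtain ⟨k, hk⟩ := Nat.Partrec.Code.evaln_complete.1 hy
    exact ⟨k, by rw [Option.isSome_iff_exists]; exact ⟨y, hk⟩⟩
  · rintro ⟨s, hs⟩
    obtain ⟨y, hy⟩ := Option.isSome_iff_exists.1 hs
    exact ⟨y, Nat.Partrec.Code.evaln_sound hy⟩

theorem ce_mono (c : Code) (s n : ℕ) (h : (evaln s c n).isSome = true) : (evaln (s+1) c n).isSome = true := by
  obtain ⟨y, hy⟩ := Option.isSome_iff_exists.1 h
  exact Option.isSome_iff_exists.2 ⟨y, Nat.Partrec.Code.evaln_mono (Nat.le_succ s) hy⟩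

theorem ce_halt : CESet haltingSet := by
  refine ⟨fun n => (Denumerable.ofNat Code n).eval n, ?_, fun n => Iff.rfl⟩
  refine Partrec.nat_iff.1 ?_
  exact Nat.Partrec.Code.eval_part.comp (Computable.ofNat Code) Computable.id

theorem evaln_pr {β : Type*} [Primcodable β] {s n : β → ℕ} {c : β → Code} (hs : Primrec s) (hc : Primrec c)
    (hn : Primrec n) : Primrec fun z => evaln (s z) (c z) (n z) :=
  Nat.Partrec.Code.primrec_evaln.comp (Primrec.pair (Primrec.pair hs hc) hn)

def qF (c : Code) (k a : ℕ) : Option Str :=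
  (evaln k c a).bind fun v => (Encodable.decode (α := Str) v).bind fun σ => cond (decide (σ.length < k)) (some σ) none

def eF (c : Code) (i : ℕ) : Option (Str × Str) :=
  (Encodable.decode (α := Str) i.unpair.1).bind fun ρ =>
    (qF c (i.unpair.2 + 1) i.unpair.1).bind fun σ =>
      cond (decide (Encodable.encode ρ = i.unpair.1) && !(qF c i.unpair.2 i.unpair.1).isSome) (some (ρ, σ)) none

theorem qF_pr (c : Code) {β : Type*} [Primcodable β] {k a : β → ℕ} (hk : Primrec k) (ha : Primrec a) :
    Primrec fun z => qF c (k z) (a z) := by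
  refine Primrec.option_bind (evaln_pr hk (Primrec.const c) ha) ?_
  refine Primrec.option_bind (Primrec.decode.comp Primrec.snd) ?_
  exact Primrec.cond (lt_pr (Primrec.list_length.comp Primrec.snd) (hk.comp (Primrec.fst.comp Primrec.fst)))
    (Primrec.option_some.comp Primrec.snd) (Primrec.const none)

theorem eF_pr (c : Code) : Primrec (eF c) := by
  have h1 : Primrec fun i : ℕ => i.unpair.1 := Primrec.fst.comp Primrec.unpair
  have h2 : Primrec fun i : ℕ => i.unpair.2 := Primrec.snd.comp Primrec.unpair
  refine Primrec.option_bind (Primrec.decode.comp h1) ?_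
  refine Primrec.option_bind (qF_pr c (Primrec.succ.comp (h2.comp Primrec.fst)) (h1.comp Primrec.fst)) ?_
  have h0 : Primrec fun p : (ℕ × Str) × Str => p.1.1 := Primrec.fst.comp Primrec.fst
  have hr : Primrec fun p : (ℕ × Str) × Str => p.1.2 := Primrec.snd.comp Primrec.fst
  exact Primrec.cond (Primrec.and.comp (eq_pr (Primrec.encode.comp hr) (h1.comp h0))
    (Primrec.not.comp (Primrec.option_isSome.comp (qF_pr c (h2.comp h0) (h1.comp h0)))))
    (Primrec.option_some.comp (Primrec.pair hr Primrec.snd)) (Primrec.const none)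

theorem qF_some {c : Code} {k a : ℕ} {σ : Str} : qF c k a = some σ ↔
    ∃ v, evaln k c a = some v ∧ Encodable.decode (α := Str) v = some σ ∧ σ.length < k := by
  unfold qF
  simp only [Option.bind_eq_some_iff]
  constructor
  · rintro ⟨v, h1, τ, h2, h3⟩
    by_cases h : τ.length < k
    · simp [h] at h3; subst h3; exact ⟨v, h1, h2, h⟩
    · simp [h] at h3
  · rintro ⟨v, h1, h2, h3⟩
    exact ⟨v, h1, σ, h2, by simp [h3]⟩

theorem eF_some {c : Code} {i : ℕ} {ρ σ : Str} : eF c i = some (ρ, σ) ↔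
    Encodable.encode ρ = i.unpair.1 ∧ qF c (i.unpair.2 + 1) i.unpair.1 = some σ ∧ qF c i.unpair.2 i.unpair.1 = none := by
  unfold eF
  simp only [Option.bind_eq_some_iff]
  constructor
  · rintro ⟨ρ', h1, σ', h2, h3⟩
    by_cases h : Encodable.encode ρ' = i.unpair.1
    · cases h4 : qF c i.unpair.2 i.unpair.1 with
      | none => simp [h, h4] at h3; obtain ⟨rfl, rfl⟩ := h3; exact ⟨h, h2, rfl⟩
      | some x => simp [h4] at h3
    · simp [h] at h3
  · rintro ⟨h1, h2, h3⟩
    exact ⟨ρ, by rw [← h1, Encodable.encodek], σ, h2, by simp [h1, h3]⟩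

theorem qF_mono {c : Code} {k k' a : ℕ} {σ : Str} (h : k ≤ k') (hq : qF c k a = some σ) : qF c k' a = some σ := by
  rw [qF_some] at *
  obtain ⟨v, h1, h2, h3⟩ := hq
  exact ⟨v, Nat.Partrec.Code.evaln_mono h h1, h2, by omega⟩

theorem enum_U {U : Str →. Str} (hU : Partrec U) : ∃ f : ℕ → Option (Str × Str), Primrec f ∧
    (∀ i ρ σ, f i = some (ρ, σ) → σ ∈ U ρ ∧ σ.length ≤ i) ∧ (∀ ρ σ, σ ∈ U ρ → ∃ i, f i = some (ρ, σ)) ∧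
    (∀ i j ρ σ τ, f i = some (ρ, σ) → f j = some (ρ, τ) → i = j) := by
  obtain ⟨c, hc⟩ := Nat.Partrec.Code.exists_code.1 hU
  have hc' : ∀ ρ : Str, eval c (Encodable.encode ρ) = (U ρ).map Encodable.encode := by
    intro ρ; rw [hc]; simp
  refine ⟨eF c, eF_pr c, ?_, ?_, ?_⟩
  · intro i ρ σ h
    obtain ⟨h1, h2, h3⟩ := eF_some.1 h
    obtain ⟨v, h4, h5, h6⟩ := qF_some.1 h2
    constructor
    · have := Nat.Partrec.Code.evaln_sound h4
      rw [← h1, hc', Part.mem_map_iff] at this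
      obtain ⟨σ', h7, rfl⟩ := this
      rw [Encodable.encodek] at h5
      cases h5; exact h7
    · have := Nat.unpair_right_le i; omega
  · intro ρ σ h
    have h1 : Encodable.encode σ ∈ eval c (Encodable.encode ρ) := by
      rw [hc']; exact Part.mem_map _ h
    obtain ⟨k, hk⟩ := Nat.Partrec.Code.evaln_complete.1 h1
    have hex : ∃ k, (qF c k (Encodable.encode ρ)).isSome = true := by
      refine ⟨max k (σ.length + 1), Option.isSome_iff_exists.2 ⟨σ, qF_some.2 ⟨Encodable.encode σ, ?_, Encodable.encodek σ, by omega⟩⟩⟩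
      exact Nat.Partrec.Code.evaln_mono (le_max_left _ _) hk
    classical
    have hs := Nat.find_spec hex
    have hm := fun m => Nat.find_min hex (m := m)
    cases hn : Nat.find hex with
    | zero => rw [hn] at hs; simp [qF, Nat.Partrec.Code.evaln] at hs
    | succ n =>
      rw [hn] at hs hm
      obtain ⟨τ, hτ⟩ := Option.isSome_iff_exists.1 hs
      have h3 := hm n (by omega)
      obtain ⟨v, h4, h5, h6⟩ := qF_some.1 hτ
      have := Part.mem_unique (Nat.Partrec.Code.evaln_sound h4) h1
      subst this
      rw [Encodable.encodek] at h5; cases h5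
      refine ⟨Nat.pair (Encodable.encode ρ) n, eF_some.2 ?_⟩
      rw [Nat.unpair_pair]
      exact ⟨rfl, hτ, by simpa using h3⟩
  · intro i j ρ σ τ h1 h2
    obtain ⟨a1, a2, a3⟩ := eF_some.1 h1
    obtain ⟨b1, b2, b3⟩ := eF_some.1 h2
    rw [← a1] at a2 a3
    rw [← b1] at b2 b3
    have hk : i.unpair.2 = j.unpair.2 := by
      rcases lt_trichotomy i.unpair.2 j.unpair.2 with h | h | h
      · rw [qF_mono (k' := j.unpair.2) (by omega) a2] at b3; cases b3
      · exact h
      · rw [qF_mono (k' := i.unpair.2) (by omega) b2] at a3; cases a3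
    rw [← Nat.pair_unpair i, ← Nat.pair_unpair j, hk, ← a1, ← b1]

/-! ### Kraft -/

theorem pf_ud {S : Set Str} (h : ∀ ρ ∈ S, ∀ τ ∈ S, ρ <+: τ → ρ = τ) (hn : [] ∉ S) :
    InformationTheory.UniquelyDecodable S := by
  intro L₁
  induction L₁ with
  | nil =>
    intro L₂ _ h2 he
    cases L₂ with
    | nil => rfl
    | cons a L =>
      simp at he
      exact absurd (he.1 ▸ h2 a (by simp)) hn
  | cons a L ih =>
    intro L₂ h1 h2 he
    cases L₂ with
    | nil =>
      simp at he
      exact absurd (he.1 ▸ h1 a (by simp)) hn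
    | cons b M =>
      have ha := h1 a (by simp)
      have hb := h2 b (by simp)
      simp only [List.flatten_cons] at he
      have hab : a = b := by
        rcases pfx_total (List.prefix_append a L.flatten) (he ▸ List.prefix_append b M.flatten) with h3 | h3
        · exact h _ ha _ hb h3
        · exact (h _ hb _ ha h3).symm
      subst hab
      rw [ih M (fun w hw => h1 w (by simp [hw])) (fun w hw => h2 w (by simp [hw])) (List.append_cancel_left he)]

theorem kraft_fin (S : Finset Str) (h : ∀ ρ ∈ S, ∀ τ ∈ S, ρ <+: τ → ρ = τ) :
    ∑ w ∈ S, (1 / 2 : ℝ) ^ w.length ≤ 1 := by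
  by_cases hn : [] ∈ S
  · have : S = {[]} := by
      ext x; simp only [Finset.mem_singleton]
      constructor
      · intro hx; exact (h _ hn _ hx ⟨_, rfl⟩).symm
      · rintro rfl; exact hn
    rw [this]; simp
  · have := InformationTheory.kraft_mcmillan_inequality (S := S) (pf_ud (S := (S : Set Str)) (by simpa using h) (by simpa using hn))
    simpa using this

theorem kraft_enum {U : Str →. Str} (hU : PFMachine U) (f : ℕ → Option (Str × Str))
    (h1 : ∀ i ρ σ, f i = some (ρ, σ) → σ ∈ U ρ)
    (h2 : ∀ i j ρ σ τ, f i = some (ρ, σ) → f j = some (ρ, τ) → i = j) (T : ℕ) :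
    ∑ i ∈ Finset.range T, pv (((f i).map fun q => (1, q.1.length)).getD (0, 0)) ≤ 1 := by
  classical
  have e : ∑ i ∈ Finset.range T, pv (((f i).map fun q => (1, q.1.length)).getD (0, 0)) =
      ∑ i ∈ (Finset.range T).filter (fun i => (f i).isSome), (1 / 2 : ℝ) ^ (((f i).map fun q => q.1).getD []).length := by
    rw [Finset.sum_filter]
    refine Finset.sum_congr rfl fun i _ => ?_
    cases f i <;> simp [pv]
  rw [e]
  have inj : Set.InjOn (fun i => ((f i).map fun q => q.1).getD []) ((Finset.range T).filter (fun i => (f i).isSome) : Finset ℕ) := by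
    intro i hi j hj hij
    simp only [Finset.coe_filter, Set.mem_ofPred_eq] at hi hj
    obtain ⟨⟨ρ, σ⟩, hp⟩ := Option.isSome_iff_exists.1 hi.2
    obtain ⟨⟨ρ', σ'⟩, hq⟩ := Option.isSome_iff_exists.1 hj.2
    simp [hp, hq] at hij
    subst hij
    exact h2 _ _ _ _ _ hp hq
  rw [← Finset.sum_image (f := fun w : Str => (1 / 2 : ℝ) ^ w.length) inj]
  refine kraft_fin _ ?_
  intro ρ hρ τ hτ
  simp only [Finset.mem_image, Finset.mem_filter] at hρ hτ
  obtain ⟨i, ⟨_, hi⟩, rfl⟩ := hρ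
  obtain ⟨j, ⟨_, hj⟩, rfl⟩ := hτ
  obtain ⟨⟨ρ, σ⟩, hp⟩ := Option.isSome_iff_exists.1 hi
  obtain ⟨⟨ρ', σ'⟩, hq⟩ := Option.isSome_iff_exists.1 hj
  simp only [hp, hq, Option.map_some, Option.getD_some]
  exact hU.2 _ _ (Part.dom_iff_mem.2 ⟨_, h1 _ _ _ hp⟩) (Part.dom_iff_mem.2 ⟨_, h1 _ _ _ hq⟩)

/-! ### KC basics -/

theorem KC_le {M : Str →. Str} {σ ρ : Str} (h : σ ∈ M ρ) : KC M σ ≤ ρ.length :=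
  iInf_le (fun ρ : {ρ : Str // σ ∈ M ρ} => ((ρ : Str).length : ℕ∞)) ⟨ρ, h⟩

theorem le_KC {M : Str →. Str} {σ : Str} {x : ℕ∞} (h : ∀ ρ, σ ∈ M ρ → x ≤ ρ.length) : x ≤ KC M σ :=
  le_iInf fun ρ => h ρ.1 ρ.2

theorem KC_att {M : Str →. Str} {σ : Str} {n : ℕ} (h : KC M σ ≤ n) : ∃ ρ, σ ∈ M ρ := by
  by_contra hc
  push Not at hc
  have : (⊤ : ℕ∞) ≤ KC M σ := le_KC fun ρ hρ => absurd hρ (hc ρ)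
  exact absurd (this.trans h) (by simp)

theorem opt_desc {U : Str →. Str} (hU : OptimalPF U) (σ : Str) : ∃ ρ, σ ∈ U ρ := by
  let M : Str →. Str := fun ρ => ((cond (decide (ρ = [])) (some σ) none : Option Str) : Part Str)
  have hM : PFMachine M := by
    constructor
    · refine Computable.ofOption ?_
      exact (Primrec.cond (eq_pr Primrec.id (Primrec.const [])) (Primrec.const (some σ)) (Primrec.const none)).to_comp
    · intro ρ₁ ρ₂ h1 h2 _
      have : ∀ ρ, (M ρ).Dom → ρ = [] := by
        intro ρ h; by_contra hc; simp [M, hc] at h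
      rw [this _ h1, this _ h2]
  obtain ⟨c, hc⟩ := hU.2 M hM
  have h1 : KC M σ ≤ ([] : Str).length := KC_le (by simp [M])
  refine KC_att (n := 0 + c) ((hc σ).trans ?_)
  push_cast
  gcongr
  simpa using h1
end KPaper


namespace KPaper

theorem pair_sum (φ : ℕ → ℕ → ℝ) (h : ∀ a b, 0 ≤ φ a b) (T : ℕ) :
    ∑ m ∈ Finset.range T, φ m.unpair.1 m.unpair.2 ≤ ∑ a ∈ Finset.range T, ∑ b ∈ Finset.range T, φ a b := by
  classical
  rw [← Finset.sum_product' (f := φ)]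
  have inj : Set.InjOn Nat.unpair (Finset.range T : Set ℕ) := by
    intro a _ b _ hab
    rw [← Nat.pair_unpair a, ← Nat.pair_unpair b, hab]
  rw [← Finset.sum_image (f := fun p : ℕ × ℕ => φ p.1 p.2) inj]
  refine Finset.sum_le_sum_of_subset_of_nonneg ?_ fun _ _ _ => h _ _
  intro p hp
  obtain ⟨m, hm, rfl⟩ := Finset.mem_image.1 hp
  rw [Finset.mem_range] at hm
  simp only [Finset.mem_product, Finset.mem_range]
  exact ⟨(Nat.unpair_left_le m).trans_lt hm, (Nat.unpair_right_le m).trans_lt hm⟩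

theorem restr_eq {A : Set ℕ} {X : ℕ → Bool} {n : ℕ} (h : ∀ i < n, X i = true ↔ i ∈ A) :
    (List.range n).map X = restrSet A n := by
  unfold restrSet
  rw [List.map_inj_left]
  intro i hi
  rw [Bool.eq_iff_iff, h i (List.mem_range.1 hi)]; simp

namespace Inp

/-- `I` is a correct input for `U`, `A`, `D`. -/
structure Rl (U : Str →. Str) (Y : Bool → Set ℕ) (I : Inp) : Prop where
  sound : ∀ i ρ σ, I.f i = some (ρ, σ) → σ ∈ U ρ
  compl : ∀ ρ σ, σ ∈ U ρ → ∃ i, I.f i = some (ρ, σ)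
  Xlim : ∀ ty n, n ∈ Y ty ↔ ∃ s, I.X ty s n = true
  Hlim : ∀ n, n ∈ haltingSet ↔ ∃ s, I.H s n = true
  ok : I.OK

variable {I : Inp}

def Bset (I : Inp) : Set ℕ := {n | ∃ s, I.dat.Bs s n = true}

theorem Bs_pr {β : Type*} [Primcodable β] {s n : β → ℕ} (hs : Primrec s) (hn : Primrec n) :
    Primrec fun z => I.dat.Bs (s z) (n z) := by
  have h1 := Primrec.fst.comp (Primrec.unpair.comp hn)
  have h2 := Primrec.snd.comp (Primrec.unpair.comp hn)
  refine (lt_pr h2 (baseL_pr (I := I) (hist_pr (I := I) hs) h1)).of_eq fun z => ?_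
  rw [Dat.Bs, base_eq]

theorem preB_pr {β : Type*} [Primcodable β] {s n : β → ℕ} (hs : Primrec s) (hn : Primrec n) :
    Primrec fun z => I.dat.preB (s z) (n z) :=
  Primrec.list_map (f := fun z => List.range (n z)) (g := fun z y => I.dat.Bs (s z) y)
    (Primrec.list_range.comp hn) (Bs_pr (hs.comp Primrec.fst) Primrec.snd)

theorem conv_aux (F : ℕ → ℕ → Bool) (hF : ∀ s s' n, s ≤ s' → F s n = true → F s' n = true) (n : ℕ) :
    ∃ s0, ∀ s ≥ s0, ∀ i < n, F s i = true ↔ ∃ t, F t i = true := by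
  induction n with
  | zero => exact ⟨0, fun s _ i hi => by omega⟩
  | succ n ih =>
    obtain ⟨s0, h0⟩ := ih
    by_cases h : ∃ t, F t n = true
    · obtain ⟨t, ht⟩ := h
      refine ⟨max s0 t, fun s hs i hi => ?_⟩
      rcases (Nat.lt_succ_iff.1 hi).eq_or_lt with rfl | h1
      · exact ⟨fun h => ⟨_, h⟩, fun _ => hF t s _ (by omega) ht⟩
      · exact h0 s (by omega) i h1
    · refine ⟨s0, fun s hs i hi => ?_⟩
      rcases (Nat.lt_succ_iff.1 hi).eq_or_lt with rfl | h1
      · exact ⟨fun h => ⟨_, h⟩, fun h' => absurd h' h⟩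
      · exact h0 s (by omega) i h1

theorem preB_lim (n : ℕ) : ∃ s0, ∀ s ≥ s0, I.dat.preB s n = restrSet I.Bset n := by
  obtain ⟨s0, h⟩ := conv_aux I.dat.Bs (fun s s' n h => Dat.Bs_mono h) n
  exact ⟨s0, fun s hs => restr_eq fun i hi => h s hs i hi⟩

theorem pre_lim {U : Str →. Str} {Y : Bool → Set ℕ} (h : I.Rl U Y) (ty : Bool) (n : ℕ) :
    ∃ s0, ∀ s ≥ s0, I.dat.pre ty s n = restrSet (Y ty) n := by
  obtain ⟨s0, h0⟩ := conv_aux (I.X ty) (fun s s' n hs hx => (I.good h.ok).X_le hs hx) n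
  exact ⟨s0, fun s hs => restr_eq fun i hi => (h0 s hs i hi).trans (h.Xlim ty i).symm⟩

theorem pre_btw (h : I.OK) {ty : Bool} {a b c n : ℕ} (hab : a ≤ b) (hbc : b ≤ c)
    (he : I.dat.pre ty c n = I.dat.pre ty a n) : I.dat.pre ty b n = I.dat.pre ty a n := by
  simp only [Dat.pre, List.map_inj_left] at *
  exact fun y hy => (I.good h).X_btw hab hbc (he y hy)

theorem str_some {i : ℕ} {ρ σ : Str} (h : I.f i = some (ρ, σ)) : I.dat.str i = σ := by
  change I.strF i = σ; simp [strF, h]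

theorem len_some {i : ℕ} {ρ σ : Str} (h : I.f i = some (ρ, σ)) : I.dat.len i = σ.length := by
  rw [Dat.len, str_some h]

theorem w_some {i : ℕ} {ρ σ : Str} (h : I.f i = some (ρ, σ)) : I.dat.w i = (1/2) ^ ρ.length := by
  change pv (I.wD i) = _; simp [wD, h, pv]

/-! ### the machine -/

noncomputable def mreq (I : Inp) (ty : Bool) (r : ℕ) (m : ℕ) : Option (ℕ × Str) :=
  (I.f m.unpair.2).bind fun q =>
    cond (decide (m.unpair.2 < m.unpair.1) && (I.goodB ty m.unpair.2 m.unpair.1 &&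
      !decide (I.dat.preB (m.unpair.1 + 1) q.2.length = I.dat.preB m.unpair.1 q.2.length)))
      (some (q.1.length - r, I.dat.preB (m.unpair.1 + 1) q.2.length)) none

theorem mreq_pr (ty : Bool) (r : ℕ) : Primrec (I.mreq ty r) := by
  have h1 : Primrec fun i : ℕ => i.unpair.1 := Primrec.fst.comp Primrec.unpair
  have h2 : Primrec fun i : ℕ => i.unpair.2 := Primrec.snd.comp Primrec.unpair
  refine Primrec.option_bind (I.hf.comp h2) ?_
  have h1' : Primrec fun p : ℕ × (Str × Str) => p.1.unpair.1 := h1.comp Primrec.fst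
  have h2' : Primrec fun p : ℕ × (Str × Str) => p.1.unpair.2 := h2.comp Primrec.fst
  have hl : Primrec fun p : ℕ × (Str × Str) => p.2.2.length :=
    Primrec.list_length.comp (Primrec.snd.comp Primrec.snd)
  have hr : Primrec fun p : ℕ × (Str × Str) => p.2.1.length :=
    Primrec.list_length.comp (Primrec.fst.comp Primrec.snd)
  have hB := preB_pr (I := I) (Primrec.succ.comp h1') hl
  exact Primrec.cond (Primrec.and.comp (lt_pr h2' h1') (Primrec.and.comp (goodB_pr (Primrec.const ty) h2' h1')
    (Primrec.not.comp (eq_pr hB (preB_pr h1' hl)))))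
    (Primrec.option_some.comp (Primrec.pair (Primrec.nat_sub.comp hr (Primrec.const r)) hB)) (Primrec.const none)

theorem mreq_some {ty : Bool} {r i s : ℕ} {ρ σ : Str} (hf : I.f i = some (ρ, σ)) (hi : i < s)
    (hg : I.dat.good ty i s) (hB : I.dat.preB (s+1) σ.length ≠ I.dat.preB s σ.length) :
    I.mreq ty r (Nat.pair s i) = some (ρ.length - r, I.dat.preB (s+1) σ.length) := by
  simp [mreq, hf, hi, (I.goodB_iff ty i s).2 hg, hB]

theorem mreq_wt (ty : Bool) (r m : ℕ) : open Classical in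
    rwt (I.mreq ty r m) ≤ 2 ^ r * (if m.unpair.2 < m.unpair.1 ∧ I.dat.good ty m.unpair.2 m.unpair.1 ∧
      I.dat.preB (m.unpair.1 + 1) (I.dat.len m.unpair.2) ≠ I.dat.preB m.unpair.1 (I.dat.len m.unpair.2)
      then I.dat.w m.unpair.2 else 0) := by
  cases hf : I.f m.unpair.2 with
  | none =>
    simp only [mreq, hf, Option.bind_none, rwt]
    split_ifs
    · exact mul_nonneg (by positivity) (pv_nn _)
    · simp
  | some q =>
    obtain ⟨ρ, σ⟩ := q
    by_cases hc : m.unpair.2 < m.unpair.1 ∧ I.dat.good ty m.unpair.2 m.unpair.1 ∧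
      I.dat.preB (m.unpair.1 + 1) (I.dat.len m.unpair.2) ≠ I.dat.preB m.unpair.1 (I.dat.len m.unpair.2)
    · rw [if_pos hc, w_some hf]
      obtain ⟨c1, c2, c3⟩ := hc
      rw [len_some hf] at c3
      have := mreq_some (r := r) hf c1 c2 c3
      rw [Nat.pair_unpair] at this
      rw [this]
      simp only [rwt]
      rcases le_total r ρ.length with h | h
      · obtain ⟨k, hk⟩ := Nat.exists_eq_add_of_le h
        rw [hk, Nat.add_sub_cancel_left, pow_add, ← mul_assoc, ← mul_pow]; norm_num
      · obtain ⟨k, hk⟩ := Nat.exists_eq_add_of_le h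
        rw [Nat.sub_eq_zero_of_le h, hk, pow_add, mul_right_comm, ← mul_pow]; norm_num
        exact one_le_pow₀ (by norm_num)
    · rw [if_neg hc, mul_zero]
      rw [len_some hf, ← goodB_iff] at hc
      have : (decide (m.unpair.2 < m.unpair.1) && (I.goodB ty m.unpair.2 m.unpair.1 &&
        !decide (I.dat.preB (m.unpair.1 + 1) σ.length = I.dat.preB m.unpair.1 σ.length))) = false := by
        rw [Bool.eq_false_iff]; intro h; apply hc; simpa using h
      simp [mreq, hf, this, rwt]

theorem mreq_sum (h : I.OK) (ty : Bool) (r : ℕ) {p : ℝ}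
    (hp : ∀ T, open Classical in ∑ i ∈ Finset.range T, (if I.dat.kind i ≠ 0 then I.dat.τ i else 0) ≤ p) (T : ℕ) :
    ∑ m ∈ Finset.range T, rwt (I.mreq ty r m) ≤ 2 ^ r * p := by
  classical
  refine (Finset.sum_le_sum fun m _ => mreq_wt ty r m).trans ?_
  rw [← Finset.mul_sum]
  refine mul_le_mul_of_nonneg_left ?_ (by positivity)
  have hnn : ∀ i, 0 ≤ I.dat.w i := (I.good h).wnn
  refine (pair_sum (fun s i => if i < s ∧ I.dat.good ty i s ∧
      I.dat.preB (s + 1) (I.dat.len i) ≠ I.dat.preB s (I.dat.len i) then I.dat.w i else 0)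
      (fun a b => by split_ifs; exacts [hnn _, le_rfl]) T).trans ?_
  refine le_trans (Finset.sum_le_sum (g := fun s => if I.dat.kind (s+1) ≠ 0 then I.dat.τ (s+1) else 0) fun s hs => ?_) ?_
  · refine le_trans (le_of_eq ?_) ((I.good h).mach_cost ty s)
    have hs := Finset.mem_range.1 hs
    rw [← Finset.sum_filter, ← Finset.sum_filter]
    refine Finset.sum_congr ?_ fun _ _ => rfl
    ext i; simp only [Finset.mem_filter, Finset.mem_range]
    constructor
    · rintro ⟨_, h1, h2⟩; exact ⟨h1, h2⟩
    · rintro ⟨h1, h2⟩; exact ⟨by omega, h1, h2⟩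
  · have := hp (T+1)
    rw [Finset.sum_range_succ'] at this
    rw [if_neg (by simpa using (I.good h).kind0), add_zero] at this
    exact this

/-- initial outputs -/
noncomputable def mout (I : Inp) (ty : Bool) (ρ : Str) (m : ℕ) : Option Str :=
  (I.f m.unpair.1).bind fun q =>
    cond (decide (m.unpair.1 < m.unpair.2) && (decide (q.1 = ρ) && I.goodB ty m.unpair.1 m.unpair.2))
      (some (I.dat.preB m.unpair.2 q.2.length)) none

theorem mout_pr (ty : Bool) : Primrec fun p : Str × ℕ => I.mout ty p.1 p.2 := by
  have h1 : Primrec fun p : Str × ℕ => p.2.unpair.1 := Primrec.fst.comp (Primrec.unpair.comp Primrec.snd)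
  have h2 : Primrec fun p : Str × ℕ => p.2.unpair.2 := Primrec.snd.comp (Primrec.unpair.comp Primrec.snd)
  refine Primrec.option_bind (I.hf.comp h1) ?_
  have h1' := h1.comp (Primrec.fst (α := Str × ℕ) (β := Str × Str))
  have h2' := h2.comp (Primrec.fst (α := Str × ℕ) (β := Str × Str))
  have hl : Primrec fun p : (Str × ℕ) × (Str × Str) => p.2.2.length :=
    Primrec.list_length.comp (Primrec.snd.comp Primrec.snd)
  exact Primrec.cond (Primrec.and.comp (lt_pr h1' h2') (Primrec.and.comp
    (eq_pr (Primrec.fst.comp Primrec.snd) (Primrec.fst.comp Primrec.fst)) (goodB_pr (Primrec.const ty) h1' h2')))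
    (Primrec.option_some.comp (preB_pr h2' hl)) (Primrec.const none)

theorem mout_some {ty : Bool} {ρ τ : Str} {m : ℕ} (h : I.mout ty ρ m = some τ) :
    ∃ i s σ, I.f i = some (ρ, σ) ∧ i < s ∧ I.dat.good ty i s ∧ τ = I.dat.preB s σ.length := by
  obtain ⟨⟨ρ', σ⟩, h1, h2⟩ := Option.bind_eq_some_iff.1 h
  by_cases hc : (decide (m.unpair.1 < m.unpair.2) && (decide (ρ' = ρ) && I.goodB ty m.unpair.1 m.unpair.2)) = true
  · simp only [hc, cond_true] at h2
    simp only [Bool.and_eq_true, decide_eq_true_eq, goodB_iff] at hc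
    obtain ⟨c1, rfl, c3⟩ := hc
    cases h2
    exact ⟨_, _, σ, h1, c1, c3, rfl⟩
  · simp only [Bool.eq_false_iff.2 hc, cond_false] at h2; cases h2

theorem mout_mk {ty : Bool} {ρ σ : Str} {i s : ℕ} (hf : I.f i = some (ρ, σ)) (hi : i < s)
    (hg : I.dat.good ty i s) : I.mout ty ρ (Nat.pair i s) = some (I.dat.preB s σ.length) := by
  simp [mout, hf, hi, (I.goodB_iff ty i s).2 hg]

theorem machine {U : Str →. Str} {Y : Bool → Set ℕ} (hU : PFMachine U) (hI : I.Rl U Y) (ty : Bool) {p : ℝ}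
    (hp : ∀ T, open Classical in ∑ i ∈ Finset.range T, (if I.dat.kind i ≠ 0 then I.dat.τ i else 0) ≤ p)
    (ρ' : Str) {σ' : Str} (hσ : σ' ∈ U ρ') (hσ' : ∀ n, σ' ≠ restrSet (Y ty) n)
    (hr : 2 ^ ρ'.length * p ≤ 1/2)
    (hlen : ∀ i ρ σ, I.f i = some (ρ, σ) → I.n0 < σ.length → ρ'.length ≤ ρ.length) :
    ∃ M, PFMachine M ∧ ∀ n, KC M (restrSet I.Bset n) ≤ KC U (restrSet (Y ty) n) := by
  obtain ⟨N, ⟨hN1, hN2⟩, hN⟩ := kc_thm (I.mreq ty ρ'.length) (mreq_pr ty _).to_comp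
    (fun T => (mreq_sum hI.ok ty _ hp T).trans hr)
  set b : Str → Bool := fun ρ => decide (ρ = ρ' ++ ρ.drop ρ'.length) with hb
  have hbt : ∀ ρ, b ρ = true ↔ ρ' <+: ρ := by
    intro ρ; simp only [hb, decide_eq_true_eq]
    constructor
    · intro h; exact ⟨_, h.symm⟩
    · rintro ⟨t, rfl⟩; simp
  let M : Str →. Str := fun ρ => cond (b ρ) (N (ρ.drop ρ'.length)) (Nat.rfindOpt (I.mout ty ρ))
  have hdrop : Primrec fun ρ : Str => ρ.drop ρ'.length := Primrec.list_drop.comp (Primrec.const _) Primrec.id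
  have hbp : Primrec b := eq_pr Primrec.id (Primrec.list_append.comp (Primrec.const ρ') hdrop)
  have domM : ∀ ρ, b ρ = false → (M ρ).Dom → (U ρ).Dom := by
    intro ρ hρ hd
    simp only [M, hρ, cond_false] at hd
    obtain ⟨m, τ, h⟩ := Nat.rfindOpt_dom.1 hd
    obtain ⟨i, s, σ, hf, _⟩ := mout_some h
    exact Part.dom_iff_mem.2 ⟨σ, hI.sound _ _ _ hf⟩
  refine ⟨M, ⟨?_, ?_⟩, ?_⟩
  · exact Partrec.cond hbp.to_comp (hN1.comp hdrop.to_comp) (Partrec.rfindOpt (mout_pr ty).to_comp)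
  · intro ρ₁ ρ₂ h1 h2 h12
    cases hb1 : b ρ₁ with
    | true =>
      have hp1 := (hbt _).1 hb1
      have hp2 := hp1.trans h12
      have hb2 := (hbt _).2 hp2
      simp only [M, hb1, hb2, cond_true] at h1 h2
      have := hN2 _ _ h1 h2 (h12.drop _)
      simp only [hb, decide_eq_true_eq] at hb1 hb2
      rw [hb1, hb2, this]
    | false =>
      have d1 := domM _ hb1 h1
      cases hb2 : b ρ₂ with
      | true =>
        exfalso
        have hp2 := (hbt _).1 hb2
        have hd : (U ρ').Dom := Part.dom_iff_mem.2 ⟨_, hσ⟩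
        have : ρ₁ = ρ' := by
          rcases pfx_total h12 hp2 with h | h
          · exact hU.2 _ _ d1 hd h
          · exact (hU.2 _ _ hd d1 h).symm
        rw [this, (hbt ρ').2 (List.prefix_refl _)] at hb1
        cases hb1
      | false => exact hU.2 _ _ d1 (domM _ hb2 h2) h12
  · intro n
    refine le_KC fun ρ hρ => ?_
    obtain ⟨i, hi⟩ := hI.compl _ _ hρ
    have hln : (restrSet (Y ty) n).length = n := by simp [restrSet]
    obtain ⟨s1, hs1⟩ := pre_lim hI ty n
    obtain ⟨s2, hs2⟩ := preB_lim (I := I) n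
    have hbρ : b ρ = false := by
      rw [Bool.eq_false_iff]; intro h
      have := hU.2 _ _ (Part.dom_iff_mem.2 ⟨_, hσ⟩) (Part.dom_iff_mem.2 ⟨_, hρ⟩) ((hbt _).1 h)
      subst this
      exact hσ' n (Part.mem_unique hσ hρ)
    have good_iff : ∀ s, I.dat.good ty i s ↔ I.dat.pre ty s n = restrSet (Y ty) n := by
      intro s; rw [Dat.good, len_some hi, hln, str_some hi, eq_comm]
    have hdom : (M ρ).Dom := by
      simp only [M, hbρ, cond_false]
      refine Nat.rfindOpt_dom.2 ⟨Nat.pair i (max s1 (i+1)), _, mout_mk hi (by omega) ?_⟩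
      exact (good_iff _).2 (hs1 _ (by omega))
    obtain ⟨τ, hτ⟩ := Part.dom_iff_mem.1 hdom
    have hτ' := hτ
    simp only [M, hbρ, cond_false] at hτ
    obtain ⟨m, hm⟩ := Nat.rfindOpt_spec hτ
    obtain ⟨i', s0, σ, hf, his, hg, rfl⟩ := mout_some hm
    have hσe := Part.mem_unique (hI.sound _ _ _ hf) hρ
    subst hσe
    rw [hln] at hτ'
    have hg0 : I.dat.pre ty s0 n = restrSet (Y ty) n := by
      have := hg
      rw [Dat.good, len_some hf, hln, str_some hf] at this; exact this.symm
    have hgs : ∀ s ≥ s0, I.dat.good ty i' s := by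
      intro s hs
      rw [Dat.good, len_some hf, hln, str_some hf, ← hg0]
      refine (pre_btw hI.ok hs (le_max_left s s1) ?_).symm
      rw [hg0]; exact hs1 _ (le_max_right _ _)
    by_cases h0 : I.dat.preB s0 n = restrSet I.Bset n
    · rw [← h0]; exact KC_le hτ'
    · have hex : ∃ k, I.dat.preB (s0 + k) n = restrSet I.Bset n := ⟨s2, hs2 _ (by omega)⟩
      classical
      have hk := Nat.find_spec hex
      have hmin := fun m => Nat.find_min hex (m := m)
      cases hn : Nat.find hex with
      | zero => rw [hn] at hk; exact absurd hk h0
      | succ k =>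
        rw [hn] at hk hmin
        have hne : I.dat.preB (s0 + k + 1) n ≠ I.dat.preB (s0 + k) n := by
          intro h; exact hmin k (by omega) (h ▸ hk)
        have hreq := mreq_some (r := ρ'.length) (s := s0 + k) hf (by omega) (hgs _ (by omega)) (by rw [hln]; exact hne)
        rw [hln] at hreq
        obtain ⟨ν, hν1, hν2⟩ := hN _ _ _ hreq
        have hMν : restrSet I.Bset n ∈ M (ρ' ++ ν) := by
          have : b (ρ' ++ ν) = true := (hbt _).2 (List.prefix_append _ _)
          simp only [M, this, cond_true, List.drop_left]
          rw [← hk]; exact hν2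
        have hle := hlen i' ρ _ hf (by
          rw [hln]
          exact (Dat.base_ge (C := I.dat) _ _).1.trans_lt (Dat.preB_ne hne).2)
        refine (KC_le hMν).trans ?_
        rw [List.length_append, hν1]
        exact_mod_cast (by omega : ρ'.length + (ρ.length - ρ'.length) ≤ ρ.length)

end Inp
end KPaper


namespace KPaper
namespace Inp
variable {I : Inp}

def doneB (I : Inp) (ty : Bool) (e s0 : ℕ) (g : Dy) (j s : ℕ) : Bool :=
  !decide (s < s0) && !dlt (I.alphaL (I.hist s) ty e s) (dmul g (I.SD (j+1)))

def frstB (I : Inp) (ty : Bool) (e s0 : ℕ) (g : Dy) (j s : ℕ) : Bool :=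
  I.doneB ty e s0 g j s && (Nat.rec true (fun s' acc => acc && !(I.doneB ty e s0 g j s' &&
    decide (I.preX ty s' (I.strF j).length = I.preX ty s (I.strF j).length))) s : Bool)

def treq (I : Inp) (ty : Bool) (e s0 : ℕ) (g : Dy) (k m : ℕ) : Option (ℕ × Str) :=
  (I.f m.unpair.1).bind fun q => cond (I.frstB ty e s0 g m.unpair.1 m.unpair.2)
    (some (q.1.length + k, I.preX ty m.unpair.2 q.2.length)) none

theorem doneB_pr {β : Type*} [Primcodable β] (ty : Bool) (e s0 : ℕ) (g : Dy) {j s : β → ℕ} (hj : Primrec j)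
    (hs : Primrec s) : Primrec fun z => I.doneB ty e s0 g (j z) (s z) :=
  Primrec.and.comp (Primrec.not.comp (lt_pr hs (Primrec.const s0)))
    (Primrec.not.comp (dlt_pr (alphaL_pr (hist_pr hs) (Primrec.const ty) (Primrec.const e) hs)
      (dmul_pr (Primrec.const g) (SD_pr (Primrec.succ.comp hj)))))

theorem frstB_pr {β : Type*} [Primcodable β] (ty : Bool) (e s0 : ℕ) (g : Dy) {j s : β → ℕ} (hj : Primrec j)
    (hs : Primrec s) : Primrec fun z => I.frstB ty e s0 g (j z) (s z) := by
  refine Primrec.and.comp (doneB_pr ty e s0 g hj hs) ?_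
  have h0 : Primrec fun p : β × ℕ × Bool => p.1 := Primrec.fst
  have h1 : Primrec fun p : β × ℕ × Bool => p.2.1 := Primrec.fst.comp Primrec.snd
  have h2 : Primrec fun p : β × ℕ × Bool => p.2.2 := Primrec.snd.comp Primrec.snd
  have hl := Primrec.list_length.comp (strF_pr (I := I) (hj.comp h0))
  exact rec_pr (g := fun _ => true) (h := fun z s' acc => acc && !(I.doneB ty e s0 g (j z) s' &&
    decide (I.preX ty s' (I.strF (j z)).length = I.preX ty (s z) (I.strF (j z)).length))) hs (Primrec.const true)
    (Primrec.and.comp h2 (Primrec.not.comp (Primrec.and.comp (doneB_pr ty e s0 g (hj.comp h0) h1)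
      (eq_pr (preX_pr (Primrec.const ty) h1 hl) (preX_pr (Primrec.const ty) (hs.comp h0) hl)))))

theorem treq_pr (ty : Bool) (e s0 : ℕ) (g : Dy) (k : ℕ) : Primrec (I.treq ty e s0 g k) := by
  have h1 : Primrec fun i : ℕ => i.unpair.1 := Primrec.fst.comp Primrec.unpair
  have h2 : Primrec fun i : ℕ => i.unpair.2 := Primrec.snd.comp Primrec.unpair
  refine Primrec.option_bind (I.hf.comp h1) ?_
  have h1' : Primrec fun p : ℕ × (Str × Str) => p.1.unpair.1 := h1.comp Primrec.fst
  have h2' : Primrec fun p : ℕ × (Str × Str) => p.1.unpair.2 := h2.comp Primrec.fst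
  have hl : Primrec fun p : ℕ × (Str × Str) => p.2.2.length :=
    Primrec.list_length.comp (Primrec.snd.comp Primrec.snd)
  have hr : Primrec fun p : ℕ × (Str × Str) => p.2.1.length :=
    Primrec.list_length.comp (Primrec.fst.comp Primrec.snd)
  exact Primrec.cond (frstB_pr ty e s0 g h1' h2') (Primrec.option_some.comp (Primrec.pair
    (Primrec.nat_add.comp hr (Primrec.const k)) (preX_pr (Primrec.const ty) h2' hl))) (Primrec.const none)

theorem doneB_iff {ty : Bool} {e s0 : ℕ} {g : Dy} {j s : ℕ} :
    I.doneB ty e s0 g j s = true ↔ I.dat.done ty e s0 (pv g) j s := by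
  rw [Dat.done, S_eq, α_eq, ← pv_dmul, ← not_lt (b := pv (dmul _ _)), ← dlt_iff]
  simp [doneB]

theorem frstB_iff {ty : Bool} {e s0 : ℕ} {g : Dy} {j s : ℕ} :
    I.frstB ty e s0 g j s = true ↔ I.dat.frst ty e s0 (pv g) j s := by
  rw [frstB, Dat.frst, Bool.and_eq_true, doneB_iff]
  refine and_congr_right fun _ => ?_
  have : ∀ n, (Nat.rec true (fun s' acc => acc && !(I.doneB ty e s0 g j s' &&
    decide (I.preX ty s' (I.strF j).length = I.preX ty s (I.strF j).length))) n : Bool) = true ↔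
    ∀ s' < n, I.dat.done ty e s0 (pv g) j s' → I.dat.pre ty s' (I.dat.len j) ≠ I.dat.pre ty s (I.dat.len j) := by
    intro n
    induction n with
    | zero => simp
    | succ n ih =>
      simp only [Bool.and_eq_true, Bool.not_eq_true', Bool.and_eq_false_imp, decide_eq_false_iff_not]
      rw [ih, doneB_iff, Nat.forall_lt_succ_right]
      rfl
  exact this s

theorem treq_some {ty : Bool} {e s0 : ℕ} {g : Dy} {k j s : ℕ} {ρ σ : Str} (hf : I.f j = some (ρ, σ))
    (h : I.dat.frst ty e s0 (pv g) j s) :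
    I.treq ty e s0 g k (Nat.pair j s) = some (ρ.length + k, I.dat.pre ty s σ.length) := by
  simp [treq, hf, frstB_iff.2 h]; rfl

theorem treq_wt {ty : Bool} {e s0 : ℕ} {g : Dy} {k : ℕ} (m : ℕ) : open Classical in
    rwt (I.treq ty e s0 g k m) ≤ (1/2)^k *
      (if I.dat.frst ty e s0 (pv g) m.unpair.1 m.unpair.2 then I.dat.w m.unpair.1 else 0) := by
  cases hf : I.f m.unpair.1 with
  | none =>
    simp only [treq, hf, Option.bind_none, rwt]
    split_ifs
    · exact mul_nonneg (by positivity) (pv_nn _)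
    · simp
  | some q =>
    obtain ⟨ρ, σ⟩ := q
    by_cases hc : I.dat.frst ty e s0 (pv g) m.unpair.1 m.unpair.2
    · rw [if_pos hc, w_some hf]
      have := treq_some (k := k) hf hc
      rw [Nat.pair_unpair] at this
      rw [this]
      simp only [rwt]
      rw [pow_add, mul_comm]
    · rw [if_neg hc, mul_zero]
      rw [← frstB_iff] at hc
      simp [treq, hf, Bool.eq_false_iff.2 hc, rwt]

theorem triv {U : Str →. Str} {Y : Bool → Set ℕ} (hU : OptimalPF U) (hI : I.Rl U Y)
    (hnt : ∀ ty, ¬ KTrivialSet U (Y ty)) {q : ℝ}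
    (hq : ∀ T, open Classical in ∑ i ∈ Finset.range T, (if I.dat.Ev i then I.dat.τ i else 0) ≤ q)
    (e s0 : ℕ) (Γ : ℝ) (h : I.dat.Stab e s0 Γ) : ∃ n, ∀ i ≥ n, I.dat.Ev i → I.dat.lev i ≠ e := by
  by_contra hcon
  push Not at hcon
  obtain ⟨ty, hty⟩ := (I.good hI.ok).inf_done hq h hcon
  apply hnt ty
  set g := I.GD (I.hist s0) s0 e with hg
  have hΓ : Γ = pv g := by rw [← (h.2 s0 le_rfl).2, G_eq]
  have hpos := h.1
  rw [hΓ] at h hpos hty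
  obtain ⟨k, hk⟩ : ∃ k : ℕ, (1/2 : ℝ)^k * (q / pv g) ≤ 1/2 := by
    have hq0 : 0 ≤ q := by simpa using hq 0
    obtain ⟨k, hk⟩ := exists_pow_lt_of_lt_one (show (0:ℝ) < 1/2 / (q / pv g + 1) by positivity) (show (1/2:ℝ) < 1 by norm_num)
    refine ⟨k, ?_⟩
    have h0 : 0 ≤ q / pv g := by positivity
    rw [lt_div_iff₀ (by positivity)] at hk
    have : (0:ℝ) < (1/2)^k := by positivity
    nlinarith
  have hsum : ∀ T, ∑ m ∈ Finset.range T, rwt (I.treq ty e s0 g k m) ≤ 1/2 := by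
    intro T
    classical
    refine (Finset.sum_le_sum fun m _ => treq_wt m).trans ?_
    rw [← Finset.mul_sum]
    refine le_trans (mul_le_mul_of_nonneg_left ?_ (by positivity)) hk
    refine (pair_sum (fun j s => if I.dat.frst ty e s0 (pv g) j s then I.dat.w j else 0)
      (fun a b => by split_ifs; exacts [(I.good hI.ok).wnn _, le_rfl]) T).trans ?_
    rw [le_div_iff₀ hpos, mul_comm, Finset.mul_sum]
    refine le_trans (le_of_eq ?_) ((I.good hI.ok).frst_sum hq h T (ty := ty))
    refine Finset.sum_congr rfl fun j _ => ?_
    rw [Finset.mul_sum]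
    refine Finset.sum_congr rfl fun s _ => ?_
    split_ifs <;> simp
  obtain ⟨N, hN, hN'⟩ := kc_thm _ (treq_pr ty e s0 g k).to_comp hsum
  obtain ⟨c, hc⟩ := hU.2 N hN
  refine ⟨k + c, fun n => ?_⟩
  refine (hc _).trans ?_
  push_cast
  rw [← add_assoc]
  gcongr
  rw [← tsub_le_iff_right]
  refine le_KC fun ρ hρ => ?_
  rw [tsub_le_iff_right]
  obtain ⟨j, hj⟩ := hI.compl _ _ hρ
  have hln : (zeroStr n).length = n := by simp [zeroStr]
  obtain ⟨s1, hs1⟩ := pre_lim hI ty n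
  have hex : ∃ s, I.dat.done ty e s0 (pv g) j s ∧ I.dat.pre ty s n = restrSet (Y ty) n := by
    obtain ⟨s, hs, hs'⟩ := hty j (max s0 s1)
    exact ⟨s, ⟨by omega, hs'⟩, hs1 s (by omega)⟩
  classical
  obtain ⟨f1, f2⟩ := Nat.find_spec hex
  have fm := fun m => Nat.find_min hex (m := m)
  set s := Nat.find hex
  have hfr : I.dat.frst ty e s0 (pv g) j s := by
    refine ⟨f1, fun s' hs' hd he => fm s' hs' ⟨hd, ?_⟩⟩
    rw [len_some hj, hln] at he
    rw [he, f2]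
  have hreq := treq_some (k := k) hj hfr
  rw [hln, f2] at hreq
  obtain ⟨ν, hν1, hν2⟩ := hN' _ _ _ hreq
  refine (KC_le hν2).trans ?_
  rw [hν1]; push_cast; exact le_rfl

end Inp
end KPaper


namespace KPaper
open Nat.Partrec (Code)
open Nat.Partrec.Code (evaln eval)

/-! ### Turing reductions -/

theorem rec_of_partrec {O f : ℕ →. ℕ} (h : Nat.Partrec f) : RecursiveIn O f := by
  induction h with
  | zero => exact .zero
  | succ => exact .succ
  | left => exact .left
  | right => exact .right
  | pair _ _ h1 h2 => exact .pair h1 h2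
  | comp _ _ h1 h2 => exact .comp h1 h2
  | prec _ _ h1 h2 => exact .prec h1 h2
  | rfind _ h => exact .rfind h

theorem ce_le_halt {B : Set ℕ} (h : CESet B) : TuringLeSet B haltingSet := by
  obtain ⟨f, hf, h⟩ := h
  obtain ⟨c, rfl⟩ := Nat.Partrec.Code.exists_code.1 hf
  let r : ℕ → ℕ := fun e => Encodable.encode (Code.curry (Code.comp c Code.left) e)
  have hr : Computable r := by
    have : Primrec r := Primrec.encode.comp (Nat.Partrec.Code.primrec₂_curry.comp (Primrec.const _) Primrec.id)
    exact this.to_comp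
  have hr' : RecursiveIn (chi haltingSet) (fun n => Part.some (r n)) := rec_of_partrec (Partrec.nat_iff.1 hr)
  have hm : ∀ n, r n ∈ haltingSet ↔ n ∈ B := by
    intro n
    rw [h]
    change ((Denumerable.ofNat Code (r n)).eval (r n)).Dom ↔ _
    rw [show Denumerable.ofNat Code (r n) = Code.curry (Code.comp c Code.left) n from Denumerable.ofNat_encode _,
      Nat.Partrec.Code.eval_curry]
    simp [Nat.Partrec.Code.eval]
    exact Iff.of_eq (congrArg Part.Dom (Part.bind_some n c.eval))
  have := RecursiveIn.comp (RecursiveIn.oracle (O := chi haltingSet)) hr'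
  unfold TuringLeSet
  have e : chi B = fun n => Part.some (r n) >>= chi haltingSet := by
    funext n
    refine Eq.trans ?_ (Part.bind_some (r n) (chi haltingSet)).symm
    by_cases hn : n ∈ B
    · have h2 := (hm n).2 hn
      simp [chi, hn, h2]
    · have h2 : r n ∉ haltingSet := fun h => hn ((hm n).1 h)
      simp [chi, hn, h2]
  rw [e]; exact this

namespace Inp
variable {I : Inp}

theorem ce_B : CESet I.Bset := by
  refine ⟨fun n => Nat.rfindOpt fun s => cond (I.dat.Bs s n) (some 0) none, ?_, fun n => ?_⟩
  · refine Partrec.nat_iff.1 (Partrec.rfindOpt ?_)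
    have : Primrec fun p : ℕ × ℕ => cond (I.dat.Bs p.2 p.1) (some 0) (none : Option ℕ) :=
      Primrec.cond (Bs_pr Primrec.snd Primrec.fst) (Primrec.const _) (Primrec.const _)
    exact this.to_comp
  · rw [Nat.rfindOpt_dom]
    change (∃ s, _) ↔ _
    refine exists_congr fun s => ?_
    cases I.dat.Bs s n <;> simp

theorem halt_le_B {U : Str →. Str} {Y : Bool → Set ℕ} (hI : I.Rl U Y)
    (hlim : ∀ e, ∃ s1, ∀ s ≥ s1, I.dat.base s e = I.dat.base s1 e) : TuringLeSet haltingSet I.Bset := by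
  choose s1 hs1 using hlim
  have hG := I.good hI.ok
  let b : ℕ → ℕ := fun e => I.dat.base (s1 e) e
  have hle : ∀ s e, I.dat.base s e ≤ b e := by
    intro s e
    refine (Dat.base_mono_s (le_max_left s (s1 e)) e).trans ?_
    rw [hs1 e _ (le_max_right _ _)]
  have hB : ∀ e n, Nat.pair e n ∈ I.Bset ↔ n < b e := by
    intro e n
    change (∃ s, I.dat.Bs s (Nat.pair e n) = true) ↔ _
    simp only [Dat.Bs, Nat.unpair_pair, decide_eq_true_eq]
    exact ⟨fun ⟨s, h⟩ => h.trans_le (hle s e), fun h => ⟨_, h⟩⟩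
  have hH : ∀ e, e ∈ haltingSet ↔ I.H (b e) e = true := by
    intro e
    rw [hI.Hlim]
    refine ⟨fun hex => ?_, fun h => ⟨_, h⟩⟩
    classical
    have f1 := Nat.find_spec hex
    have fm := fun m => Nat.find_min hex (m := m)
    refine hG.H_le (s := Nat.find hex) (C := I.dat) ?_ f1
    cases hn : Nat.find hex with
    | zero => exact Nat.zero_le _
    | succ n =>
      rw [hn] at f1 fm
      by_cases he : e < n + 1
      · have h2 : I.H n e = false := by simpa using fm n (by omega)
        obtain ⟨k1, k2⟩ := hG.code' n e f1 h2 he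
        exact (Dat.base_act k1 k2).trans (hle _ _)
      · exact le_trans (by omega) (Dat.base_ge (C := I.dat) (s1 e) e).2
  have hL : RecursiveIn (chi I.Bset) (fun e => Part.some (b e)) := by
    have := RecursiveIn.rfind (RecursiveIn.oracle (O := chi I.Bset))
    refine (congrArg (RecursiveIn (chi I.Bset)) ?_).mp this
    funext e
    refine Part.eq_some_iff.2 (Nat.mem_rfind.2 ⟨?_, ?_⟩)
    · have h0 : chi I.Bset (Nat.pair e (b e)) = Part.some 0 := by
        have : Nat.pair e (b e) ∉ I.Bset := fun h => lt_irrefl _ ((hB e _).1 h)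
        simp [chi, this]
      refine (Part.mem_map_iff _).2 ⟨0, ?_, by simp⟩
      rw [h0]; exact Part.mem_some 0
    · intro m hm
      have h0 : chi I.Bset (Nat.pair e m) = Part.some 1 := by
        have : Nat.pair e m ∈ I.Bset := (hB e _).2 hm
        simp [chi, this]
      refine (Part.mem_map_iff _).2 ⟨1, ?_, by simp⟩
      rw [h0]; exact Part.mem_some 1
  have hid : RecursiveIn (chi I.Bset) (fun e => Part.some e) := rec_of_partrec (Partrec.nat_iff.1 Computable.id)
  have hg : RecursiveIn (chi I.Bset) (fun p => Part.some (cond (I.H p.unpair.2 p.unpair.1) 1 0)) := by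
    refine rec_of_partrec (Partrec.nat_iff.1 ?_)
    have : Primrec fun p : ℕ => cond (I.H p.unpair.2 p.unpair.1) 1 0 :=
      Primrec.cond (I.hH.comp (Primrec.pair (Primrec.snd.comp Primrec.unpair) (Primrec.fst.comp Primrec.unpair)))
        (Primrec.const 1) (Primrec.const 0)
    exact this.to_comp
  have := RecursiveIn.comp hg (RecursiveIn.pair hid hL)
  unfold TuringLeSet
  refine (congrArg (RecursiveIn (chi I.Bset)) ?_).mp this
  funext e
  have e1 : (Nat.pair <$> Part.some e <*> Part.some (b e)) = Part.some (Nat.pair e (b e)) := by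
    simp [Seq.seq]
  rw [e1]
  refine (Part.bind_some _ _).trans ?_
  simp only [chi, Nat.unpair_pair, hH]
  cases I.H (b e) e <;> simp

end Inp

/-! ### inputs -/

theorem mkInp {U : Str →. Str} (hU : OptimalPF U) (Y : Bool → Set ℕ) (hY : ∀ ty, CESet (Y ty)) :
    ∃ F : ℕ → ℕ → Inp, ∀ n0 k0, (F n0 k0).n0 = n0 ∧ (F n0 k0).k0 = k0 ∧ (F n0 k0).f = (F 0 0).f ∧
      (F n0 k0).Rl U Y := by
  obtain ⟨f, hf, h1, h2, h3⟩ := enum_U hU.1.1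
  choose c hc using fun ty => ce_approx (hY ty)
  obtain ⟨cH, hcH⟩ := ce_approx ce_halt
  have hX : Primrec fun p : Bool × ℕ × ℕ => (evaln p.2.1 (cond p.1 (c true) (c false)) p.2.2).isSome :=
    Primrec.option_isSome.comp (evaln_pr (Primrec.fst.comp Primrec.snd)
      (Primrec.cond Primrec.fst (Primrec.const _) (Primrec.const _)) (Primrec.snd.comp Primrec.snd))
  have hH : Primrec fun p : ℕ × ℕ => (evaln p.1 cH p.2).isSome :=
    Primrec.option_isSome.comp (evaln_pr Primrec.fst (Primrec.const _) Primrec.snd)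
  have hce : ∀ ty, (cond ty (c true) (c false)) = c ty := by intro ty; cases ty <;> rfl
  refine ⟨fun n0 k0 => ⟨f, fun ty s y => (evaln s (cond ty (c true) (c false)) y).isSome,
    fun s y => (evaln s cH y).isSome, n0, k0, hf, hX, hH⟩, fun n0 k0 => ⟨rfl, rfl, rfl, ?_⟩⟩
  set I : Inp := ⟨f, fun ty s y => (evaln s (cond ty (c true) (c false)) y).isSome,
    fun s y => (evaln s cH y).isSome, n0, k0, hf, hX, hH⟩ with hIdef
  have Xlim : ∀ ty n, n ∈ Y ty ↔ ∃ s, I.X ty s n = true := by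
    intro ty n
    simp only [hIdef, hce]; exact hc ty n
  have Xmono : ∀ ty s y, I.X ty s y = true → I.X ty (s+1) y = true := by
    intro ty s y h
    exact ce_mono _ _ _ h
  have Xmono' : ∀ ty s s' y, s ≤ s' → I.X ty s y = true → I.X ty s' y = true := by
    intro ty s s' y hs h
    induction s', hs using Nat.le_induction with
    | base => exact h
    | succ n _ ih => exact Xmono _ _ _ ih
  refine ⟨fun i ρ σ h => (h1 i ρ σ h).1, h2, Xlim, hcH, ⟨Xmono, fun s y h => ce_mono _ _ _ h, ?_, ?_, ?_⟩⟩
  · exact kraft_enum hU.1 f (fun i ρ σ h => (h1 i ρ σ h).1) h3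
  · intro i
    change (((f i).map fun q => q.2).getD []).length ≤ i
    cases hi : f i with
    | none => simp
    | some q => simpa using (h1 i q.1 q.2 hi).2
  · intro ty n
    obtain ⟨ρ, hρ⟩ := opt_desc hU (restrSet (Y ty) (n+1))
    obtain ⟨i, hi⟩ := h2 _ _ hρ
    have hi : I.f i = some (ρ, restrSet (Y ty) (n+1)) := hi
    have hl : (restrSet (Y ty) (n+1)).length = n + 1 := by simp [restrSet]
    have hlen := Inp.len_some hi
    rw [hl] at hlen
    refine ⟨i, ?_, ?_, ?_⟩
    · change n < I.dat.len i; omega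
    · change 0 < I.dat.w i; rw [Inp.w_some hi]; positivity
    · obtain ⟨s0, h0⟩ := Inp.conv_aux (I.X ty) (fun s s' n => Xmono' ty s s' n) (n+1)
      refine ⟨s0, fun s hs => ?_⟩
      rw [Dat.good, hlen, Inp.str_some hi]
      exact (restr_eq fun i hi => (h0 s hs i hi).trans (Xlim ty i).symm).symm

theorem tail_small {C : Dat} (hC : C.Good) {ε : ℝ} (hε : 0 < ε) : ∃ N, ∀ T,
    open Classical in ∑ k ∈ Finset.range T, (if N < C.len k then C.w k else 0) ≤ ε := by
  have hbdd : BddAbove (Set.range C.S) := ⟨1, by rintro _ ⟨T, rfl⟩; exact hC.wsum T⟩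
  obtain ⟨N, hN⟩ := exists_lt_of_lt_ciSup (show (⨆ T, C.S T) - ε < ⨆ T, C.S T by linarith)
  refine ⟨N, fun T => ?_⟩
  have h1 : C.S (max T N) ≤ ⨆ T, C.S T := le_ciSup hbdd _
  have h2 : C.S N + ∑ k ∈ Finset.Ico N (max T N), C.w k = C.S (max T N) :=
    Finset.sum_range_add_sum_Ico _ (le_max_right _ _)
  refine le_trans ?_ (show ∑ k ∈ Finset.Ico N (max T N), C.w k ≤ ε by linarith)
  classical
  rw [← Finset.sum_filter]
  refine Finset.sum_le_sum_of_subset_of_nonneg ?_ fun _ _ _ => hC.wnn _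
  intro k hk
  simp only [Finset.mem_filter, Finset.mem_range, Finset.mem_Ico] at *
  have := hC.len_le k
  omega

theorem stmt16_main (U : Str →. Str) (hU : OptimalPF U)
    (A D : Set ℕ) (hA : CESet A) (hD : CESet D)
    (hAnt : ¬ KTrivialSet U A) (hDnt : ¬ KTrivialSet U D) :
    ∃ (B : Set ℕ) (Ma Md : Str →. Str), CESet B ∧ PFMachine Ma ∧ PFMachine Md ∧
      TuringEquivSet B haltingSet ∧
      (∀ n, KC Ma (restrSet B n) ≤ KC U (restrSet A n)) ∧
      (∀ n, KC Md (restrSet B n) ≤ KC U (restrSet D n)) := by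
  classical
  let Y : Bool → Set ℕ := fun ty => cond ty D A
  have hY : ∀ ty, CESet (Y ty) := by intro ty; cases ty; exacts [hA, hD]
  have hnt : ∀ ty, ¬ KTrivialSet U (Y ty) := by intro ty; cases ty; exacts [hAnt, hDnt]
  obtain ⟨F, hF⟩ := mkInp hU Y hY
  let σ' : Bool → Str := fun ty => [!decide (0 ∈ Y ty)]
  have hσ' : ∀ ty n, σ' ty ≠ restrSet (Y ty) n := by
    intro ty n h
    have hn : n = 1 := by simpa [σ', restrSet] using (congrArg List.length h).symm
    subst hn
    by_cases h0 : 0 ∈ Y ty <;> simp [σ', restrSet, h0] at h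
  choose ρ' hρ' using fun ty => opt_desc hU (σ' ty)
  let R := max (ρ' false).length (ρ' true).length
  have hR : ∀ ty, (ρ' ty).length ≤ R := by intro ty; cases ty; exacts [le_max_left _ _, le_max_right _ _]
  obtain ⟨N, hN⟩ := tail_small ((F 0 0).good (hF 0 0).2.2.2.ok) (show (0:ℝ) < (1/2)^R / 16 by positivity)
  obtain ⟨e1, e2, e3, hI⟩ := hF N (R+3)
  set I := F N (R+3) with hIdef
  have hstr : I.dat.str = (F 0 0).dat.str := by funext i; change I.strF i = (F 0 0).strF i; simp [Inp.strF, e3]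
  have hw : I.dat.w = (F 0 0).dat.w := by funext i; change pv (I.wD i) = pv ((F 0 0).wD i); simp [Inp.wD, e3]
  have hn0 : I.dat.n0 = N := e1
  have hgg : I.dat.g = (1/2)^R / 8 := by change pv (1, I.k0) = _; rw [e2]; simp [pv, pow_add]; field_simp; norm_num
  have hq : ∀ T, ∑ k ∈ Finset.range T, (if I.dat.n0 < I.dat.len k then I.dat.w k else 0) ≤ (1/2)^R / 16 := by
    intro T
    have hlen : ∀ k, I.dat.len k = (F 0 0).dat.len k := fun k => by simp only [Dat.len, hstr]
    refine le_trans (le_of_eq (Finset.sum_congr rfl fun k _ => ?_)) (hN T)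
    simp only [hn0, hlen, hw]
  have hG := I.good hI.ok
  have hlim := hG.limits (Inp.triv hU hI hnt (hG.ev_sum hq))
  have hm : ∀ ty, ∃ M, PFMachine M ∧ ∀ n, KC M (restrSet I.Bset n) ≤ KC U (restrSet (Y ty) n) := by
    intro ty
    have hpow : (2:ℝ)^(ρ' ty).length * (1/2)^R ≤ 1 := by
      obtain ⟨k, hk⟩ := Nat.exists_eq_add_of_le (hR ty)
      rw [hk, pow_add, ← mul_assoc, ← mul_pow]; norm_num
      exact pow_le_one₀ (by norm_num) (by norm_num)
    refine Inp.machine hU.1 hI ty (hG.pay_sum hq) (ρ' ty) (hρ' ty) (hσ' ty) ?_ ?_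
    · rw [hgg]; nlinarith
    · intro i ρ σ hf hlt
      by_contra hcon
      push Not at hcon
      have h1 : I.dat.w i ≤ (1/2)^R / 16 := by
        refine le_trans ?_ (hq (i+1))
        refine le_trans ?_ (Finset.single_le_sum (f := fun k => if I.dat.n0 < I.dat.len k then I.dat.w k else 0)
          (fun k _ => by split_ifs; exacts [hG.wnn _, le_rfl]) (Finset.mem_range.2 (Nat.lt_succ_self i)))
        have : I.dat.n0 < I.dat.len i := by rw [Inp.len_some hf]; exact hlt
        rw [if_pos this]
      rw [Inp.w_some hf] at h1
      have h2 : (1/2:ℝ)^R ≤ (1/2)^ρ.length :=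
        pow_le_pow_of_le_one (by norm_num) (by norm_num) (hcon.le.trans (hR ty))
      have : (0:ℝ) < (1/2)^ρ.length := by positivity
      linarith
  obtain ⟨Ma, a1, a2⟩ := hm false
  obtain ⟨Md, d1, d2⟩ := hm true
  exact ⟨I.Bset, Ma, Md, Inp.ce_B, a1, d1, ⟨ce_le_halt Inp.ce_B, Inp.halt_le_B hI hlim⟩, a2, d2⟩

end KPaper

section
open Part Filter
open scoped Classical
namespace KPaper
/-- For any c.e. sets `A`, `D`, neither `K`-trivial, there are a c.e.
set `B` and prefix-free machines `M_a`, `M_d` with `B ≡_T ∅'`,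
`K_{M_a}(B↾n) ≤ K(A↾n)` and `K_{M_d}(B↾n) ≤ K(D↾n)` for all `n`. -/
theorem stmt16 (U : Str →. Str) (hU : OptimalPF U)
    (A D : Set ℕ) (hA : CESet A) (hD : CESet D)
    (hAnt : ¬ KTrivialSet U A) (hDnt : ¬ KTrivialSet U D) :
    ∃ (B : Set ℕ) (Ma Md : Str →. Str), CESet B ∧ PFMachine Ma ∧ PFMachine Md ∧
      TuringEquivSet B haltingSet ∧
      (∀ n, KC Ma (restrSet B n) ≤ KC U (restrSet A n)) ∧
      (∀ n, KC Md (restrSet B n) ≤ KC U (restrSet D n)) := by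
  exact stmt16_main U hU A D hA hD hAnt hDnt

end KPaper
end
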